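/- For every γ > 0, if p = p(n) ≥ n^{γ−1/2}, then a.a.s. Γ = G(n,p) has the following property: every spanning subgraph G ⊆ Γ obtained by deleting, at each vertex v, at most (1/3 − γ)·deg_Γ(v) of the edges incident to v, contains the square of a cycle on at least (1−γ)n vertices. In other words, the local resilience of G(n,p) with respect to containing the square of a cycle on at least (1−γ)n vertices is a.a.s. at least 1/3 − γ. -/

import Mathlib

open MeasureTheory Filter Topology

/-- Bernoulli measure on `Bool` with success probability `p` (clamped to `[0,1]`). -/
noncomputable def bernoulliMeasure (p : ℝ) : Measure Bool :=
  (min (ENNReal.ofReal p) 1) • Measure.dirac true +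
    (1 - min (ENNReal.ofReal p) 1) • Measure.dirac false

/-- The distribution of the binomial random graph `G(n,p)`, as a product of independent
Bernoulli measures, one for each potential edge. -/
noncomputable def gnp (n : ℕ) (p : ℝ) : Measure (Sym2 (Fin n) → Bool) :=
  Measure.pi fun _ => bernoulliMeasure p

/-- The simple graph on `[n]` determined by an outcome of the edge indicators. -/
def graphOf {n : ℕ} (ω : Sym2 (Fin n) → Bool) : SimpleGraph (Fin n) :=
  SimpleGraph.fromRel fun u v => ω s(u, v) = true

/-- `G` contains a (not necessarily induced) copy of `H`. -/
def ContainsCopy {α β : Type*} (H : SimpleGraph α) (G : SimpleGraph β) : Prop :=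
  ∃ f : α → β, Function.Injective f ∧ ∀ ⦃u v⦄, H.Adj u v → G.Adj (f u) (f v)

/-- The maximum degree of a graph on a finite vertex type. -/
noncomputable def maxDeg {V : Type*} [Fintype V] (G : SimpleGraph V) : ℕ :=
  Finset.univ.sup fun v => (G.neighborSet v).ncard

/-- The maximum 0-density `m₀(H)`. -/
noncomputable def m0 {V : Type*} [Fintype V] (H : SimpleGraph V) : ℝ :=
  sSup {x : ℝ | ∃ H' : H.Subgraph, H'.verts.Nonempty ∧
    x = (H'.edgeSet.ncard : ℝ) / (H'.verts.ncard : ℝ)}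

/-- The maximum 1-density `m₁(H)`. -/
noncomputable def m1 {V : Type*} [Fintype V] (H : SimpleGraph V) : ℝ :=
  sSup {x : ℝ | ∃ H' : H.Subgraph, 1 < H'.verts.ncard ∧
    x = (H'.edgeSet.ncard : ℝ) / ((H'.verts.ncard : ℝ) - 1)}

/-- The maximum 2-density `m₂(H)`. -/
noncomputable def m2 {V : Type*} [Fintype V] (H : SimpleGraph V) : ℝ :=
  sSup {x : ℝ | ∃ H' : H.Subgraph, 0 < H'.edgeSet.ncard ∧
    x = if 2 < H'.verts.ncard
      then ((H'.edgeSet.ncard : ℝ) - 1) / ((H'.verts.ncard : ℝ) - 2)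
      else 1 / 2}

/-- The maximum Riordan-density `m_R(H)`. -/
noncomputable def mR {V : Type*} [Fintype V] (H : SimpleGraph V) : ℝ :=
  sSup {x : ℝ | ∃ H' : H.Subgraph, 2 < H'.verts.ncard ∧
    x = (H'.edgeSet.ncard : ℝ) / ((H'.verts.ncard : ℝ) - 2)}

/-- The local 1-density `m₁(x,H)` of `H` at the vertex `x`. -/
noncomputable def m1At {V : Type*} [Fintype V] (H : SimpleGraph V) (x : V) : ℝ :=
  sSup {r : ℝ | ∃ H' : H.Subgraph, x ∈ H'.verts ∧ 1 < H'.verts.ncard ∧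
    r = (H'.edgeSet.ncard : ℝ) / ((H'.verts.ncard : ℝ) - 1)}

/-- `H` is strictly 1-balanced: `H` itself is the unique maximiser of the 1-density. -/
def StrictlyOneBalanced {V : Type*} [Fintype V] (H : SimpleGraph V) : Prop :=
  ∀ H' : H.Subgraph, 1 < H'.verts.ncard → H' ≠ ⊤ →
    (H'.edgeSet.ncard : ℝ) / ((H'.verts.ncard : ℝ) - 1) <
      (H.edgeSet.ncard : ℝ) / ((Fintype.card V : ℝ) - 1)

/-- `H` is vertex-1-balanced: the local 1-density at every vertex equals `m₁(H)`. -/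
def VertexOneBalanced {V : Type*} [Fintype V] (H : SimpleGraph V) : Prop :=
  ∀ x : V, m1At H x = m1 H

/-- `G` (an `n`-vertex graph) contains an `H`-factor: `⌊n / v(H)⌋` pairwise vertex-disjoint
copies of `H`. -/
def HasFactor {V : Type*} [Fintype V] (H : SimpleGraph V) {n : ℕ}
    (G : SimpleGraph (Fin n)) : Prop :=
  ∃ f : Fin (n / Fintype.card V) × V → Fin n, Function.Injective f ∧
    ∀ (i : Fin (n / Fintype.card V)) ⦃u v : V⦄, H.Adj u v → G.Adj (f (i, u)) (f (i, v))

/-- The square of the cycle on `m` vertices: vertices `ZMod m`, with edges between vertices at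
(cyclic) distance 1 or 2. -/
def cycleSquare (m : ℕ) : SimpleGraph (ZMod m) :=
  SimpleGraph.fromRel fun u v => u - v = 1 ∨ u - v = 2

set_option autoImplicit false
set_option linter.unusedVariables false

namespace NS
open Classical Finset

section prob
variable {E : Type*} [Fintype E]

/-- weight of an outcome -/
noncomputable def wt (p : ℝ) (ω : E → Bool) : ℝ := ∏ e, if ω e = true then p else 1 - p

/-- expectation -/
noncomputable def Ex (p : ℝ) (f : (E → Bool) → ℝ) : ℝ := ∑ ω : E → Bool, wt p ω * f ω

/-- probability -/
noncomputable def Pr (p : ℝ) (P : (E → Bool) → Prop) : ℝ :=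
  Ex p (fun ω => if P ω then 1 else 0)

lemma wt_nonneg {p : ℝ} (h0 : 0 ≤ p) (h1 : p ≤ 1) (ω : E → Bool) : 0 ≤ wt p ω := by
  unfold wt
  apply Finset.prod_nonneg
  intro e _
  split_ifs <;> linarith

lemma Ex_prod (p : ℝ) (h : E → Bool → ℝ) :
    Ex p (fun ω => ∏ e, h e (ω e)) = ∏ e, (p * h e true + (1 - p) * h e false) := by
  unfold Ex wt
  have h1 : ∀ e, p * h e true + (1 - p) * h e false
      = ∑ b : Bool, (if b = true then p else 1 - p) * h e b := by
    intro e; simp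
  simp_rw [h1]
  rw [Finset.prod_univ_sum]
  simp only [Fintype.piFinset_univ]
  apply Finset.sum_congr rfl
  intro ω _
  rw [Finset.prod_mul_distrib]

lemma Ex_one (p : ℝ) : Ex (E := E) p (fun _ => 1) = 1 := by
  have := Ex_prod (E := E) p (fun _ _ => 1)
  simpa using this

lemma Ex_mono {p : ℝ} (h0 : 0 ≤ p) (h1 : p ≤ 1) {f g : (E → Bool) → ℝ} (h : ∀ ω, f ω ≤ g ω) :
    Ex p f ≤ Ex p g := by
  unfold Ex
  gcongr with ω
  · exact wt_nonneg h0 h1 ω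
  · exact h ω

lemma Ex_sum {ι : Type*} (p : ℝ) (s : Finset ι) (f : ι → (E → Bool) → ℝ) :
    Ex p (fun ω => ∑ i ∈ s, f i ω) = ∑ i ∈ s, Ex p (f i) := by
  unfold Ex
  rw [Finset.sum_comm]
  apply Finset.sum_congr rfl
  intro ω _
  rw [Finset.mul_sum]

lemma Ex_mul_left (p a : ℝ) (f : (E → Bool) → ℝ) : Ex p (fun ω => a * f ω) = a * Ex p f := by
  unfold Ex
  rw [Finset.mul_sum]
  apply Finset.sum_congr rfl
  intro ω _
  ring

lemma Pr_nonneg {p : ℝ} (h0 : 0 ≤ p) (h1 : p ≤ 1) (P : (E → Bool) → Prop) : 0 ≤ Pr p P := by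
  unfold Pr Ex
  apply Finset.sum_nonneg
  intro ω _
  have := wt_nonneg h0 h1 ω
  dsimp only
  split_ifs <;> simp [this]

lemma Pr_mono {p : ℝ} (h0 : 0 ≤ p) (h1 : p ≤ 1) {P Q : (E → Bool) → Prop}
    (h : ∀ ω, P ω → Q ω) : Pr p P ≤ Pr p Q := by
  apply Ex_mono h0 h1
  intro ω
  by_cases hp : P ω
  · simp [hp, h ω hp]
  · simp only [hp, if_false]; split_ifs <;> norm_num

lemma Pr_union {ι : Type*} {p : ℝ} (h0 : 0 ≤ p) (h1 : p ≤ 1) (s : Finset ι)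
    {P : (E → Bool) → Prop} (Q : ι → (E → Bool) → Prop)
    (h : ∀ ω, P ω → ∃ i ∈ s, Q i ω) : Pr p P ≤ ∑ i ∈ s, Pr p (Q i) := by
  unfold Pr
  rw [← Ex_sum]
  apply Ex_mono h0 h1
  intro ω
  by_cases hp : P ω
  · obtain ⟨i, hi, hq⟩ := h ω hp
    simp only [hp, if_true]
    have := Finset.single_le_sum (f := fun i => if Q i ω then (1:ℝ) else 0) (s := s)
      (fun i _ => by split_ifs <;> norm_num) hi
    simpa [hq] using this
  · simp only [hp, if_false]
    apply Finset.sum_nonneg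
    intro i _
    split_ifs <;> norm_num

lemma Pr_or {p : ℝ} (h0 : 0 ≤ p) (h1 : p ≤ 1) (P Q : (E → Bool) → Prop) :
    Pr p (fun ω => P ω ∨ Q ω) ≤ Pr p P + Pr p Q := by
  have := Pr_union h0 h1 (Finset.univ : Finset Bool) (P := fun ω => P ω ∨ Q ω)
    (fun b => if b then P else Q) (by
      intro ω h
      rcases h with h | h
      · exact ⟨true, Finset.mem_univ _, by simpa using h⟩
      · exact ⟨false, Finset.mem_univ _, by simpa using h⟩)
  simpa using this

lemma Pr_not {p : ℝ} (P : (E → Bool) → Prop) :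
    Pr p P = 1 - Pr p (fun ω => ¬ P ω) := by
  rw [eq_sub_iff_add_eq, ← Ex_one (E := E) p]
  unfold Pr Ex
  rw [← Finset.sum_add_distrib]
  apply Finset.sum_congr rfl
  intro ω _
  by_cases h : P ω <;> simp [h]

lemma Pr_markov {p : ℝ} (h0 : 0 ≤ p) (h1 : p ≤ 1) (f : (E → Bool) → ℝ) (hf : ∀ ω, 0 ≤ f ω)
    {a : ℝ} (ha : 0 < a) : Pr p (fun ω => a ≤ f ω) ≤ Ex p f / a := by
  rw [le_div_iff₀ ha, mul_comm]
  unfold Pr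
  rw [← Ex_mul_left]
  apply Ex_mono h0 h1
  intro ω
  by_cases h : a ≤ f ω
  · simp [h]
  · simp [h, hf ω]

lemma Pr_all (p : ℝ) (S : Finset E) : Pr p (fun ω => ∀ e ∈ S, ω e = true) = p ^ #S := by
  have := Ex_prod (E := E) p (fun e b => if e ∈ S then cond b 1 0 else 1)
  have h2 : (fun ω : E → Bool => ∏ e, (if e ∈ S then cond (ω e) (1 : ℝ) 0 else 1))
      = fun ω => if (∀ e ∈ S, ω e = true) then 1 else 0 := by
    funext ω
    split_ifs with h
    · apply Finset.prod_eq_one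
      intro e _
      split_ifs with h1
      · simp [h e h1]
      · rfl
    · push Not at h
      obtain ⟨e, he, hne⟩ := h
      apply Finset.prod_eq_zero (Finset.mem_univ e)
      simp [he, hne]
  rw [h2] at this
  unfold Pr
  refine Eq.trans ?_ (this.trans ?_)
  · congr! 2; simp
  have h3 : ∀ e, (p * (if e ∈ S then cond true (1 : ℝ) 0 else 1) +
    (1 - p) * (if e ∈ S then cond false (1 : ℝ) 0 else 1)) = if e ∈ S then p else 1 := by
    intro e; split_ifs <;> simp
  rw [Finset.prod_congr rfl (fun e _ => h3 e)]
  rw [Finset.prod_ite_mem]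
  simp

/-- number of present edges -/
noncomputable def cnt (S : Finset E) (ω : E → Bool) : ℕ := #{e ∈ S | ω e = true}

lemma Ex_exp {p : ℝ} (h0 : 0 ≤ p) (h1 : p ≤ 1) (S : Finset E) {a : ℝ} (ha : |a| ≤ 1) :
    Ex p (fun ω => Real.exp (a * cnt S ω)) ≤ Real.exp (#S * p * (a + a ^ 2)) := by
  have := Ex_prod (E := E) p (fun e b => if e ∈ S then cond b (Real.exp a) 1 else 1)
  have h2 : (fun ω : E → Bool => ∏ e, (if e ∈ S then cond (ω e) (Real.exp a) 1 else 1))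
      = fun ω => Real.exp (a * cnt S ω) := by
    funext ω
    rw [Finset.prod_ite_mem]
    have : ∀ e ∈ Finset.univ ∩ S, cond (ω e) (Real.exp a) 1 = if ω e = true then Real.exp a else 1 := by
      intro e _; cases ω e <;> simp
    rw [Finset.prod_congr rfl this, Finset.prod_ite]
    simp only [Finset.univ_inter, Finset.prod_const, one_pow, mul_one]
    rw [← Real.exp_nat_mul, mul_comm]
    rfl
  rw [h2] at this
  rw [this]
  have h3 : ∀ e, (p * (if e ∈ S then cond true (Real.exp a) 1 else 1) +
    (1 - p) * (if e ∈ S then cond false (Real.exp a) 1 else 1))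
      = if e ∈ S then (1 + p * (Real.exp a - 1)) else 1 := by
    intro e; split_ifs
    · simp only [cond_true, cond_false]; ring
    · ring
  rw [Finset.prod_congr rfl (fun e _ => h3 e)]
  rw [Finset.prod_ite_mem]
  simp only [Finset.univ_inter, Finset.prod_const]
  have hb := Real.abs_exp_sub_one_sub_id_le ha
  have hb' := (abs_le.1 hb).2
  have h4 : 1 + p * (Real.exp a - 1) ≤ Real.exp (p * (a + a ^ 2)) := by
    have := Real.add_one_le_exp (p * (a + a ^ 2))
    nlinarith
  have h5 : 0 ≤ 1 + p * (Real.exp a - 1) := by nlinarith [Real.exp_pos a]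
  calc (1 + p * (Real.exp a - 1)) ^ #S ≤ (Real.exp (p * (a + a ^ 2))) ^ #S := by gcongr
    _ = _ := by rw [← Real.exp_nat_mul]; ring_nf

lemma chern_upper {p : ℝ} (h0 : 0 ≤ p) (h1 : p ≤ 1) (S : Finset E) {η : ℝ} (hη : 0 < η)
    (hη1 : η ≤ 1) {N : ℝ} (hN : (#S : ℝ) ≤ N) :
    Pr p (fun ω => (1 + η) * p * N ≤ cnt S ω) ≤ Real.exp (-(N * p * η ^ 2 / 4)) := by
  have ha : |η / 2| ≤ 1 := by rw [abs_of_pos (by linarith)]; linarith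
  have hm := Pr_markov (E := E) h0 h1 (fun ω => Real.exp (η / 2 * cnt S ω))
    (fun ω => (Real.exp_pos _).le) (Real.exp_pos (η / 2 * ((1 + η) * p * N)))
  have he := Ex_exp (E := E) h0 h1 S ha
  calc _ ≤ Pr p (fun ω => Real.exp (η / 2 * ((1 + η) * p * N)) ≤ Real.exp (η / 2 * cnt S ω)) := by
        apply Pr_mono h0 h1
        intro ω h
        apply Real.exp_le_exp.2
        gcongr
    _ ≤ _ := hm
    _ ≤ Real.exp (N * p * (η / 2 + (η / 2) ^ 2)) / Real.exp (η / 2 * ((1 + η) * p * N)) := by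
        gcongr
        refine he.trans ?_
        gcongr
    _ = _ := by
        rw [← Real.exp_sub]; congr 1; ring

lemma chern_lower {p : ℝ} (h0 : 0 ≤ p) (h1 : p ≤ 1) (S : Finset E) {η : ℝ} (hη : 0 < η)
    (hη1 : η ≤ 1) : Pr p (fun ω => cnt S ω ≤ (1 - η) * p * #S) ≤ Real.exp (-(#S * p * η ^ 2 / 4)) := by
  have ha : |-(η / 2)| ≤ 1 := by rw [abs_neg, abs_of_pos (by linarith)]; linarith
  have hm := Pr_markov (E := E) h0 h1 (fun ω => Real.exp (-(η / 2) * cnt S ω))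
    (fun ω => (Real.exp_pos _).le) (Real.exp_pos (-(η / 2) * ((1 - η) * p * #S)))
  have he := Ex_exp (E := E) h0 h1 S ha
  calc _ ≤ Pr p (fun ω => Real.exp (-(η / 2) * ((1 - η) * p * #S)) ≤ Real.exp (-(η / 2) * cnt S ω)) := by
        apply Pr_mono h0 h1
        intro ω h
        apply Real.exp_le_exp.2
        nlinarith
    _ ≤ _ := hm
    _ ≤ Real.exp (#S * p * (-(η / 2) + (-(η / 2)) ^ 2)) / Real.exp (-(η / 2) * ((1 - η) * p * #S)) := by
        gcongr
    _ = _ := by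
        rw [← Real.exp_sub]; congr 1; ring

end prob

lemma bern_sing {p : ℝ} (h0 : 0 ≤ p) (h1 : p ≤ 1) (b : Bool) :
    bernoulliMeasure p {b} = ENNReal.ofReal (if b = true then p else 1 - p) := by
  unfold bernoulliMeasure
  have h2 : min (ENNReal.ofReal p) 1 = ENNReal.ofReal p := by
    apply min_eq_left; rw [← ENNReal.ofReal_one]; exact ENNReal.ofReal_le_ofReal h1
  rw [h2]
  have h3 : (1 : ENNReal) - ENNReal.ofReal p = ENNReal.ofReal (1 - p) := by
    rw [← ENNReal.ofReal_one, ENNReal.ofReal_sub _ h0]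
  rw [h3]
  cases b <;> simp

lemma bern_prob {p : ℝ} (h0 : 0 ≤ p) (h1 : p ≤ 1) : IsProbabilityMeasure (bernoulliMeasure p) := by
  constructor
  have : (Set.univ : Set Bool) = {true} ∪ {false} := by ext b; cases b <;> simp
  rw [this, measure_union (by simp) (by simp), bern_sing h0 h1, bern_sing h0 h1,
    ← ENNReal.ofReal_add (by simpa using h0) (by simpa using h1)]
  simp

lemma gnp_eq (n : ℕ) {p : ℝ} (h0 : 0 ≤ p) (h1 : p ≤ 1) (S : Set (Sym2 (Fin n) → Bool)) :
    gnp n p S = ENNReal.ofReal (Pr p (fun ω => ω ∈ S)) := by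
  have := bern_prob h0 h1
  have hs : ∀ ω : Sym2 (Fin n) → Bool, gnp n p {ω} = ENNReal.ofReal (wt p ω) := by
    intro ω
    unfold gnp wt
    rw [Measure.pi_singleton, ENNReal.ofReal_prod_of_nonneg]
    · apply Finset.prod_congr rfl
      intro e _
      exact bern_sing h0 h1 _
    · intro e _; split_ifs <;> linarith
  have hS : S = ((Finset.univ.filter (fun ω => ω ∈ S) : Finset (Sym2 (Fin n) → Bool)) : Set _) := by
    ext ω; simp
  have hg : gnp n p S = ∑ ω ∈ Finset.univ.filter (fun ω => ω ∈ S), gnp n p {ω} := by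
    rw [sum_measure_singleton, ← hS]
  rw [hg]
  simp_rw [hs]
  rw [← ENNReal.ofReal_sum_of_nonneg (fun ω _ => wt_nonneg h0 h1 ω)]
  congr 1
  unfold Pr Ex
  rw [Finset.sum_filter]
  refine Finset.sum_congr (by ext; simp) (fun ω _ => ?_)
  simp

end NS

namespace NS
open Classical Finset

section graphs
variable {V : Type*}

/-- number of ordered adjacent pairs in `A × B` -/
noncomputable def eG (G : SimpleGraph V) (A B : Finset V) : ℕ := #{q ∈ A ×ˢ B | G.Adj q.1 q.2}

/-- lower regularity -/
def LR (G : SimpleGraph V) (A B : Finset V) (r D : ℝ) : Prop :=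
  ∀ X Y : Finset V, X ⊆ A → Y ⊆ B → r ≤ #X → r ≤ #Y → D * #X * #Y ≤ eG G X Y

lemma eG_mono (G : SimpleGraph V) {A B A' B' : Finset V} (hA : A ⊆ A') (hB : B ⊆ B') :
    eG G A B ≤ eG G A' B' := by
  unfold eG
  apply Finset.card_le_card
  exact Finset.filter_subset_filter _ (Finset.product_subset_product hA hB)

lemma eG_mono_graph {G H : SimpleGraph V} (h : G ≤ H) (A B : Finset V) : eG G A B ≤ eG H A B := by
  unfold eG
  apply Finset.card_le_card
  intro q hq
  simp only [Finset.mem_filter] at hq ⊢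
  exact ⟨hq.1, h hq.2⟩

lemma eG_comm (G : SimpleGraph V) (A B : Finset V) : eG G A B = eG G B A := by
  unfold eG
  apply Finset.card_bij (fun q _ => (q.2, q.1))
  · intro q hq
    simp only [Finset.mem_filter, Finset.mem_product] at hq ⊢
    exact ⟨⟨hq.1.2, hq.1.1⟩, hq.2.symm⟩
  · intro a _ b _ h
    simp only [Prod.mk.injEq] at h
    exact Prod.ext h.2 h.1
  · intro q hq
    simp only [Finset.mem_filter, Finset.mem_product] at hq
    refine ⟨(q.2, q.1), ?_, rfl⟩
    simp only [Finset.mem_filter, Finset.mem_product]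
    exact ⟨⟨hq.1.2, hq.1.1⟩, hq.2.symm⟩

lemma eG_eq_sum_right (G : SimpleGraph V) (A B : Finset V) :
    eG G A B = ∑ y ∈ B, #{x ∈ A | G.Adj x y} := by
  unfold eG
  rw [Finset.card_filter, Finset.sum_product_right]
  simp_rw [Finset.card_filter]

lemma eG_eq_sum_left (G : SimpleGraph V) (A B : Finset V) :
    eG G A B = ∑ x ∈ A, #{y ∈ B | G.Adj x y} := by
  unfold eG
  rw [Finset.card_filter, Finset.sum_product]
  simp_rw [Finset.card_filter]

lemma LR.symm {G : SimpleGraph V} {A B : Finset V} {r D : ℝ} (h : LR G A B r D) :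
    LR G B A r D := by
  intro X Y hX hY hx hy
  have := h Y X hY hX hy hx
  rw [eG_comm]
  linarith [mul_right_comm D (#X : ℝ) (#Y : ℝ)]

lemma LR.mono {G : SimpleGraph V} {A B A' B' : Finset V} {r r' D : ℝ} (h : LR G A B r D)
    (hA : A' ⊆ A) (hB : B' ⊆ B) (hr : r ≤ r') : LR G A' B' r' D := by
  intro X Y hX hY hx hy
  exact h X Y (hX.trans hA) (hY.trans hB) (hr.trans hx) (hr.trans hy)

end graphs

lemma graphOf_adj {n : ℕ} (ω : Sym2 (Fin n) → Bool) (u v : Fin n) :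
    (graphOf ω).Adj u v ↔ u ≠ v ∧ ω s(u, v) = true := by
  unfold graphOf
  rw [SimpleGraph.fromRel_adj, Sym2.eq_swap (a := v)]
  simp

/-- asymptotics: `n p^2` dominates logarithms -/
lemma np2_large {γ : ℝ} (hγ : 0 < γ) (C : ℝ) : ∃ N : ℕ, ∀ n : ℕ, N ≤ n → ∀ p : ℝ,
    (n : ℝ) ^ (γ - 1 / 2) ≤ p → C * Real.log n ≤ n * p ^ 2 := by
  have h := isLittleO_log_rpow_atTop (r := 2 * γ) (by linarith)
  have h2 := (h.bound (c := 1 / (|C| + 1)) (by positivity))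
  have h3 := (tendsto_natCast_atTop_atTop (R := ℝ)).eventually h2
  obtain ⟨N, hN⟩ := eventually_atTop.1 (h3.and (eventually_ge_atTop 1))
  refine ⟨N, fun n hn p hp => ?_⟩
  obtain ⟨h4, h5⟩ := hN n hn
  have hn0 : (0 : ℝ) < n := by exact_mod_cast h5
  have h6 : (0 : ℝ) ≤ (n : ℝ) ^ (2 * γ) := by positivity
  have h7 : (0 : ℝ) ≤ Real.log n := Real.log_nonneg (by exact_mod_cast h5)
  rw [Real.norm_of_nonneg h7, Real.norm_of_nonneg h6, div_mul_eq_mul_div, le_div_iff₀ (by positivity),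
    one_mul] at h4
  have h8 : (n : ℝ) ^ (2 * γ) ≤ n * p ^ 2 := by
    have h9 : (n : ℝ) ^ (2 * γ) = n * ((n : ℝ) ^ (γ - 1 / 2)) ^ 2 := by
      rw [← Real.rpow_natCast, ← Real.rpow_mul hn0.le]
      nth_rewrite 2 [← Real.rpow_one (n : ℝ)]
      rw [← Real.rpow_add hn0]
      congr 1
      push_cast; ring
    rw [h9]
    have : (0 : ℝ) ≤ (n : ℝ) ^ (γ - 1 / 2) := by positivity
    gcongr
  have h10 : C ≤ |C| := le_abs_self C
  nlinarith

lemma np2_const {γ : ℝ} (hγ : 0 < γ) (C : ℝ) : ∃ N : ℕ, ∀ n : ℕ, N ≤ n → ∀ p : ℝ,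
    (n : ℝ) ^ (γ - 1 / 2) ≤ p → C ≤ n * p ^ 2 := by
  obtain ⟨N, hN⟩ := np2_large hγ (|C|)
  refine ⟨max N 3, fun n hn p hp => ?_⟩
  have h := hN n (le_trans (le_max_left _ _) hn) p hp
  have h3 : (3 : ℝ) ≤ n := by exact_mod_cast (le_trans (le_max_right _ _) hn)
  have h1 : 1 ≤ Real.log n := by
    rw [Real.le_log_iff_exp_le (by linarith)]
    exact (Real.exp_one_lt_d9.le.trans (by norm_num)).trans h3
  nlinarith [le_abs_self C, abs_nonneg C]

lemma p_pos {γ : ℝ} {n : ℕ} (hn : 1 ≤ n) {p : ℝ} (hp : (n : ℝ) ^ (γ - 1 / 2) ≤ p) : 0 < p := by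
  have : (0 : ℝ) < n := by exact_mod_cast hn
  exact lt_of_lt_of_le (by positivity) hp

lemma deg_event {γ : ℝ} (hγ : 0 < γ) {η ζ : ℝ} (hη : 0 < η) (hη1 : η ≤ 1) (hζ : 0 < ζ) :
    ∃ N : ℕ, ∀ n : ℕ, N ≤ n → ∀ p : ℝ, (n : ℝ) ^ (γ - 1 / 2) ≤ p → p ≤ 1 →
      Pr p (fun ω : Sym2 (Fin n) → Bool =>
        ¬ ∀ v : Fin n, (1 - η) * n * p ≤ ((graphOf ω).neighborSet v).ncard) ≤ ζ := by
  obtain ⟨N, hN⟩ := np2_large hγ (64 / η ^ 2)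
  refine ⟨max (max N 2) (max ⌈2 / η⌉₊ ⌈1 / ζ⌉₊), fun n hn p hp hp1 => ?_⟩
  simp only [max_le_iff] at hn
  obtain ⟨⟨hn1, hn2⟩, hn3, hn4⟩ := hn
  have hlog := hN n hn1 p hp
  have hp0 := p_pos (by omega) hp
  have hn3' : 2 / η ≤ n := (Nat.le_ceil _).trans (by exact_mod_cast hn3)
  have hn4' : 1 / ζ ≤ n := (Nat.le_ceil _).trans (by exact_mod_cast hn4)
  have hn2' : (2 : ℝ) ≤ n := by exact_mod_cast hn2
  set S : Fin n → Finset (Sym2 (Fin n)) := fun v => (univ.erase v).image (fun u => s(v, u)) with hS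
  have hScard : ∀ v, (#(S v) : ℝ) = n - 1 := by
    intro v
    rw [hS]
    dsimp only
    rw [Finset.card_image_of_injective, Finset.card_erase_of_mem (Finset.mem_univ _),
      Finset.card_univ, Fintype.card_fin, Nat.cast_sub (by omega)]
    · simp
    · intro a b h
      exact Sym2.congr_right.1 h
  have hcnt : ∀ v ω, cnt (S v) ω = ((graphOf ω).neighborSet v).ncard := by
    intro v ω
    have h1 : (graphOf ω).neighborSet v
        = ((univ.erase v).filter (fun u => ω s(v, u) = true) : Finset (Fin n)) := by
      ext u
      rw [SimpleGraph.mem_neighborSet, graphOf_adj]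
      simp [ne_comm (a := v)]
    rw [h1, Set.ncard_coe_finset]
    unfold cnt
    rw [hS]
    dsimp only
    rw [Finset.filter_image, Finset.card_image_of_injective]
    intro a b h
    exact Sym2.congr_right.1 h
  calc _ ≤ ∑ v : Fin n, Pr p (fun ω => cnt (S v) ω ≤ (1 - η / 2) * p * #(S v)) := by
        apply Pr_union hp0.le hp1
        intro ω h
        push Not at h
        obtain ⟨v, hv⟩ := h
        refine ⟨v, Finset.mem_univ _, ?_⟩
        rw [hcnt, hScard]
        refine hv.le.trans ?_
        have : 2 ≤ η * n := by rwa [div_le_iff₀' hη] at hn3'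
        have h2 : (1 - η) * n ≤ (1 - η / 2) * (n - 1) := by nlinarith
        nlinarith
    _ ≤ ∑ v : Fin n, Real.exp (-(2 * Real.log n)) := by
        gcongr with v
        refine (chern_lower hp0.le hp1 (S v) (by linarith) (by linarith)).trans ?_
        apply Real.exp_le_exp.2
        rw [hScard]
        have h1 : 64 * Real.log n ≤ η ^ 2 * (n * p ^ 2) := by
          rw [div_mul_eq_mul_div, div_le_iff₀ (by positivity)] at hlog; linarith
        have h2 : (n : ℝ) * p ^ 2 ≤ 2 * (n - 1) * p := by
          have : (n : ℝ) * p ≤ n := by nlinarith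
          have : (n : ℝ) * p * p ≤ n * p := by nlinarith
          nlinarith
        nlinarith [sq_nonneg η]
    _ ≤ ζ := by
        rw [Finset.sum_const, Finset.card_univ, Fintype.card_fin, nsmul_eq_mul, two_mul, neg_add,
          Real.exp_add, Real.exp_neg, Real.exp_log (by linarith)]
        rw [div_le_iff₀ hζ] at hn4'
        field_simp
        linarith

/-- potential edges between two sets -/
noncomputable def Eset {n : ℕ} (X Z : Finset (Fin n)) : Finset (Sym2 (Fin n)) :=
  (X ×ˢ Z).image (fun q => s(q.1, q.2))

lemma Eset_card {n : ℕ} (X Z : Finset (Fin n)) : #(Eset X Z) ≤ #X * #Z :=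
  Finset.card_image_le.trans (by rw [Finset.card_product])

lemma eG_le_two_cnt {n : ℕ} (ω : Sym2 (Fin n) → Bool) (X Z : Finset (Fin n)) :
    eG (graphOf ω) X Z ≤ 2 * cnt (Eset X Z) ω := by
  unfold eG cnt
  apply Finset.card_le_mul_card_image_of_maps_to (f := fun q : Fin n × Fin n => s(q.1, q.2))
  · intro q hq
    simp only [Finset.mem_filter, graphOf_adj] at hq ⊢
    exact ⟨Finset.mem_image_of_mem _ hq.1, hq.2.2⟩
  · intro e he
    induction e with | _ a b => ?_
    calc _ ≤ #({(a, b), (b, a)} : Finset (Fin n × Fin n)) := by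
          apply Finset.card_le_card
          intro q hq
          simp only [Finset.mem_filter, Sym2.eq_iff] at hq
          simp only [Finset.mem_insert, Finset.mem_singleton, Prod.ext_iff]
          exact hq.2
      _ ≤ 2 := Finset.card_le_two

lemma eG_le_cnt {n : ℕ} (ω : Sym2 (Fin n) → Bool) {X Z : Finset (Fin n)} (h : Disjoint X Z) :
    eG (graphOf ω) X Z ≤ cnt (Eset X Z) ω := by
  unfold eG cnt
  apply Finset.card_le_card_of_injOn (f := fun q : Fin n × Fin n => s(q.1, q.2))
  · intro q hq
    simp only [Finset.mem_coe, Finset.mem_filter, graphOf_adj] at hq ⊢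
    exact ⟨Finset.mem_image_of_mem _ hq.1, hq.2.2⟩
  · intro a ha b hb hab
    simp only [Finset.mem_coe, Finset.mem_filter, Finset.mem_product] at ha hb
    rcases Sym2.eq_iff.1 hab with h1 | h1
    · exact Prod.ext h1.1 h1.2
    · exact absurd (h1.1 ▸ ha.1.1) (fun h2 => Finset.disjoint_left.1 h h2 hb.1.2)

lemma sum_pow_card_le {n : ℕ} {r : ℝ} (hr : 0 ≤ r) :
    ∑ X : Finset (Fin n), r ^ #X ≤ Real.exp (n * r) := by
  have := Finset.sum_pow_mul_eq_add_pow r 1 (univ : Finset (Fin n))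
  simp only [one_pow, mul_one, Finset.powerset_univ, Finset.card_univ, Fintype.card_fin] at this
  rw [this, Real.exp_nat_mul]
  gcongr
  exact Real.add_one_le_exp r

/-- discrepancy property -/
def Disc {n : ℕ} (Γ : SimpleGraph (Fin n)) (p η : ℝ) (U : ℕ) : Prop :=
  (∀ A B : Finset (Fin n), Disjoint A B → U ≤ #A → U ≤ #B → (eG Γ A B : ℝ) ≤ (1 + η) * p * #A * #B) ∧
  (∀ A B : Finset (Fin n), U ≤ #A → U ≤ #B → (eG Γ A B : ℝ) ≤ 4 * p * #A * #B)

lemma disc_event {γ : ℝ} (hγ : 0 < γ) {η η0 ζ : ℝ} (hη : 0 < η) (hη1 : η ≤ 1) (hη0 : 0 < η0)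
    (hζ : 0 < ζ) :
    ∃ N : ℕ, ∀ n : ℕ, N ≤ n → ∀ p : ℝ, (n : ℝ) ^ (γ - 1 / 2) ≤ p → p ≤ 1 →
      Pr p (fun ω : Sym2 (Fin n) → Bool =>
        ¬ Disc (graphOf ω) p η ⌈η0 * n * p⌉₊) ≤ ζ := by
  obtain ⟨N, hN⟩ := np2_large hγ (16 / (η ^ 2 * η0))
  refine ⟨max (max N 2) ⌈9 / ζ⌉₊, fun n hn p hp hp1 => ?_⟩
  simp only [max_le_iff] at hn
  obtain ⟨⟨hn1, hn2⟩, hn4⟩ := hn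
  have hlog := hN n hn1 p hp
  have hp0 := p_pos (by omega) hp
  have hn4' : 9 / ζ ≤ n := (Nat.le_ceil _).trans (by exact_mod_cast hn4)
  have hn2' : (2 : ℝ) ≤ n := by exact_mod_cast hn2
  set U := ⌈η0 * n * p⌉₊ with hU
  have hU1 : η0 * n * p ≤ U := Nat.le_ceil _
  have hU0 : 1 ≤ U := Nat.ceil_pos.2 (by positivity)
  set t := p * η ^ 2 * U / 8 with ht
  have ht1 : 2 * Real.log n ≤ t := by
    rw [div_mul_eq_mul_div, div_le_iff₀ (by positivity)] at hlog
    have : η0 * n * p * (p * η ^ 2) ≤ U * (p * η ^ 2) := by gcongr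
    rw [ht]; linarith
  have hlog0 : 0 ≤ Real.log n := Real.log_nonneg (by linarith)
  set r := Real.exp (-(t / 2)) with hr
  have hr0 : 0 ≤ r := (Real.exp_pos _).le
  have hrn : n * r ≤ 1 := by
    have : r ≤ Real.exp (- Real.log n) := Real.exp_le_exp.2 (by linarith)
    rw [Real.exp_neg, Real.exp_log (by linarith)] at this
    calc (n : ℝ) * r ≤ n * (n : ℝ)⁻¹ := by gcongr
      _ = 1 := mul_inv_cancel₀ (by linarith)
  set T : Finset (Finset (Fin n) × Finset (Fin n)) :=
    Finset.univ.filter (fun q => U ≤ #q.1 ∧ U ≤ #q.2) with hT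
  calc _ ≤ ∑ q ∈ T, Pr p (fun ω => (1 + η) * p * (#q.1 * #q.2 : ℝ) ≤ cnt (Eset q.1 q.2) ω) := by
        apply Pr_union hp0.le hp1
        intro ω h
        by_contra! hc
        apply h
        constructor
        · intro A B hd hA hB
          have := hc (A, B) (by simp [hT, hA, hB])
          have h2 : (eG (graphOf ω) A B : ℝ) ≤ cnt (Eset A B) ω := by exact_mod_cast eG_le_cnt ω hd
          dsimp only at this
          linarith
        · intro A B hA hB
          have := hc (A, B) (by simp [hT, hA, hB])
          have h2 : (eG (graphOf ω) A B : ℝ) ≤ 2 * cnt (Eset A B) ω := by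
            exact_mod_cast eG_le_two_cnt ω A B
          dsimp only at this
          have h3 : 0 ≤ p * (#A * #B) := by positivity
          nlinarith
    _ ≤ ∑ q ∈ T, Real.exp (-t) * (r ^ #q.1 * r ^ #q.2) := by
        gcongr with q hq
        simp only [hT, Finset.mem_filter, Finset.mem_univ, true_and] at hq
        refine (chern_upper hp0.le hp1 (Eset q.1 q.2) hη hη1
          (by exact_mod_cast Eset_card q.1 q.2)).trans ?_
        rw [hr, ← Real.exp_nat_mul, ← Real.exp_nat_mul, ← Real.exp_add, ← Real.exp_add]
        apply Real.exp_le_exp.2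
        have ha : (U : ℝ) ≤ #q.1 := by exact_mod_cast hq.1
        have hb : (U : ℝ) ≤ #q.2 := by exact_mod_cast hq.2
        have hu : (1 : ℝ) ≤ U := by exact_mod_cast hU0
        have h1 : (U : ℝ) * (#q.1 + #q.2) / 2 ≤ #q.1 * #q.2 := by nlinarith
        have h2 : (U : ℝ) * (#q.1 + #q.2) / 2 * (p * η ^ 2 / 4) ≤ #q.1 * #q.2 * (p * η ^ 2 / 4) := by
          gcongr
        have h3 : t ≤ t * ((#q.1 + #q.2) / 2) := by
          have : 0 ≤ t := by positivity
          nlinarith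
        have h4 : (U : ℝ) * (#q.1 + #q.2) / 2 * (p * η ^ 2 / 4) = t * (#q.1 + #q.2) := by
          rw [ht]; ring
        linarith
    _ ≤ ∑ q : Finset (Fin n) × Finset (Fin n), Real.exp (-t) * (r ^ #q.1 * r ^ #q.2) := by
        apply Finset.sum_le_sum_of_subset_of_nonneg (Finset.filter_subset _ _)
        intro q _ _
        positivity
    _ = Real.exp (-t) * ((∑ X : Finset (Fin n), r ^ #X) * (∑ X : Finset (Fin n), r ^ #X)) := by
        rw [Fintype.sum_prod_type, Finset.sum_mul_sum, Finset.mul_sum]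
        simp_rw [Finset.mul_sum]
    _ ≤ Real.exp (-(Real.log n)) * (Real.exp 1 * Real.exp 1) := by
        have h1 := sum_pow_card_le (n := n) hr0
        have h2 : Real.exp (n * r) ≤ Real.exp 1 := Real.exp_le_exp.2 hrn
        gcongr
        · linarith
        · linarith
        · linarith
    _ ≤ ζ := by
        rw [Real.exp_neg, Real.exp_log (by linarith)]
        have : Real.exp 1 < 3 := Real.exp_one_lt_d9.trans (by norm_num)
        rw [div_le_iff₀ hζ] at hn4'
        rw [inv_mul_le_iff₀ (by linarith)]
        nlinarith [Real.exp_pos 1]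

end NS

namespace NS
open Classical Finset

section lists
variable {V : Type*}

/-- lists of length `q` over `A` -/
noncomputable def Ls (A : Finset V) : ℕ → Finset (List V)
  | 0 => {[]}
  | q + 1 => (A ×ˢ Ls A q).image (fun x => x.1 :: x.2)

lemma mem_Ls (A : Finset V) (q : ℕ) (l : List V) : l ∈ Ls A q ↔ l.length = q ∧ ∀ a ∈ l, a ∈ A := by
  induction q generalizing l with
  | zero =>
    simp only [Ls, Finset.mem_singleton]
    constructor
    · rintro rfl; simp
    · rintro ⟨h, -⟩; exact List.length_eq_zero_iff.1 h
  | succ q ih =>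
    simp only [Ls, Finset.mem_image, Finset.mem_product, Prod.exists]
    constructor
    · rintro ⟨a, l', ⟨ha, hl⟩, rfl⟩
      rw [ih] at hl
      refine ⟨by simp [hl.1], ?_⟩
      intro b hb
      rcases List.mem_cons.1 hb with rfl | hb
      · exact ha
      · exact hl.2 b hb
    · rintro ⟨h1, h2⟩
      cases l with
      | nil => simp at h1
      | cons a l' =>
        refine ⟨a, l', ⟨h2 a (by simp), ?_⟩, rfl⟩
        rw [ih]
        exact ⟨by simpa using h1, fun b hb => h2 b (by simp [hb])⟩

lemma sum_Ls_succ (A : Finset V) (q : ℕ) (f : List V → ℝ) :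
    ∑ l ∈ Ls A (q + 1), f l = ∑ l ∈ Ls A q, ∑ a ∈ A, f (a :: l) := by
  rw [Ls, Finset.sum_image, Finset.sum_product_right]
  intro x _ y _ h
  simp only [List.cons.injEq] at h
  exact Prod.ext h.1 h.2

/-- number of bad steps -/
noncomputable def bads (Bd : List V → V → Prop) : List V → ℕ
  | [] => 0
  | v :: l => bads Bd l + if Bd l v then 1 else 0

lemma seq_sum (A : Finset V) (s : ℝ) (hs : (#A : ℝ) ≤ s) {σ : ℝ} (hσ : 0 < σ)
    (Bd : List V → V → Prop) [∀ l, DecidablePred (Bd l)] (hB : ∀ l, (#{v ∈ A | Bd l v} : ℝ) ≤ σ ^ 2 * s) (q : ℕ) :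
    ∑ l ∈ Ls A q, (1 / σ) ^ (2 * bads Bd l) ≤ (2 * s) ^ q := by
  induction q with
  | zero => simp [Ls, bads]
  | succ q ih =>
    rw [sum_Ls_succ]
    have h1 : ∀ l ∈ Ls A q, ∑ a ∈ A, (1 / σ) ^ (2 * bads Bd (a :: l)) ≤
        (1 / σ) ^ (2 * bads Bd l) * (2 * s) := by
      intro l _
      have h2 : ∀ a ∈ A, (1 / σ) ^ (2 * bads Bd (a :: l)) ≤
          (1 / σ) ^ (2 * bads Bd l) * (1 + if Bd l a then (1 / σ) ^ 2 else 0) := by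
        intro a _
        simp only [bads]
        split_ifs
        · rw [mul_add, pow_add]
          have : 0 ≤ (1 / σ) ^ (2 * bads Bd l) := by positivity
          simp only [mul_one]
          nlinarith
        · simp
      refine (Finset.sum_le_sum h2).trans ?_
      rw [← Finset.mul_sum]
      gcongr
      rw [Finset.sum_add_distrib, ← Finset.sum_filter]
      simp only [Finset.sum_const, nsmul_eq_mul, mul_one]
      have h3 : (#{v ∈ A | Bd l v} : ℝ) * (1 / σ) ^ 2 ≤ s := by
        calc _ ≤ (σ ^ 2 * s) * (1 / σ) ^ 2 := by gcongr; exact hB l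
          _ = s := by field_simp
      linarith
    refine (Finset.sum_le_sum h1).trans ?_
    rw [← Finset.sum_mul, pow_succ]
    have : 0 ≤ s := le_trans (by positivity) hs
    gcongr

lemma seq_count (A : Finset V) (s : ℝ) (hs : (#A : ℝ) ≤ s) {σ : ℝ} (hσ : 0 < σ) (hσ1 : σ ≤ 1)
    (Bd : List V → V → Prop) [∀ l, DecidablePred (Bd l)] (hB : ∀ l, (#{v ∈ A | Bd l v} : ℝ) ≤ σ ^ 2 * s) (q : ℕ) :
    (#{l ∈ Ls A q | q ≤ 2 * bads Bd l} : ℝ) ≤ (2 * σ * s) ^ q := by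
  have h1 := seq_sum A s hs hσ Bd hB q
  have h2 : (#{l ∈ Ls A q | q ≤ 2 * bads Bd l} : ℝ) * (1 / σ) ^ q ≤ (2 * s) ^ q := by
    refine le_trans ?_ h1
    rw [← nsmul_eq_mul, ← Finset.sum_const, ]
    refine le_trans ?_ (Finset.sum_le_sum_of_subset_of_nonneg (Finset.filter_subset
      (fun l => q ≤ 2 * bads Bd l) _) (fun l _ _ => by positivity))
    apply Finset.sum_le_sum
    intro l hl
    simp only [Finset.mem_filter] at hl
    apply pow_le_pow_right₀ _ hl.2
    rw [le_div_iff₀ hσ]; linarith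
  have h3 : (2 * σ * s) ^ q = (2 * s) ^ q * σ ^ q := by rw [← mul_pow]; ring_nf
  rw [h3]
  calc (#{l ∈ Ls A q | q ≤ 2 * bads Bd l} : ℝ)
      = (#{l ∈ Ls A q | q ≤ 2 * bads Bd l} : ℝ) * (1 / σ) ^ q * σ ^ q := by
        rw [mul_assoc, ← mul_pow, one_div_mul_cancel hσ.ne', one_pow, mul_one]
    _ ≤ _ := by gcongr

/-- counting sets through their orderings -/
lemma set_count (A : Finset V) (q : ℕ) (P : Finset V → Prop) (Q : List V → Prop)
    [DecidablePred P] [DecidablePred Q]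
    (h : ∀ X ∈ A.powersetCard q, P X → ∀ l : List V, l.Nodup → l.toFinset = X → Q l) :
    #{X ∈ A.powersetCard q | P X} * q.factorial ≤ #{l ∈ Ls A q | Q l} := by
  set S := {X ∈ A.powersetCard q | P X} with hS
  set T := S.biUnion (fun X => X.toList.permutations.toFinset) with hT
  have h1 : #T = ∑ X ∈ S, #(X.toList.permutations.toFinset) := by
    apply Finset.card_biUnion
    intro X hX Y hY hne
    refine Finset.disjoint_left.2 ?_
    intro l hl hl'
    simp only [List.mem_toFinset, List.mem_permutations] at hl hl'
    apply hne
    rw [← Finset.toList_toFinset X, ← Finset.toList_toFinset Y]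
    exact List.toFinset_eq_of_perm _ _ (hl.symm.trans hl')
  have h2 : ∀ X ∈ S, #(X.toList.permutations.toFinset) = q.factorial := by
    intro X hX
    rw [List.toFinset_card_of_nodup (List.nodup_permutations _ (Finset.nodup_toList X)),
      List.length_permutations, Finset.length_toList]
    simp only [hS, Finset.mem_filter, Finset.mem_powersetCard] at hX
    rw [hX.1.2]
  rw [Finset.sum_congr rfl h2, Finset.sum_const, smul_eq_mul] at h1
  rw [← h1]
  apply Finset.card_le_card
  intro l hl
  simp only [hT, Finset.mem_biUnion, List.mem_toFinset, List.mem_permutations] at hl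
  obtain ⟨X, hX, hl⟩ := hl
  simp only [hS, Finset.mem_filter] at hX
  have hX' := Finset.mem_powersetCard.1 hX.1
  simp only [Finset.mem_filter, mem_Ls]
  refine ⟨⟨?_, ?_⟩, ?_⟩
  · rw [hl.length_eq, Finset.length_toList, hX'.2]
  · intro a ha
    apply hX'.1
    rw [← Finset.mem_toList]
    exact hl.mem_iff.1 ha
  · apply h X hX.1 hX.2 l
    · exact hl.nodup_iff.2 (Finset.nodup_toList X)
    · rw [List.toFinset_eq_of_perm _ _ hl, Finset.toList_toFinset]

lemma powersetCard_count (A : Finset V) (s : ℕ) (hs : #A ≤ s) (q : ℕ) :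
    #(A.powersetCard q) * q.factorial ≤ s ^ q := by
  rw [Finset.card_powersetCard, mul_comm, ← Nat.descFactorial_eq_factorial_mul_choose]
  exact (Nat.descFactorial_le_pow _ _).trans (Nat.pow_le_pow_left hs q)

/-- degree of `z` into a list -/
noncomputable def ldeg (G : SimpleGraph V) (l : List V) (z : V) : ℕ := l.countP (fun x => G.Adj x z)

lemma ldeg_eq (G : SimpleGraph V) {l : List V} (hl : l.Nodup) (z : V) :
    ldeg G l z = #{x ∈ l.toFinset | G.Adj x z} := by
  unfold ldeg
  rw [List.countP_eq_length_filter, ← List.toFinset_card_of_nodup (hl.filter _),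
    List.toFinset_filter]
  congr! 2; simp

/-- low degree vertices -/
noncomputable def Ul (G : SimpleGraph V) (B : Finset V) (D : ℕ) (l : List V) : Finset V :=
  {z ∈ B | ldeg G l z < D}

lemma Ul_cons (G : SimpleGraph V) (B : Finset V) (D : ℕ) (v : V) (l : List V) :
    Ul G B D (v :: l) ⊆ Ul G B D l := by
  intro z hz
  simp only [Ul, Finset.mem_filter] at hz ⊢
  refine ⟨hz.1, lt_of_le_of_lt ?_ hz.2⟩
  unfold ldeg
  rw [List.countP_cons]
  omega

lemma potential (G : SimpleGraph V) (B : Finset V) (D : ℕ) (b κp : ℝ) (hκ : 0 ≤ κp) (l : List V)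
    (hl : b ≤ #(Ul G B D l)) :
    κp * b * (l.length - bads (fun l v => b ≤ #(Ul G B D l) ∧
      (#{z ∈ Ul G B D l | G.Adj v z} : ℝ) < κp * #(Ul G B D l)) l) ≤
      ∑ z ∈ B, ((min (ldeg G l z) D : ℕ) : ℝ) := by
  induction l with
  | nil => simp [bads, ldeg]
  | cons v l ih =>
    have h1 : b ≤ #(Ul G B D l) := hl.trans (by exact_mod_cast Finset.card_le_card (Ul_cons G B D v l))
    have ih := ih h1
    have hmono : ∀ z ∈ B, min (ldeg G l z) D + (if z ∈ Ul G B D l ∧ G.Adj v z then 1 else 0)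
        ≤ min (ldeg G (v :: l) z) D := by
      intro z hz
      have : ldeg G (v :: l) z = ldeg G l z + if G.Adj v z then 1 else 0 := by
        unfold ldeg; rw [List.countP_cons]; simp
      rw [this]
      simp only [Ul, Finset.mem_filter, hz, true_and]
      by_cases h1 : G.Adj v z <;> by_cases h2 : ldeg G l z < D <;> simp [h1, h2] <;> omega
    have hsum := Finset.sum_le_sum hmono
    rw [Finset.sum_add_distrib] at hsum
    have hcard : ∑ z ∈ B, (if z ∈ Ul G B D l ∧ G.Adj v z then 1 else 0)
        = #{z ∈ Ul G B D l | G.Adj v z} := by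
      rw [← Finset.card_filter]
      congr 1
      ext z
      simp only [Finset.mem_filter, Ul]
      tauto
    rw [hcard] at hsum
    have hsum' : (∑ z ∈ B, ((min (ldeg G l z) D : ℕ) : ℝ)) + #{z ∈ Ul G B D l | G.Adj v z}
        ≤ ∑ z ∈ B, ((min (ldeg G (v :: l) z) D : ℕ) : ℝ) := by exact_mod_cast hsum
    refine le_trans ?_ hsum'
    simp only [bads, List.length_cons]
    by_cases hb : (#{z ∈ Ul G B D l | G.Adj v z} : ℝ) < κp * #(Ul G B D l)
    · rw [if_pos ⟨h1, hb⟩]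
      push_cast
      push_cast at ih
      have : (0 : ℝ) ≤ #{z ∈ Ul G B D l | G.Adj v z} := by positivity
      linarith
    · rw [if_neg (fun h => hb h.2)]
      push Not at hb
      push_cast
      have : κp * b ≤ κp * #(Ul G B D l) := by gcongr
      push_cast at ih
      linarith

lemma badX_count (G : SimpleGraph V) (A B : Finset V) (s : ℕ) (hA : #A ≤ s) (hB : #B ≤ s)
    (hs : 1 ≤ s)
    {σ κp : ℝ} (hσ : 0 < σ) (hσ1 : σ ≤ 1) (hκ : 0 < κp) (hLR : LR G A B (σ ^ 2 * s) κp)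
    (D q : ℕ) (hD : 2 * (D : ℝ) ≤ κp * σ ^ 2 * q) :
    (#{X ∈ A.powersetCard q | σ ^ 2 * s ≤ #{z ∈ B | #{x ∈ X | G.Adj x z} < D}} : ℝ) * q.factorial
      ≤ (2 * σ * s) ^ q := by
  have hs' : (1 : ℝ) ≤ s := by exact_mod_cast hs
  set b : ℝ := σ ^ 2 * s with hb
  have hb0 : 0 < b := by positivity
  set Bd : List V → V → Prop := fun l v => b ≤ #(Ul G B D l) ∧
      (#{z ∈ Ul G B D l | G.Adj v z} : ℝ) < κp * #(Ul G B D l) with hBd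
  have hBd1 : ∀ l, (#{v ∈ A | Bd l v} : ℝ) ≤ σ ^ 2 * s := by
    intro l
    by_contra! hc
    have hne : ({v ∈ A | Bd l v} : Finset V).Nonempty := by
      rw [← Finset.card_pos]
      have : (0 : ℝ) < #{v ∈ A | Bd l v} := hb0.trans hc
      exact_mod_cast this
    obtain ⟨v, hv⟩ := hne
    have hv' := (Finset.mem_filter.1 hv).2.1
    have h1 := hLR {v ∈ A | Bd l v} (Ul G B D l) (Finset.filter_subset _ _)
      (Finset.filter_subset _ _) hc.le hv'
    rw [eG_eq_sum_left] at h1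
    have h2 : ((∑ x ∈ A with Bd l x, #{y ∈ Ul G B D l | G.Adj x y} : ℕ) : ℝ)
        < ∑ x ∈ A with Bd l x, κp * #(Ul G B D l) := by
      push_cast
      apply Finset.sum_lt_sum_of_nonempty ⟨v, hv⟩
      intro x hx
      exact (Finset.mem_filter.1 hx).2.2
    rw [Finset.sum_const, nsmul_eq_mul] at h2
    linarith [mul_right_comm κp (#{v ∈ A | Bd l v} : ℝ) (#(Ul G B D l) : ℝ)]
  refine le_trans ?_ (seq_count A s (by exact_mod_cast hA) hσ hσ1 Bd hBd1 q)
  have := set_count A q (fun X => σ ^ 2 * s ≤ #{z ∈ B | #{x ∈ X | G.Adj x z} < D})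
    (fun l => q ≤ 2 * bads Bd l) ?_
  · exact_mod_cast this
  intro X hX hP l hl hlX
  have hU : Ul G B D l = {z ∈ B | #{x ∈ X | G.Adj x z} < D} := by
    unfold Ul
    simp_rw [ldeg_eq G hl, hlX]
  have hpot := potential G B D b κp hκ.le l (by rw [hU]; exact hP)
  have hlen : l.length = q := by
    rw [← List.toFinset_card_of_nodup hl, hlX]; exact (Finset.mem_powersetCard.1 hX).2
  have h2 : ∑ z ∈ B, ((min (ldeg G l z) D : ℕ) : ℝ) ≤ s * D := by
    calc _ ≤ ∑ z ∈ B, (D : ℝ) := by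
          apply Finset.sum_le_sum; intro z _; exact_mod_cast min_le_right _ _
      _ = #B * D := by simp
      _ ≤ s * D := by gcongr
  push_cast at hpot h2
  have h3 : κp * b * (l.length - bads Bd l) ≤ s * D := hpot.trans h2
  rw [hlen] at h3
  have h4 : (q : ℝ) ≤ 2 * bads Bd l := by
    by_contra! hc
    have h5 : κp * b * (q / 2) < κp * b * (q - bads Bd l) := by
      apply mul_lt_mul_of_pos_left _ (by positivity)
      linarith
    have h6 : s * D ≤ s * (κp * σ ^ 2 * q / 2) := by gcongr; linarith
    rw [hb] at h5 h3
    linarith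
  exact_mod_cast h4

lemma badZ_count (B T : Finset V) (s : ℕ) (hB : #B ≤ s)
    {σ : ℝ} (hσ : 0 < σ) (hσ1 : σ ≤ 1) (hT : (#T : ℝ) ≤ σ ^ 2 * s) (q : ℕ) :
    (#{Z ∈ B.powersetCard q | q ≤ 2 * #{z ∈ Z | z ∈ T}} : ℝ) * q.factorial ≤ (2 * σ * s) ^ q := by
  refine le_trans ?_ (seq_count B s (by exact_mod_cast hB) hσ hσ1 (fun _ v => v ∈ T) ?_ q)
  · have := set_count B q (fun Z => q ≤ 2 * #{z ∈ Z | z ∈ T})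
      (fun l => q ≤ 2 * bads (fun _ v => v ∈ T) l) ?_
    · exact_mod_cast this
    intro Z hZ hP l hl hlZ
    refine hP.trans (le_of_eq ?_)
    congr 1
    have h1 : ∀ l : List V, bads (fun _ v => v ∈ T) l = l.countP (fun v => v ∈ T) := by
      intro l
      induction l with
      | nil => simp [bads]
      | cons a l ih => rw [bads, List.countP_cons, ih]; simp
    rw [h1, List.countP_eq_length_filter, ← List.toFinset_card_of_nodup (hl.filter _),
      List.toFinset_filter, hlZ]
    simp
  · intro l
    refine le_trans ?_ hT
    exact_mod_cast Finset.card_le_card (fun x hx => (Finset.mem_filter.1 hx).2)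

lemma bad_pair_count (G : SimpleGraph V) (A B : Finset V) (s : ℕ) (hA : #A ≤ s) (hB : #B ≤ s)
    (hs : 1 ≤ s) {σ κp : ℝ} (hσ : 0 < σ) (hσ1 : σ ≤ 1) (hκ : 0 < κp)
    (hLR : LR G A B (σ ^ 2 * s) κp) (q : ℕ) (hq : 4 ≤ κp * σ ^ 2 * q) :
    (#{x ∈ A.powersetCard q ×ˢ B.powersetCard q |
      (eG G x.1 x.2 : ℝ) < κp * σ ^ 2 / 8 * q ^ 2} : ℝ) * (q.factorial) ^ 2
      ≤ 2 * (2 * σ) ^ q * (s : ℝ) ^ (2 * q) := by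
  set D : ℕ := ⌈κp * σ ^ 2 * q / 4⌉₊ with hD
  have hD1 : κp * σ ^ 2 * q / 4 ≤ D := Nat.le_ceil _
  have hD2 : 2 * (D : ℝ) ≤ κp * σ ^ 2 * q := by
    have := Nat.ceil_lt_add_one (show 0 ≤ κp * σ ^ 2 * q / 4 by positivity)
    rw [← hD] at this
    linarith
  set U : Finset V → Finset V := fun X => {z ∈ B | #{x ∈ X | G.Adj x z} < D} with hU
  set F1 := {X ∈ A.powersetCard q | σ ^ 2 * s ≤ #(U X)} with hF1
  set F2 := fun X => {Z ∈ B.powersetCard q | q ≤ 2 * #{z ∈ Z | z ∈ U X}} with hF2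
  set A' := {X ∈ A.powersetCard q | (#(U X) : ℝ) < σ ^ 2 * s} with hA'
  have hsub : {x ∈ A.powersetCard q ×ˢ B.powersetCard q |
      (eG G x.1 x.2 : ℝ) < κp * σ ^ 2 / 8 * q ^ 2} ⊆
      F1 ×ˢ B.powersetCard q ∪ A'.biUnion (fun X => {X} ×ˢ F2 X) := by
    rintro ⟨X, Z⟩ hx
    simp only [Finset.mem_filter, Finset.mem_product] at hx
    obtain ⟨⟨hX, hZ⟩, hlt⟩ := hx
    by_cases h1 : σ ^ 2 * s ≤ #(U X)
    · apply Finset.mem_union_left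
      rw [Finset.mem_product]
      exact ⟨Finset.mem_filter.2 ⟨hX, h1⟩, hZ⟩
    · apply Finset.mem_union_right
      rw [Finset.mem_biUnion]
      refine ⟨X, Finset.mem_filter.2 ⟨hX, not_le.1 h1⟩, ?_⟩
      rw [Finset.mem_product]
      refine ⟨Finset.mem_singleton_self _, Finset.mem_filter.2 ⟨hZ, ?_⟩⟩
      by_contra! hc
      have hZ' := Finset.mem_powersetCard.1 hZ
      have h2 : #{z ∈ Z | z ∉ U X} * D ≤ eG G X Z := by
        rw [eG_eq_sum_right, ← smul_eq_mul, ← Finset.sum_const]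
        refine le_trans (Finset.sum_le_sum ?_) (Finset.sum_le_sum_of_subset (Finset.filter_subset _ _))
        intro z hz
        simp only [hU, Finset.mem_filter, not_and, not_lt] at hz
        exact hz.2 (hZ'.1 hz.1)
      have h3 : #{z ∈ Z | z ∈ U X} + #{z ∈ Z | z ∉ U X} = q := by
        rw [Finset.card_filter_add_card_filter_not, hZ'.2]
      have h4 : (q : ℝ) ≤ 2 * #{z ∈ Z | z ∉ U X} := by
        have hc' : 2 * #{z ∈ Z | z ∈ U X} < q := hc
        exact_mod_cast (show q ≤ 2 * #{z ∈ Z | z ∉ U X} by omega)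
      have h5 : (#{z ∈ Z | z ∉ U X} : ℝ) * D ≤ eG G X Z := by exact_mod_cast h2
      have h6 : (q : ℝ) / 2 * (κp * σ ^ 2 * q / 4) ≤ #{z ∈ Z | z ∉ U X} * D := by
        gcongr; linarith
      nlinarith
  have hcard := Finset.card_le_card hsub
  have h1 : (#(F1 ×ˢ B.powersetCard q) : ℝ) * q.factorial ^ 2 ≤ (2 * σ * s) ^ q * (s : ℝ) ^ q := by
    have ha := badX_count G A B s hA hB hs hσ hσ1 hκ hLR D q hD2
    have hb : (#(B.powersetCard q) * q.factorial : ℝ) ≤ s ^ q := by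
      exact_mod_cast powersetCard_count B s hB q
    rw [Finset.card_product]
    push_cast
    calc (#F1 : ℝ) * #(B.powersetCard q) * q.factorial ^ 2
        = (#F1 * q.factorial) * (#(B.powersetCard q) * q.factorial) := by ring
      _ ≤ _ := by gcongr
  have h2 : (#(A'.biUnion (fun X => {X} ×ˢ F2 X)) : ℝ) * q.factorial ^ 2
      ≤ (s : ℝ) ^ q * (2 * σ * s) ^ q := by
    have ha : (#(A.powersetCard q) * q.factorial : ℝ) ≤ s ^ q := by
      exact_mod_cast powersetCard_count A s hA q
    have hb : (#(A'.biUnion (fun X => {X} ×ˢ F2 X)) : ℝ) ≤ ∑ X ∈ A', (#(F2 X) : ℝ) := by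
      have := Finset.card_biUnion_le (s := A') (t := fun X => {X} ×ˢ F2 X)
      simp only [Finset.card_product, Finset.card_singleton, one_mul] at this
      exact_mod_cast this
    have hc : (∑ X ∈ A', (#(F2 X) : ℝ)) * q.factorial ≤ #(A.powersetCard q) * (2 * σ * s) ^ q := by
      rw [Finset.sum_mul]
      calc _ ≤ ∑ X ∈ A', (2 * σ * s) ^ q := by
            apply Finset.sum_le_sum
            intro X hX
            exact badZ_count B (U X) s hB hσ hσ1 (Finset.mem_filter.1 hX).2.le q
        _ = #A' * (2 * σ * s) ^ q := by simp
        _ ≤ _ := by gcongr; exact Finset.filter_subset _ _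
    calc _ ≤ (∑ X ∈ A', (#(F2 X) : ℝ)) * q.factorial ^ 2 := by gcongr
      _ = (∑ X ∈ A', (#(F2 X) : ℝ)) * q.factorial * q.factorial := by ring
      _ ≤ #(A.powersetCard q) * (2 * σ * s) ^ q * q.factorial := by gcongr
      _ = (#(A.powersetCard q) * q.factorial) * (2 * σ * s) ^ q := by ring
      _ ≤ _ := by gcongr
  have h3 := Finset.card_union_le (F1 ×ˢ B.powersetCard q) (A'.biUnion (fun X => {X} ×ˢ F2 X))
  calc _ ≤ ((#(F1 ×ˢ B.powersetCard q) : ℝ) + #(A'.biUnion (fun X => {X} ×ˢ F2 X)))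
        * q.factorial ^ 2 := by
        gcongr
        exact_mod_cast hcard.trans h3
    _ ≤ (2 * σ * s) ^ q * (s : ℝ) ^ q + (s : ℝ) ^ q * (2 * σ * s) ^ q := by
        rw [add_mul]; exact add_le_add h1 h2
    _ = _ := by rw [mul_pow (2 * σ), pow_mul', sq]; ring

end lists
end NS

namespace NS
open Classical Finset

section inh
variable {n : ℕ}

def InhBad (Γ G : SimpleGraph (Fin n)) (A B : Finset (Fin n)) (q : ℕ) (t : ℝ) (y : Fin n) : Prop :=
  ∃ X Z : Finset (Fin n), X ⊆ A ∧ Z ⊆ B ∧ #X = q ∧ #Z = q ∧ (∀ x ∈ X, Γ.Adj y x) ∧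
    (∀ z ∈ Z, Γ.Adj y z) ∧ (eG G X Z : ℝ) < t

def Inh (Γ : SimpleGraph (Fin n)) (p κ η σ : ℝ) (s : ℕ) : Prop :=
  ∀ G : SimpleGraph (Fin n), G ≤ Γ → ∀ A B : Finset (Fin n), Disjoint A B → #A ≤ s → #B ≤ s →
    LR G A B (σ ^ 2 * s) (κ * p) →
    (#{y ∈ (A ∪ B)ᶜ | InhBad Γ G A B ⌈η * s * p⌉₊
      (κ * p * σ ^ 2 / 8 * (⌈η * s * p⌉₊ : ℝ) ^ 2) y} : ℝ) ≤ η * s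

noncomputable def sg (η : ℝ) : ℝ := η ^ 2 * Real.exp (-(3 / η ^ 2)) / (4 * Real.exp 2)

lemma sg_pos {η : ℝ} (h : 0 < η) : 0 < sg η := by unfold sg; positivity

lemma sg_le {η : ℝ} (h : 0 < η) (h1 : η ≤ 1) : sg η ≤ 1 := by
  unfold sg
  rw [div_le_one (by positivity)]
  have h2 : Real.exp (-(3 / η ^ 2)) ≤ 1 := by
    rw [Real.exp_le_one_iff]
    have : 0 < 3 / η ^ 2 := by positivity
    linarith
  have h3 : (1 : ℝ) ≤ Real.exp 2 := by
    have := Real.add_one_le_exp (2 : ℝ); linarith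
  have h4 : η ^ 2 ≤ 1 := by nlinarith
  have : 0 < Real.exp (-(3 / η ^ 2)) := Real.exp_pos _
  nlinarith

/-- bipartite graph of a set of pairs -/
def gr (F : Finset (Fin n × Fin n)) : SimpleGraph (Fin n) := SimpleGraph.fromRel (fun u v => (u, v) ∈ F)

lemma gr_adj {A B : Finset (Fin n)} (hd : Disjoint A B) {F : Finset (Fin n × Fin n)}
    (hF : F ⊆ A ×ˢ B) {u v : Fin n} (hu : u ∈ A) (hv : v ∈ B) : (gr F).Adj u v ↔ (u, v) ∈ F := by
  unfold gr
  rw [SimpleGraph.fromRel_adj]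
  constructor
  · rintro ⟨-, h | h⟩
    · exact h
    · have := Finset.mem_product.1 (hF h)
      exact absurd hv (Finset.disjoint_left.1 hd this.1)
  · intro h
    refine ⟨?_, Or.inl h⟩
    rintro rfl
    exact Finset.disjoint_left.1 hd hu hv

lemma eG_gr {A B X Z : Finset (Fin n)} (hd : Disjoint A B) (G : SimpleGraph (Fin n))
    (hX : X ⊆ A) (hZ : Z ⊆ B) :
    eG (gr {q ∈ A ×ˢ B | G.Adj q.1 q.2}) X Z = eG G X Z := by
  unfold eG
  congr 1
  apply Finset.filter_congr
  intro q hq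
  have hq' := Finset.mem_product.1 hq
  rw [gr_adj hd (Finset.filter_subset _ _) (hX hq'.1) (hZ hq'.2)]
  simp [hX hq'.1, hZ hq'.2]

noncomputable def BP (A B : Finset (Fin n)) (q : ℕ) (t : ℝ) (F : Finset (Fin n × Fin n)) :
    Finset (Finset (Fin n) × Finset (Fin n)) :=
  {x ∈ A.powersetCard q ×ˢ B.powersetCard q | (eG (gr F) x.1 x.2 : ℝ) < t}

lemma BP_bound {A B : Finset (Fin n)} {s : ℕ} (hA : #A ≤ s) (hB : #B ≤ s) (hs : 1 ≤ s)
    {p κ η : ℝ} (hp : 0 < p) (hκ : 0 < κ) (hη : 0 < η) (hη1 : η ≤ 1)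
    {F : Finset (Fin n × Fin n)} (hLR : LR (gr F) A B ((sg η) ^ 2 * s) (κ * p))
    {q : ℕ} (hq : η * s * p ≤ q) (hq4 : 4 ≤ κ * p * (sg η) ^ 2 * q) :
    (#(BP A B q (κ * p * (sg η) ^ 2 / 8 * (q : ℝ) ^ 2) F) : ℝ) * p ^ (2 * q)
      ≤ Real.exp (-(3 / η ^ 2)) ^ q := by
  have h := bad_pair_count (gr F) A B s hA hB hs (sg_pos hη) (sg_le hη hη1)
    (mul_pos hκ hp) hLR q hq4
  have hq0 : 1 ≤ q := by
    rcases Nat.eq_zero_or_pos q with h0 | h0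
    · subst h0; norm_num at hq4
    · exact h0
  have hfac : (0 : ℝ) < q.factorial := by exact_mod_cast Nat.factorial_pos q
  have h1 : ((q : ℝ)) ^ q ≤ Real.exp q * q.factorial := by
    have := Real.pow_div_factorial_le_exp (q : ℝ) (by positivity) q
    rwa [div_le_iff₀ hfac] at this
  have h2 : (s * p) ^ q ≤ (Real.exp q * q.factorial) / η ^ q := by
    rw [le_div_iff₀ (by positivity), ← mul_pow]
    refine le_trans ?_ h1
    gcongr
    linarith
  have h3 : (#(BP A B q (κ * p * (sg η) ^ 2 / 8 * (q : ℝ) ^ 2) F) : ℝ) * p ^ (2 * q) *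
      (q.factorial : ℝ) ^ 2 ≤ 2 * (2 * sg η) ^ q * ((Real.exp q * q.factorial) / η ^ q) ^ 2 := by
    calc _ = (#(BP A B q (κ * p * (sg η) ^ 2 / 8 * (q : ℝ) ^ 2) F) : ℝ) *
          (q.factorial : ℝ) ^ 2 * p ^ (2 * q) := by ring
      _ ≤ 2 * (2 * sg η) ^ q * (s : ℝ) ^ (2 * q) * p ^ (2 * q) := by
          unfold BP
          gcongr
      _ = 2 * (2 * sg η) ^ q * ((s * p) ^ q) ^ 2 := by ring
      _ ≤ _ := by
          have := sg_pos hη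
          gcongr
  have h4 : 2 * (2 * sg η) ^ q * ((Real.exp q * q.factorial) / η ^ q) ^ 2
      = 2 * (2 * sg η * Real.exp 2 / η ^ 2) ^ q * (q.factorial : ℝ) ^ 2 := by
    have : Real.exp q ^ 2 = Real.exp 2 ^ q := by
      rw [← Real.exp_nat_mul, ← Real.exp_nat_mul]; congr 1; push_cast; ring
    rw [div_pow, mul_pow (Real.exp (q:ℝ)), this, div_pow (2 * sg η * Real.exp 2), mul_pow (2 * sg η) (Real.exp 2)]
    ring
  rw [h4] at h3
  have h5 := le_of_mul_le_mul_right h3 (by positivity)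
  refine h5.trans ?_
  have h6 : 2 * sg η * Real.exp 2 / η ^ 2 = Real.exp (-(3 / η ^ 2)) / 2 := by
    unfold sg; field_simp; ring
  rw [h6, div_pow]
  have h7 : (2 : ℝ) ≤ 2 ^ q := by
    calc (2 : ℝ) = 2 ^ 1 := by norm_num
      _ ≤ 2 ^ q := pow_le_pow_right₀ (by norm_num) hq0
  rw [mul_div_assoc', div_le_iff₀ (by positivity)]
  have : 0 < Real.exp (-(3 / η ^ 2)) ^ q := by positivity
  nlinarith

lemma Tcard {A B Y : Finset (Fin n)} (hd : Disjoint A B) (hY : Disjoint Y (A ∪ B))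
    {F : Finset (Fin n × Fin n)} (hF : F ⊆ A ×ˢ B) {q : ℕ}
    (g : Fin n → Finset (Fin n) × Finset (Fin n))
    (hg : ∀ y ∈ Y, (g y).1 ∈ A.powersetCard q ∧ (g y).2 ∈ B.powersetCard q) :
    #((F ∪ Y.biUnion (fun y => {y} ×ˢ ((g y).1 ∪ (g y).2))).image (fun e => s(e.1, e.2)))
      = #F + 2 * q * #Y := by
  have hAY : ∀ y ∈ Y, y ∉ A ∧ y ∉ B := by
    intro y hy
    have := Finset.disjoint_left.1 hY hy
    simpa using this
  have hgs : ∀ y ∈ Y, ∀ z ∈ (g y).1 ∪ (g y).2, z ∈ A ∨ z ∈ B := by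
    intro y hy z hz
    rcases Finset.mem_union.1 hz with h | h
    · exact Or.inl ((Finset.mem_powersetCard.1 (hg y hy).1).1 h)
    · exact Or.inr ((Finset.mem_powersetCard.1 (hg y hy).2).1 h)
  have hT : ∀ e ∈ F ∪ Y.biUnion (fun y => {y} ×ˢ ((g y).1 ∪ (g y).2)),
      (e.1 ∈ A ∧ e.2 ∈ B) ∨ (e.1 ∈ Y ∧ (e.2 ∈ A ∨ e.2 ∈ B)) := by
    intro e he
    rcases Finset.mem_union.1 he with h | h
    · left; exact Finset.mem_product.1 (hF h)
    · right
      obtain ⟨y, hy, h⟩ := Finset.mem_biUnion.1 h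
      have h' := Finset.mem_product.1 h
      have h1 : e.1 = y := by simpa using h'.1
      rw [h1]
      exact ⟨hy, hgs y hy _ h'.2⟩
  rw [Finset.card_image_of_injOn]
  · rw [Finset.card_union_of_disjoint, Finset.card_biUnion]
    · congr 1
      calc _ = ∑ y ∈ Y, 2 * q := by
            apply Finset.sum_congr rfl
            intro y hy
            rw [Finset.card_product, Finset.card_singleton, one_mul, Finset.card_union_of_disjoint,
              (Finset.mem_powersetCard.1 (hg y hy).1).2, (Finset.mem_powersetCard.1 (hg y hy).2).2]
            · ring
            · exact Finset.disjoint_of_subset_left (Finset.mem_powersetCard.1 (hg y hy).1).1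
                (Finset.disjoint_of_subset_right (Finset.mem_powersetCard.1 (hg y hy).2).1 hd)
        _ = _ := by rw [Finset.sum_const, smul_eq_mul, mul_comm]
    · intro y hy y' hy' hne
      refine Finset.disjoint_left.2 ?_
      intro e he he'
      have h1 := (Finset.mem_product.1 he).1
      have h2 := (Finset.mem_product.1 he').1
      rw [Finset.mem_singleton] at h1 h2
      exact hne (h1.symm.trans h2)
    · refine Finset.disjoint_left.2 ?_
      intro e he he'
      have h1 := (Finset.mem_product.1 (hF he)).1
      obtain ⟨y, hy, h⟩ := Finset.mem_biUnion.1 he'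
      have h2 := (Finset.mem_product.1 h).1
      rw [Finset.mem_singleton] at h2
      rw [h2] at h1
      exact (hAY y hy).1 h1
  · intro e he e' he' hee
    have h1 := hT e he
    have h2 := hT e' he'
    have hd' : ∀ x, x ∈ A → x ∉ B := fun x hx => Finset.disjoint_left.1 hd hx
    rcases Sym2.eq_iff.1 hee with h | h
    · exact Prod.ext h.1 h.2
    · exfalso
      rw [h.1, h.2] at h1
      rcases h1 with h1 | h1 <;> rcases h2 with h2 | h2
      · exact hd' _ h1.1 h2.2
      · exact (hAY _ h2.1).2 h1.2
      · exact (hAY _ h1.1).2 h2.2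
      · rcases h1.2 with h3 | h3
        · exact (hAY _ h2.1).1 h3
        · exact (hAY _ h2.1).2 h3

lemma inh_F {A B Y : Finset (Fin n)} {s : ℕ} (hd : Disjoint A B) (hY : Disjoint Y (A ∪ B))
    (hA : #A ≤ s) (hB : #B ≤ s) (hs : 1 ≤ s)
    {p κ η : ℝ} (hp : 0 < p) (hp1 : p ≤ 1) (hκ : 0 < κ) (hη : 0 < η) (hη1 : η ≤ 1)
    {F : Finset (Fin n × Fin n)} (hF : F ⊆ A ×ˢ B)
    (hLR : LR (gr F) A B ((sg η) ^ 2 * s) (κ * p))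
    {q : ℕ} (hq : η * s * p ≤ q) (hq4 : 4 ≤ κ * p * (sg η) ^ 2 * q) (hYc : η * s ≤ #Y) :
    Pr p (fun ω : Sym2 (Fin n) → Bool => (∀ e ∈ F, ω s(e.1, e.2) = true) ∧ ∀ y ∈ Y,
      ∃ x ∈ BP A B q (κ * p * (sg η) ^ 2 / 8 * (q : ℝ) ^ 2) F,
        ∀ z ∈ x.1 ∪ x.2, ω s(y, z) = true) ≤ p ^ #F * Real.exp (-(3 * p * s ^ 2)) := by
  set bp := BP A B q (κ * p * (sg η) ^ 2 / 8 * (q : ℝ) ^ 2) F with hbp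
  set T : (Fin n → Finset (Fin n) × Finset (Fin n)) → Finset (Sym2 (Fin n)) := fun g =>
    (F ∪ Y.biUnion (fun y => {y} ×ˢ ((g y).1 ∪ (g y).2))).image (fun e => s(e.1, e.2)) with hT
  calc _ ≤ ∑ g ∈ Fintype.piFinset (fun y => if y ∈ Y then bp else {(∅, ∅)}),
        Pr p (fun ω => ∀ e ∈ T g, ω e = true) := by
        apply Pr_union hp.le hp1
        rintro ω ⟨h1, h2⟩
        choose! g hg1 hg2 using h2
        refine ⟨fun y => if y ∈ Y then g y else (∅, ∅), ?_, ?_⟩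
        · rw [Fintype.mem_piFinset]
          intro y
          split_ifs with h
          · exact hg1 y h
          · simp
        · intro e he
          simp only [hT, Finset.mem_image, Finset.mem_union, Finset.mem_biUnion,
            Finset.mem_product, Finset.mem_singleton] at he
          obtain ⟨⟨u, v⟩, h | ⟨y, hy, h3, h4⟩, rfl⟩ := he
          · exact h1 _ h
          · dsimp only at h3 h4 ⊢
            subst h3
            rw [if_pos hy] at h4
            exact hg2 u hy v (Finset.mem_union.2 h4)
    _ = ∑ g ∈ Fintype.piFinset (fun y => if y ∈ Y then bp else {(∅, ∅)}),
        p ^ (#F + 2 * q * #Y) := by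
        apply Finset.sum_congr rfl
        intro g hg
        rw [Pr_all, hT]
        dsimp only
        rw [Tcard hd hY hF]
        intro y hy
        have := Fintype.mem_piFinset.1 hg y
        rw [if_pos hy] at this
        simp only [hbp, BP, Finset.mem_filter, Finset.mem_product] at this
        exact this.1
    _ = p ^ #F * ((#bp : ℝ) * p ^ (2 * q)) ^ #Y := by
        rw [Finset.sum_const, Fintype.card_piFinset, nsmul_eq_mul]
        have : ∏ y, #(if y ∈ Y then bp else {((∅ : Finset (Fin n)), (∅ : Finset (Fin n)))}) = #bp ^ #Y := by
          have h1 : ∀ y, #(if y ∈ Y then bp else {((∅ : Finset (Fin n)), (∅ : Finset (Fin n)))})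
              = if y ∈ Y then #bp else 1 := by
            intro y; split_ifs <;> simp
          simp_rw [h1]
          rw [Finset.prod_ite_mem]; simp
        rw [this]
        push_cast
        rw [pow_add, pow_mul, mul_pow]
        ring
    _ ≤ p ^ #F * (Real.exp (-(3 / η ^ 2)) ^ q) ^ #Y := by
        gcongr
        exact BP_bound hA hB hs hp hκ hη hη1 hLR hq hq4
    _ ≤ _ := by
        gcongr
        rw [← Real.exp_nat_mul, ← Real.exp_nat_mul]
        apply Real.exp_le_exp.2
        have h1 : (η * s * p) * (η * s) ≤ q * #Y := by gcongr
        have h2 : (3 / η ^ 2) * ((η * s * p) * (η * s)) ≤ (3 / η ^ 2) * (q * #Y) := by gcongr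
        have h3 : (3 / η ^ 2) * ((η * s * p) * (η * s)) = 3 * p * s ^ 2 := by field_simp
        nlinarith

lemma inh_ABY {A B Y : Finset (Fin n)} {s : ℕ} (hd : Disjoint A B) (hY : Disjoint Y (A ∪ B))
    (hA : #A ≤ s) (hB : #B ≤ s) (hs : 1 ≤ s)
    {p κ η : ℝ} (hp : 0 < p) (hp1 : p ≤ 1) (hκ : 0 < κ) (hη : 0 < η) (hη1 : η ≤ 1)
    {q : ℕ} (hq : η * s * p ≤ q) (hq4 : 4 ≤ κ * p * (sg η) ^ 2 * q) (hYc : η * s ≤ #Y) :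
    Pr p (fun ω : Sym2 (Fin n) → Bool => ∃ F ⊆ A ×ˢ B, LR (gr F) A B ((sg η) ^ 2 * s) (κ * p) ∧
      (∀ e ∈ F, ω s(e.1, e.2) = true) ∧ ∀ y ∈ Y,
      ∃ x ∈ BP A B q (κ * p * (sg η) ^ 2 / 8 * (q : ℝ) ^ 2) F,
        ∀ z ∈ x.1 ∪ x.2, ω s(y, z) = true) ≤ Real.exp (-(2 * p * s ^ 2)) := by
  calc _ ≤ ∑ F ∈ (A ×ˢ B).powerset with LR (gr F) A B ((sg η) ^ 2 * s) (κ * p),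
        Pr p (fun ω : Sym2 (Fin n) → Bool => (∀ e ∈ F, ω s(e.1, e.2) = true) ∧ ∀ y ∈ Y,
      ∃ x ∈ BP A B q (κ * p * (sg η) ^ 2 / 8 * (q : ℝ) ^ 2) F,
        ∀ z ∈ x.1 ∪ x.2, ω s(y, z) = true) := by
        apply Pr_union hp.le hp1
        rintro ω ⟨F, hF, hLR, h⟩
        exact ⟨F, Finset.mem_filter.2 ⟨Finset.mem_powerset.2 hF, hLR⟩, h⟩
    _ ≤ ∑ F ∈ (A ×ˢ B).powerset with LR (gr F) A B ((sg η) ^ 2 * s) (κ * p),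
        p ^ #F * Real.exp (-(3 * p * s ^ 2)) := by
        apply Finset.sum_le_sum
        intro F hF
        simp only [Finset.mem_filter, Finset.mem_powerset] at hF
        exact inh_F hd hY hA hB hs hp hp1 hκ hη hη1 hF.1 hF.2 hq hq4 hYc
    _ ≤ ∑ F ∈ (A ×ˢ B).powerset, p ^ #F * Real.exp (-(3 * p * s ^ 2)) := by
        apply Finset.sum_le_sum_of_subset_of_nonneg (Finset.filter_subset _ _)
        intro F _ _
        positivity
    _ = (p + 1) ^ (#A * #B) * Real.exp (-(3 * p * s ^ 2)) := by
        rw [← Finset.sum_mul]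
        congr 1
        have := Finset.sum_pow_mul_eq_add_pow p 1 (A ×ˢ B)
        simpa using this
    _ ≤ Real.exp (p * s ^ 2) * Real.exp (-(3 * p * s ^ 2)) := by
        gcongr
        calc (p + 1) ^ (#A * #B) ≤ (p + 1) ^ (s * s) := by
              apply pow_le_pow_right₀ (by linarith); gcongr
          _ ≤ (Real.exp p) ^ (s * s) := by gcongr; exact Real.add_one_le_exp p
          _ = _ := by rw [← Real.exp_nat_mul]; push_cast; ring_nf
    _ = _ := by rw [← Real.exp_add]; ring_nf

lemma inh_fixed {s : ℕ} (hs : 1 ≤ s) {p κ η : ℝ} (hp : 0 < p) (hp1 : p ≤ 1) (hκ : 0 < κ)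
    (hη : 0 < η) (hη1 : η ≤ 1) (hq4 : 4 ≤ κ * p * (sg η) ^ 2 * ⌈η * s * p⌉₊) :
    Pr p (fun ω : Sym2 (Fin n) → Bool => ¬ Inh (graphOf ω) p κ η (sg η) s) ≤
      8 ^ n * Real.exp (-(2 * p * s ^ 2)) := by
  set q := ⌈η * s * p⌉₊ with hqdef
  have hq : η * s * p ≤ q := Nat.le_ceil _
  set ev : Finset (Fin n) × Finset (Fin n) × Finset (Fin n) → (Sym2 (Fin n) → Bool) → Prop :=
    fun t ω => ∃ F ⊆ t.1 ×ˢ t.2.1, LR (gr F) t.1 t.2.1 ((sg η) ^ 2 * s) (κ * p) ∧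
      (∀ e ∈ F, ω s(e.1, e.2) = true) ∧ ∀ y ∈ t.2.2,
      ∃ x ∈ BP t.1 t.2.1 q (κ * p * (sg η) ^ 2 / 8 * (q : ℝ) ^ 2) F,
        ∀ z ∈ x.1 ∪ x.2, ω s(y, z) = true with hev
  calc _ ≤ ∑ t : Finset (Fin n) × Finset (Fin n) × Finset (Fin n) with
        (Disjoint t.1 t.2.1 ∧ Disjoint t.2.2 (t.1 ∪ t.2.1) ∧ #t.1 ≤ s ∧ #t.2.1 ≤ s ∧ η * s ≤ #t.2.2),
        Pr p (ev t) := by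
        apply Pr_union hp.le hp1
        intro ω h
        unfold Inh at h
        push Not at h
        obtain ⟨G, hG, A, B, hd, hA, hB, hLR, hlt⟩ := h
        refine ⟨(A, B, {y ∈ (A ∪ B)ᶜ | InhBad (graphOf ω) G A B q
          (κ * p * (sg η) ^ 2 / 8 * (q : ℝ) ^ 2) y}), ?_, ?_⟩
        · simp only [Finset.mem_filter, Finset.mem_univ, true_and]
          refine ⟨hd, ?_, hA, hB, hlt.le⟩
          refine Finset.disjoint_left.2 ?_
          intro y hy hy'
          exact Finset.mem_compl.1 (Finset.mem_filter.1 hy).1 hy'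
        · refine ⟨{q ∈ A ×ˢ B | G.Adj q.1 q.2}, Finset.filter_subset _ _, ?_, ?_, ?_⟩
          · intro X Z hX hZ hx hz
            rw [eG_gr hd G hX hZ]
            exact hLR X Z hX hZ hx hz
          · intro e he
            have := hG (Finset.mem_filter.1 he).2
            rw [graphOf_adj] at this
            exact this.2
          · intro y hy
            obtain ⟨X, Z, hX, hZ, hXc, hZc, h1, h2, h3⟩ := (Finset.mem_filter.1 hy).2
            refine ⟨(X, Z), ?_, ?_⟩
            · simp only [BP, Finset.mem_filter, Finset.mem_product, Finset.mem_powersetCard]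
              refine ⟨⟨⟨hX, hXc⟩, hZ, hZc⟩, ?_⟩
              rw [eG_gr hd G hX hZ]
              exact h3
            · intro z hz
              rcases Finset.mem_union.1 hz with hz | hz
              · exact ((graphOf_adj _ _ _).1 (h1 z hz)).2
              · exact ((graphOf_adj _ _ _).1 (h2 z hz)).2
    _ ≤ ∑ t : Finset (Fin n) × Finset (Fin n) × Finset (Fin n) with
        (Disjoint t.1 t.2.1 ∧ Disjoint t.2.2 (t.1 ∪ t.2.1) ∧ #t.1 ≤ s ∧ #t.2.1 ≤ s ∧ η * s ≤ #t.2.2),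
        Real.exp (-(2 * p * s ^ 2)) := by
        apply Finset.sum_le_sum
        intro t ht
        simp only [Finset.mem_filter, Finset.mem_univ, true_and] at ht
        exact inh_ABY ht.1 ht.2.1 ht.2.2.1 ht.2.2.2.1 hs hp hp1 hκ hη hη1 hq hq4 ht.2.2.2.2
    _ ≤ ∑ t : Finset (Fin n) × Finset (Fin n) × Finset (Fin n), Real.exp (-(2 * p * s ^ 2)) := by
        apply Finset.sum_le_sum_of_subset_of_nonneg (Finset.filter_subset _ _)
        intro F _ _
        positivity
    _ = _ := by
        rw [Finset.sum_const, nsmul_eq_mul]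
        congr 1
        simp only [Finset.card_univ, Fintype.card_prod, Fintype.card_finset, Fintype.card_fin]
        push_cast
        rw [← mul_pow, ← mul_pow]; norm_num

end inh

lemma inh_event {γ : ℝ} (hγ : 0 < γ) {κ η ζ K : ℝ} (hκ : 0 < κ) (hη : 0 < η) (hη1 : η ≤ 1)
    (hζ : 0 < ζ) (hK : 0 < K) :
    ∃ N : ℕ, ∀ n : ℕ, N ≤ n → ∀ p : ℝ, (n : ℝ) ^ (γ - 1 / 2) ≤ p → p ≤ 1 →
      Pr p (fun ω : Sym2 (Fin n) → Bool =>
        ¬ ∀ s : ℕ, s ≤ n → (n : ℝ) ≤ K * s → Inh (graphOf ω) p κ η (sg η) s) ≤ ζ := by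
  have hsg := sg_pos hη
  obtain ⟨N1, hN1⟩ := np2_const hγ (3 * K ^ 2)
  obtain ⟨N2, hN2⟩ := np2_const hγ (4 * K / (κ * (sg η) ^ 2 * η))
  refine ⟨max (max N1 N2) (max 1 ⌈1 / ζ⌉₊), fun n hn p hp hp1 => ?_⟩
  simp only [max_le_iff] at hn
  obtain ⟨⟨hn1, hn2⟩, hn3, hn4⟩ := hn
  have h1 := hN1 n hn1 p hp
  have h2 := hN2 n hn2 p hp
  have hp0 := p_pos (by omega) hp
  have hn4' : 1 / ζ ≤ n := (Nat.le_ceil _).trans (by exact_mod_cast hn4)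
  have hn3' : (1 : ℝ) ≤ n := by exact_mod_cast hn3
  calc _ ≤ ∑ s ∈ range (n + 1) with (n : ℝ) ≤ K * (s : ℕ),
        Pr p (fun ω : Sym2 (Fin n) → Bool => ¬ Inh (graphOf ω) p κ η (sg η) s) := by
        apply Pr_union hp0.le hp1
        intro ω h
        push Not at h
        obtain ⟨s, hs, hs', h⟩ := h
        exact ⟨s, by simp [hs']; omega, h⟩
    _ ≤ ∑ s ∈ range (n + 1) with (n : ℝ) ≤ K * (s : ℕ), Real.exp (-(2 * n)) := by
        apply Finset.sum_le_sum
        intro s hs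
        have hs' := (Finset.mem_filter.1 hs).2
        have hs1 : 1 ≤ s := by
          rcases Nat.eq_zero_or_pos s with h0 | h0
          · subst h0; norm_num at hs'; omega
          · exact h0
        have hq4 : 4 ≤ κ * p * (sg η) ^ 2 * ⌈η * s * p⌉₊ := by
          have h3 : η * s * p ≤ ⌈η * s * p⌉₊ := Nat.le_ceil _
          have h4 : κ * p * (sg η) ^ 2 * (η * s * p) ≤ κ * p * (sg η) ^ 2 * ⌈η * s * p⌉₊ := by gcongr
          refine le_trans ?_ h4
          rw [div_le_iff₀ (by positivity)] at h2
          have h5 : n * p ^ 2 * (κ * (sg η) ^ 2 * η) ≤ K * s * p ^ 2 * (κ * (sg η) ^ 2 * η) := by gcongr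
          have h6 : K * 4 ≤ K * (κ * p * (sg η) ^ 2 * (η * s * p)) := by nlinarith
          exact le_of_mul_le_mul_left h6 hK
        refine (inh_fixed hs1 hp0 hp1 hκ hη hη1 hq4).trans ?_
        have h8 : (8 : ℝ) ^ n ≤ Real.exp (3 * n) := by
          rw [mul_comm, Real.exp_nat_mul]
          gcongr
          have : (8 : ℝ) ≤ (Real.exp 1) ^ 3 := by
            have := Real.exp_one_gt_d9
            calc (8 : ℝ) = 2 ^ 3 := by norm_num
              _ ≤ _ := by gcongr; linarith
          rw [← Real.exp_nat_mul] at this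
          simpa using this
        have h9 : 3 * (n : ℝ) ≤ p * s ^ 2 := by
          have h10 : (n : ℝ) ^ 2 * p ≤ (K * s) ^ 2 * p := by gcongr
          have h11 : (n : ℝ) * p ^ 2 ≤ n * p := by nlinarith
          have h12 : K ^ 2 * (3 * n) ≤ K ^ 2 * (p * s ^ 2) := by nlinarith
          exact le_of_mul_le_mul_left h12 (by positivity)
        calc (8 : ℝ) ^ n * Real.exp (-(2 * p * s ^ 2)) ≤ Real.exp (3 * n) * Real.exp (-(2 * p * s ^ 2)) := by
              gcongr
          _ = Real.exp (3 * n - 2 * p * s ^ 2) := by rw [← Real.exp_add]; ring_nf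
          _ ≤ _ := by apply Real.exp_le_exp.2; nlinarith
    _ ≤ ∑ s ∈ range (n + 1), Real.exp (-(2 * n)) := by
        apply Finset.sum_le_sum_of_subset_of_nonneg (Finset.filter_subset _ _)
        intro F _ _
        positivity
    _ ≤ Real.exp n * Real.exp (-(2 * n)) := by
        rw [Finset.sum_const, Finset.card_range, nsmul_eq_mul]
        gcongr
        push_cast
        exact Real.add_one_le_exp _
    _ = (Real.exp n)⁻¹ := by rw [← Real.exp_add, ← Real.exp_neg]; ring_nf
    _ ≤ (1 / ζ)⁻¹ := by
        gcongr
        have := Real.add_one_le_exp (n : ℝ)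
        linarith
    _ = ζ := by simp

end NS

namespace NS
open Classical Finset

section p4
variable {n : ℕ}

def near {l : ℕ} (i j : Fin l) : Prop := i.val < j.val ∧ j.val ≤ i.val + 2

noncomputable def eN {l : ℕ} (J : Finset (Fin l)) : ℕ := #{q ∈ J ×ˢ J | near q.1 q.2}

lemma eN_insert {l : ℕ} (J : Finset (Fin l)) (a : Fin l) (h : ∀ x ∈ J, x < a) :
    eN (insert a J) ≤ eN J + min 2 #J := by
  have h1 : {q ∈ (insert a J) ×ˢ (insert a J) | near q.1 q.2} ⊆
      {q ∈ J ×ˢ J | near q.1 q.2} ∪ ({i ∈ J | near i a}).image (fun i => (i, a)) := by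
    intro q hq
    obtain ⟨hq, hn⟩ := Finset.mem_filter.1 hq
    obtain ⟨h1, h2⟩ := Finset.mem_product.1 hq
    rw [Finset.mem_insert] at h1 h2
    rw [Finset.mem_union]
    rcases h1 with h1 | h1 <;> rcases h2 with h2 | h2
    · exfalso; rw [h1, h2] at hn; exact absurd hn.1 (lt_irrefl _)
    · exfalso
      have := h _ h2
      rw [h1] at hn
      exact absurd hn.1 (by simpa using this.le)
    · right
      refine Finset.mem_image.2 ⟨q.1, Finset.mem_filter.2 ⟨h1, h2 ▸ hn⟩, ?_⟩
      rw [← h2]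
    · left
      exact Finset.mem_filter.2 ⟨Finset.mem_product.2 ⟨h1, h2⟩, hn⟩
  have h2 := (Finset.card_le_card h1).trans (Finset.card_union_le _ _)
  have h3 : #(({i ∈ J | near i a}).image (fun i => (i, a))) ≤ min 2 #J := by
    refine Finset.card_image_le.trans (le_min ?_ (Finset.card_filter_le _ _))
    have : #{i ∈ J | near i a} ≤ #({a.val - 1, a.val - 2} : Finset ℕ) := by
      apply Finset.card_le_card_of_injOn (fun i => i.val)
      · intro i hi
        have := (Finset.mem_filter.1 hi).2
        unfold near at this
        simp
        omega
      · intro i _ j _ hij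
        exact Fin.ext hij
    exact this.trans Finset.card_le_two
  unfold eN
  omega

lemma eN_le {l : ℕ} (J : Finset (Fin l)) : (#J = 1 → eN J = 0) ∧ (2 ≤ #J → eN J + 3 ≤ 2 * #J) := by
  induction J using Finset.induction_on_max with
  | empty => simp
  | insert a s h ih =>
    have ha : a ∉ s := fun h' => lt_irrefl _ (h a h')
    rw [Finset.card_insert_of_notMem ha]
    have h1 := eN_insert s a h
    constructor
    · intro h2
      have : s = ∅ := Finset.card_eq_zero.1 (by omega)
      subst this
      simp [eN, near]
    · intro h2
      rcases Nat.lt_or_ge #s 2 with h3 | h3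
      · have h4 := ih.1 (by omega)
        have := min_le_right 2 #s
        omega
      · have h4 := ih.2 h3
        have := min_le_left 2 #s
        omega

lemma eN_split {l : ℕ} (I : Finset (Fin l)) (j : ℕ) (h1 : ∀ i ∈ I, i.val ≠ j ∧ i.val ≠ j + 1)
    (hl : 2 ≤ #{i ∈ I | i.val < j}) (hr : 2 ≤ #{i ∈ I | ¬ i.val < j}) : eN I + 6 ≤ 2 * #I := by
  have h2 := (eN_le _).2 hl
  have h3 := (eN_le _).2 hr
  have h4 := Finset.card_filter_add_card_filter_not (s := I) (fun i => i.val < j)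
  have h5 : eN I ≤ eN {i ∈ I | i.val < j} + eN {i ∈ I | ¬ i.val < j} := by
    unfold eN
    refine le_trans (Finset.card_le_card ?_) (Finset.card_union_le _ _)
    intro q hq
    obtain ⟨hq, hn⟩ := Finset.mem_filter.1 hq
    obtain ⟨h6, h7⟩ := Finset.mem_product.1 hq
    have h8 := h1 _ h6
    have h9 := h1 _ h7
    unfold near at hn
    rw [Finset.mem_union]
    by_cases h10 : q.2.val < j
    · left
      exact Finset.mem_filter.2 ⟨Finset.mem_product.2 ⟨Finset.mem_filter.2 ⟨h6, by omega⟩,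
        Finset.mem_filter.2 ⟨h7, h10⟩⟩, hn⟩
    · right
      exact Finset.mem_filter.2 ⟨Finset.mem_product.2 ⟨Finset.mem_filter.2 ⟨h6, by omega⟩,
        Finset.mem_filter.2 ⟨h7, h10⟩⟩, hn⟩
  omega

lemma eN_univ (k : ℕ) : 2 * k + 1 ≤ eN (univ : Finset (Fin (k + 2))) := by
  have : #(univ : Finset (Fin (k+1) ⊕ Fin k)) ≤ eN (univ : Finset (Fin (k + 2))) := by
    apply Finset.card_le_card_of_injOn (Sum.elim
      (fun i : Fin (k+1) => ((⟨i.val, by omega⟩, ⟨i.val+1, by omega⟩) : Fin (k+2) × Fin (k+2)))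
      (fun i : Fin k => (⟨i.val, by omega⟩, ⟨i.val+2, by omega⟩)))
    · intro x _
      rcases x with i | i <;> simp [near]
    · intro x _ y _ hxy
      rcases x with i | i <;> rcases y with j | j <;> simp [Fin.ext_iff] at hxy ⊢ <;> omega
  rw [Finset.card_univ, Fintype.card_sum, Fintype.card_fin, Fintype.card_fin] at this
  omega

def SqP (Γ : SimpleGraph (Fin n)) {l : ℕ} (v : Fin l → Fin n) : Prop :=
  ∀ i j : Fin l, near i j → Γ.Adj (v i) (v j)

def StrPair {l : ℕ} (x : (Fin l → Fin n) × (Fin l → Fin n)) : Prop :=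
  Function.Injective x.1 ∧ Function.Injective x.2 ∧ (∀ i j, i ≠ j → x.1 i ≠ x.2 j) ∧
  ∀ i : Fin l, (i.val < 2 ∨ l ≤ i.val + 2) → x.1 i = x.2 i

noncomputable def P4set (Γ : SimpleGraph (Fin n)) (l : ℕ) : Finset ((Fin l → Fin n) × (Fin l → Fin n)) :=
  {x | StrPair x ∧ SqP Γ x.1 ∧ SqP Γ x.2}

noncomputable def Tset {l : ℕ} (v : Fin l → Fin n) (J : Finset (Fin l)) : Finset (Sym2 (Fin n)) :=
  ({q ∈ J ×ˢ J | near q.1 q.2}).image (fun q => s(v q.1, v q.2))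

lemma Tset_card {l : ℕ} {v : Fin l → Fin n} (hv : Function.Injective v) (J : Finset (Fin l)) :
    #(Tset v J) = eN J := by
  unfold Tset eN
  apply Finset.card_image_of_injOn
  intro q hq q' hq' h
  have h1 := (Finset.mem_filter.1 hq).2
  have h2 := (Finset.mem_filter.1 hq').2
  rcases Sym2.eq_iff.1 h with ⟨ha, hb⟩ | ⟨ha, hb⟩
  · exact Prod.ext (hv ha) (hv hb)
  · have := hv ha
    have := hv hb
    simp_all [near]
    omega

noncomputable def coin {l : ℕ} (x : (Fin l → Fin n) × (Fin l → Fin n)) : Finset (Fin l) :=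
  {i | x.1 i = x.2 i}

lemma union_card {k : ℕ} {x : (Fin (k+2) → Fin n) × (Fin (k+2) → Fin n)} (h : StrPair x) :
    2 * (2 * k + 1) ≤ #(Tset x.1 univ ∪ Tset x.2 univ) + eN (coin x) := by
  have h1 := Finset.card_union_add_card_inter (Tset x.1 univ) (Tset x.2 univ)
  rw [Tset_card h.1, Tset_card h.2.1] at h1
  have h2 := eN_univ k
  have h3 : #(Tset x.1 univ ∩ Tset x.2 univ) ≤ #(Tset x.1 (coin x)) := by
    apply Finset.card_le_card
    intro e he
    obtain ⟨he1, he2⟩ := Finset.mem_inter.1 he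
    obtain ⟨q, hq, rfl⟩ := Finset.mem_image.1 he1
    obtain ⟨q', hq', hqq⟩ := Finset.mem_image.1 he2
    have h4 := (Finset.mem_filter.1 hq).2
    have h5 := (Finset.mem_filter.1 hq').2
    have key : ∀ i j, x.1 i = x.2 j → i = j := by
      intro i j hij
      by_contra hne
      exact h.2.2.1 i j hne hij
    refine Finset.mem_image.2 ⟨q, ?_, rfl⟩
    rcases Sym2.eq_iff.1 hqq with ⟨ha, hb⟩ | ⟨ha, hb⟩
    · have e1 := key _ _ ha.symm
      have e2 := key _ _ hb.symm
      rw [← e1] at ha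
      rw [← e2] at hb
      refine Finset.mem_filter.2 ⟨Finset.mem_product.2 ⟨?_, ?_⟩, h4⟩
      · simp [coin, ha]
      · simp [coin, hb]
    · exfalso
      have e1 := key _ _ ha.symm
      have e2 := key _ _ hb.symm
      unfold near at h4 h5
      rw [e1, e2] at h4
      omega
  rw [Tset_card h.1] at h3
  omega

lemma union_card' {l : ℕ} (hl : 2 ≤ l) {x : (Fin l → Fin n) × (Fin l → Fin n)} (h : StrPair x) :
    2 * (2 * (l - 2) + 1) ≤ #(Tset x.1 univ ∪ Tset x.2 univ) + eN (coin x) := by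
  obtain ⟨k, rfl⟩ : ∃ k, l = k + 2 := ⟨l - 2, by omega⟩
  exact union_card h

lemma coin_count {l : ℕ} (I : Finset (Fin l)) :
    #{x : (Fin l → Fin n) × (Fin l → Fin n) | coin x = I} ≤ n ^ (l + (l - #I)) := by
  have h1 : #{x : (Fin l → Fin n) × (Fin l → Fin n) | coin x = I} ≤
      #(univ : Finset ((Fin l → Fin n) × ({i // i ∈ Iᶜ} → Fin n))) := by
    apply Finset.card_le_card_of_injOn (fun x => (x.1, fun i => x.2 i.1))
    · intro x _; simp
    · intro x hx y hy hxy
      have hx' : coin x = I := by simpa using hx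
      have hy' : coin y = I := by simpa using hy
      simp only [Prod.mk.injEq] at hxy
      refine Prod.ext hxy.1 ?_
      funext i
      by_cases hi : i ∈ I
      · have a : x.1 i = x.2 i := by rw [← hx'] at hi; simpa [coin] using hi
        have b : y.1 i = y.2 i := by rw [← hy'] at hi; simpa [coin] using hi
        rw [← a, ← b, hxy.1]
      · exact congrFun hxy.2 ⟨i, by simpa using hi⟩
  refine h1.trans (le_of_eq ?_)
  simp only [Finset.card_univ, Fintype.card_prod, Fintype.card_fun, Fintype.card_fin,
    Fintype.card_coe, Finset.card_compl]
  rw [pow_add]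

lemma half_card {r : ℕ} (I : Finset (Fin (2 * r)))
    (h : ∀ t : ℕ, t < r → ∃ i ∈ I, i.val = 2 * t ∨ i.val = 2 * t + 1) : r ≤ #I := by
  have h' : ∀ t : Fin r, ∃ i ∈ I, i.val = 2 * t.val ∨ i.val = 2 * t.val + 1 := fun t => h t t.2
  choose f hf using h'
  have : #(univ : Finset (Fin r)) ≤ #I := by
    apply Finset.card_le_card_of_injOn f
    · intro t _
      exact (hf t).1
    · intro t _ u _ htu
      have h1 := (hf t).2
      have h2 := (hf u).2
      rw [htu] at h1
      apply Fin.ext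
      omega
  simpa using this

lemma term_bound {γ : ℝ} (hγ : 0 < γ) {r : ℕ} (hr : 3 / 4 ≤ γ * ((r : ℝ) - 4)) (hn : 1 ≤ n) {p : ℝ}
    (hp : (n : ℝ) ^ (γ - 1 / 2) ≤ p) (hp1 : p ≤ 1) (I : Finset (Fin (2 * r)))
    (hI : ∀ i : Fin (2 * r), (i.val < 2 ∨ 2 * r ≤ i.val + 2) → i ∈ I) {T : ℕ}
    (hT : 2 * (2 * (2 * r - 2) + 1) ≤ T + eN I) :
    (n : ℝ) ^ (2 * r + (2 * r - #I)) * p ^ T ≤ (n : ℝ) ^ (4 * r - 4) * p ^ (8 * r - 8) := by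
  have hr5 : 5 ≤ r := by
    by_contra hc
    have : (r : ℝ) ≤ 4 := by exact_mod_cast (by omega : r ≤ 4)
    nlinarith
  have hp0 := p_pos hn hp
  have hn1 : (1 : ℝ) ≤ n := by exact_mod_cast hn
  have hn0 : (0 : ℝ) < n := by linarith
  have hIc : #I ≤ 2 * r := by simpa using Finset.card_le_univ I
  have hA : 2 ≤ #{i ∈ I | i.val < 2} := by
    have : #({⟨0, by omega⟩, ⟨1, by omega⟩} : Finset (Fin (2 * r))) ≤ #{i ∈ I | i.val < 2} := by
      apply Finset.card_le_card
      intro i hi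
      have hi' : i.val < 2 := by
        simp only [Finset.mem_insert, Finset.mem_singleton] at hi
        rcases hi with rfl | rfl <;> simp
      exact Finset.mem_filter.2 ⟨hI i (Or.inl hi'), hi'⟩
    rwa [Finset.card_pair (by simp)] at this
  have hB : 2 ≤ #{i ∈ I | 2 * r ≤ i.val + 2} := by
    have : #({⟨2 * r - 2, by omega⟩, ⟨2 * r - 1, by omega⟩} : Finset (Fin (2 * r))) ≤
        #{i ∈ I | 2 * r ≤ i.val + 2} := by
      apply Finset.card_le_card
      intro i hi
      have hi' : 2 * r ≤ i.val + 2 := by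
        simp only [Finset.mem_insert, Finset.mem_singleton] at hi
        rcases hi with rfl | rfl <;> simp <;> omega
      exact Finset.mem_filter.2 ⟨hI i (Or.inr hi'), hi'⟩
    rwa [Finset.card_pair (by simp; omega)] at this
  have hnp : (n : ℝ) ^ (2 * γ) ≤ n * p ^ 2 := by
    calc (n : ℝ) ^ (2 * γ) = n * ((n : ℝ) ^ (γ - 1 / 2)) ^ 2 := by
          rw [← Real.rpow_natCast, ← Real.rpow_mul hn0.le]
          nth_rw 2 [← Real.rpow_one (n : ℝ)]
          rw [← Real.rpow_add hn0]
          congr 1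
          push_cast; ring
      _ ≤ _ := by gcongr
  have hnp1 : 1 ≤ n * p ^ 2 := le_trans (Real.one_le_rpow hn1 (by positivity)) hnp
  have hp3 : (n : ℝ) ^ (-(3 / 2) : ℝ) ≤ p ^ 3 := by
    calc (n : ℝ) ^ (-(3 / 2) : ℝ) = ((n : ℝ) ^ (-(1 / 2) : ℝ)) ^ 3 := by
          rw [← Real.rpow_natCast, ← Real.rpow_mul hn0.le]
          norm_num
      _ ≤ ((n : ℝ) ^ (γ - 1 / 2)) ^ 3 := by
          gcongr
          linarith
      _ ≤ _ := by gcongr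
  have fin : ∀ (e X : ℕ) , #I = X + 4 → e ≤ T → ∀ d : ℕ, e + 2 * X + d = 8 * r - 8 →
      1 ≤ (n * p ^ 2) ^ X * p ^ d →
      (n : ℝ) ^ (2 * r + (2 * r - #I)) * p ^ T ≤ (n : ℝ) ^ (4 * r - 4) * p ^ (8 * r - 8) := by
    intro e X hX he d hd h1
    calc (n : ℝ) ^ (2 * r + (2 * r - #I)) * p ^ T ≤ (n : ℝ) ^ (2 * r + (2 * r - #I)) * p ^ e := by
          apply mul_le_mul_of_nonneg_left _ (by positivity)
          exact pow_le_pow_of_le_one hp0.le hp1 he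
      _ ≤ (n : ℝ) ^ (2 * r + (2 * r - #I)) * p ^ e * ((n * p ^ 2) ^ X * p ^ d) :=
          le_mul_of_one_le_right (by positivity) h1
      _ = (n : ℝ) ^ (2 * r + (2 * r - #I) + X) * p ^ (e + 2 * X + d) := by
          rw [pow_add, pow_add, pow_add, pow_mul, mul_pow, ]; ring
      _ = _ := by
          rw [hd]
          congr 2
          omega
  by_cases hcase : ∃ j : ℕ, 2 ≤ j ∧ j + 1 < 2 * r - 2 ∧ ∀ i ∈ I, i.val ≠ j ∧ i.val ≠ j + 1
  · obtain ⟨j, hj1, hj2, hj3⟩ := hcase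
    have hl : 2 ≤ #{i ∈ I | i.val < j} := by
      refine hA.trans (Finset.card_le_card ?_)
      intro i hi
      have := Finset.mem_filter.1 hi
      exact Finset.mem_filter.2 ⟨this.1, by omega⟩
    have hr' : 2 ≤ #{i ∈ I | ¬ i.val < j} := by
      refine hB.trans (Finset.card_le_card ?_)
      intro i hi
      have := Finset.mem_filter.1 hi
      exact Finset.mem_filter.2 ⟨this.1, by omega⟩
    have h1 := eN_split I j hj3 hl hr'
    have h4 := Finset.card_filter_add_card_filter_not (s := I) (fun i => i.val < j)
    refine fin (8 * r - 8 - 2 * (#I - 4)) (#I - 4) (by omega) (by omega) 0 (by omega) ?_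
    rw [pow_zero, mul_one]
    exact one_le_pow₀ hnp1
  · push Not at hcase
    have hh : r ≤ #I := by
      apply half_card
      intro t ht
      rcases Nat.eq_zero_or_pos t with h0 | h0
      · exact ⟨⟨0, by omega⟩, hI _ (Or.inl (by simp)), Or.inl (by simp [h0])⟩
      · rcases Nat.lt_or_ge (2 * t + 1) (2 * r - 2) with h1 | h1
        · obtain ⟨i, hi, hi'⟩ := hcase (2 * t) (by omega) h1
          refine ⟨i, hi, ?_⟩
          by_cases h : i.val = 2 * t
          · left; exact h
          · right; exact hi' h
        · exact ⟨⟨2 * t + 1, by omega⟩, hI _ (Or.inr (by simp; omega)), Or.inr rfl⟩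
    have h1 := (eN_le I).2 (by omega)
    refine fin (8 * r - 11 - 2 * (#I - 4)) (#I - 4) (by omega) (by omega) 3 (by omega) ?_
    have hX : r - 4 ≤ #I - 4 := by omega
    calc (1 : ℝ) = (n : ℝ) ^ (3 / 2 : ℝ) * (n : ℝ) ^ (-(3 / 2) : ℝ) := by
          rw [← Real.rpow_add hn0]; norm_num
      _ ≤ (n * p ^ 2) ^ (#I - 4) * p ^ 3 := by
          apply mul_le_mul _ hp3 (by positivity) (by positivity)
          calc (n : ℝ) ^ (3 / 2 : ℝ) ≤ (n : ℝ) ^ (2 * γ * ((r - 4 : ℕ) : ℝ)) := by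
                apply Real.rpow_le_rpow_of_exponent_le hn1
                rw [Nat.cast_sub (by omega)]
                push_cast
                linarith
            _ = ((n : ℝ) ^ (2 * γ)) ^ (r - 4) := by
                rw [Real.rpow_mul hn0.le, Real.rpow_natCast]
            _ ≤ (n * p ^ 2) ^ (r - 4) := by gcongr
            _ ≤ _ := pow_le_pow_right₀ hnp1 hX

lemma p4_ex {γ : ℝ} (hγ : 0 < γ) {r : ℕ} (hr : 3 / 4 ≤ γ * ((r : ℝ) - 4)) (hn : 1 ≤ n) {p : ℝ}
    (hp : (n : ℝ) ^ (γ - 1 / 2) ≤ p) (hp1 : p ≤ 1) :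
    Ex p (fun ω : Sym2 (Fin n) → Bool => (#(P4set (graphOf ω) (2 * r)) : ℝ)) ≤
      2 ^ (2 * r) * ((n : ℝ) ^ (4 * r - 4) * p ^ (8 * r - 8)) := by
  have hp0 := p_pos hn hp
  have hr5 : 5 ≤ r := by
    by_contra hc
    have : (r : ℝ) ≤ 4 := by exact_mod_cast (by omega : r ≤ 4)
    nlinarith
  set ST : Finset ((Fin (2*r) → Fin n) × (Fin (2*r) → Fin n)) := {x | StrPair x} with hST
  set T : ((Fin (2*r) → Fin n) × (Fin (2*r) → Fin n)) → Finset (Sym2 (Fin n)) :=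
    fun x => Tset x.1 univ ∪ Tset x.2 univ with hT
  set B := (n : ℝ) ^ (4 * r - 4) * p ^ (8 * r - 8) with hB
  have step1 : Ex p (fun ω : Sym2 (Fin n) → Bool => (#(P4set (graphOf ω) (2 * r)) : ℝ)) ≤
      ∑ x ∈ ST, p ^ #(T x) := by
    calc _ ≤ Ex p (fun ω : Sym2 (Fin n) → Bool => ∑ x ∈ ST,
          if (∀ e ∈ T x, ω e = true) then (1 : ℝ) else 0) := by
          apply Ex_mono hp0.le hp1
          intro ω
          have : (#(P4set (graphOf ω) (2 * r)) : ℝ) ≤ (#{x ∈ ST | ∀ e ∈ T x, ω e = true} : ℝ) := by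
            norm_cast
            apply Finset.card_le_card
            intro x hx
            have hx' : StrPair x ∧ SqP (graphOf ω) x.1 ∧ SqP (graphOf ω) x.2 := by
              simpa [P4set] using hx
            refine Finset.mem_filter.2 ⟨by simpa [hST] using hx'.1, ?_⟩
            intro e he
            rcases Finset.mem_union.1 he with he | he
            · obtain ⟨q, hq, rfl⟩ := Finset.mem_image.1 he
              exact ((graphOf_adj _ _ _).1 (hx'.2.1 _ _ (Finset.mem_filter.1 hq).2)).2
            · obtain ⟨q, hq, rfl⟩ := Finset.mem_image.1 he
              exact ((graphOf_adj _ _ _).1 (hx'.2.2 _ _ (Finset.mem_filter.1 hq).2)).2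
          refine this.trans (le_of_eq ?_)
          rw [Finset.sum_boole]
      _ = ∑ x ∈ ST, Pr p (fun ω : Sym2 (Fin n) → Bool => ∀ e ∈ T x, ω e = true) := by
          rw [Ex_sum]
          apply Finset.sum_congr rfl
          intro x _
          unfold Pr
          congr! 2
          simp
      _ = _ := by
          apply Finset.sum_congr rfl
          intro x _
          rw [Pr_all]
  refine step1.trans ?_
  calc ∑ x ∈ ST, p ^ #(T x) = ∑ I ∈ (univ : Finset (Finset (Fin (2 * r)))),
        ∑ x ∈ ST with coin x = I, p ^ #(T x) := by
        rw [Finset.sum_fiberwise]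
    _ ≤ ∑ I ∈ (univ : Finset (Finset (Fin (2 * r)))), B := by
        apply Finset.sum_le_sum
        intro I _
        rcases Finset.eq_empty_or_nonempty {x ∈ ST | coin x = I} with h0 | ⟨x0, hx0⟩
        · rw [h0, Finset.sum_empty, hB]; positivity
        · obtain ⟨hx1, hx2⟩ := Finset.mem_filter.1 hx0
          have hx1' : StrPair x0 := by simpa [hST] using hx1
          have hI : ∀ i : Fin (2 * r), (i.val < 2 ∨ 2 * r ≤ i.val + 2) → i ∈ I := by
            intro i hi
            rw [← hx2]
            simpa [coin] using hx1'.2.2.2 i hi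
          have hbd : ∀ T : ℕ, 2 * (2 * (2 * r - 2) + 1) ≤ T + eN I →
              (n : ℝ) ^ (2 * r + (2 * r - #I)) * p ^ T ≤ B := fun T hT =>
            term_bound hγ hr hn hp hp1 I hI hT
          have hmin : ∀ x ∈ ST, coin x = I → 2 * (2 * (2 * r - 2) + 1) - eN I ≤ #(T x) := by
            intro x hx hxI
            have hx' : StrPair x := by simpa [hST] using hx
            have := union_card' (by omega) hx'
            rw [hxI] at this
            show _ ≤ #(Tset x.1 univ ∪ Tset x.2 univ)
            omega
          calc ∑ x ∈ ST with coin x = I, p ^ #(T x)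
              ≤ ∑ x ∈ ST with coin x = I, p ^ (2 * (2 * (2 * r - 2) + 1) - eN I) := by
                apply Finset.sum_le_sum
                intro x hx
                obtain ⟨h1, h2⟩ := Finset.mem_filter.1 hx
                exact pow_le_pow_of_le_one hp0.le hp1 (hmin x h1 h2)
            _ = #{x ∈ ST | coin x = I} * p ^ (2 * (2 * (2 * r - 2) + 1) - eN I) := by
                rw [Finset.sum_const, nsmul_eq_mul]
            _ ≤ (n : ℝ) ^ (2 * r + (2 * r - #I)) * p ^ (2 * (2 * (2 * r - 2) + 1) - eN I) := by
                gcongr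
                have := coin_count (n := n) I
                have h2 : #{x ∈ ST | coin x = I} ≤ n ^ (2 * r + (2 * r - #I)) := by
                  refine le_trans (Finset.card_le_card ?_) this
                  intro x hx
                  simpa using (Finset.mem_filter.1 hx).2
                exact_mod_cast h2
            _ ≤ B := hbd _ (by omega)
    _ = 2 ^ (2 * r) * B := by
        rw [Finset.sum_const, nsmul_eq_mul]
        simp

lemma p4_event {γ : ℝ} (hγ : 0 < γ) {r : ℕ} (hr : 3 / 4 ≤ γ * ((r : ℝ) - 4)) {ζ : ℝ} (hζ : 0 < ζ) :
    ∃ N : ℕ, ∀ n : ℕ, N ≤ n → ∀ p : ℝ, (n : ℝ) ^ (γ - 1 / 2) ≤ p → p ≤ 1 →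
      Pr p (fun ω : Sym2 (Fin n) → Bool => ¬ (#(P4set (graphOf ω) (2 * r)) : ℝ) ≤
        2 ^ (2 * r) / ζ * ((n : ℝ) ^ (4 * r - 4) * p ^ (8 * r - 8))) ≤ ζ := by
  refine ⟨1, fun n hn p hp hp1 => ?_⟩
  have hp0 := p_pos hn hp
  have hn0 : (0 : ℝ) < n := by exact_mod_cast hn
  have h := p4_ex hγ hr hn hp hp1
  set B := (n : ℝ) ^ (4 * r - 4) * p ^ (8 * r - 8) with hB
  have hB0 : 0 < B := by positivity
  have hm := Pr_markov hp0.le hp1 (fun ω : Sym2 (Fin n) → Bool => (#(P4set (graphOf ω) (2 * r)) : ℝ))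
    (fun ω => by positivity) (a := 2 ^ (2 * r) / ζ * B) (by positivity)
  refine le_trans (Pr_mono hp0.le hp1 ?_) (hm.trans ?_)
  · intro ω h
    exact (not_le.1 h).le
  · rw [div_le_iff₀ (by positivity)]
    refine h.trans (le_of_eq ?_)
    field_simp

end p4
end NS

namespace NS
open Classical Finset

section reg
variable {n : ℕ}

/-- maximal families of disjoint monochromatic `m`-sets -/
lemma exists_blocks {K : ℕ} (c : Fin n → Fin K) {m : ℕ} (hm : 1 ≤ m) :
    ∃ P : Finset (Finset (Fin n)), (∀ A ∈ P, #A = m) ∧ (∀ A ∈ P, ∀ B ∈ P, A ≠ B → Disjoint A B) ∧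
      (∀ A ∈ P, ∀ u ∈ A, ∀ v ∈ A, c u = c v) ∧ n ≤ #P * m + K * m := by
  let S : Finset (Finset (Finset (Fin n))) := {P | (∀ A ∈ P, #A = m) ∧
    (∀ A ∈ P, ∀ B ∈ P, A ≠ B → Disjoint A B) ∧ (∀ A ∈ P, ∀ u ∈ A, ∀ v ∈ A, c u = c v)}
  have hS : S.Nonempty := ⟨∅, by simp [S]⟩
  obtain ⟨P, hP, hmax⟩ := Finset.exists_max_image S Finset.card hS
  have hP' : (∀ A ∈ P, #A = m) ∧ (∀ A ∈ P, ∀ B ∈ P, A ≠ B → Disjoint A B) ∧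
      (∀ A ∈ P, ∀ u ∈ A, ∀ v ∈ A, c u = c v) := by simpa [S] using hP
  obtain ⟨h1, h2, h3⟩ := hP'
  refine ⟨P, h1, h2, h3, ?_⟩
  have hU : #(P.biUnion id) = #P * m := by
    rw [Finset.card_biUnion]
    · exact (Finset.sum_congr rfl (fun A hA => h1 A hA)).trans (by rw [Finset.sum_const, smul_eq_mul])
    · intro A hA B hB hAB
      exact h2 A hA B hB hAB
  have hcol : ∀ i : Fin K, #{u ∈ (P.biUnion id)ᶜ | c u = i} ≤ m := by
    intro i
    by_contra hc
    push Not at hc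
    obtain ⟨A, hA, hAm⟩ := Finset.exists_subset_card_eq hc.le
    have hA' : ∀ u ∈ A, u ∉ P.biUnion id ∧ c u = i := by
      intro u hu
      have := Finset.mem_filter.1 (hA hu)
      exact ⟨Finset.mem_compl.1 this.1, this.2⟩
    have hAP : ∀ B ∈ P, Disjoint A B := by
      intro B hB
      refine Finset.disjoint_left.2 ?_
      intro u hu hub
      exact (hA' u hu).1 (Finset.mem_biUnion.2 ⟨B, hB, hub⟩)
    have hne : A ∉ P := by
      intro h
      have := hAP A h
      rw [disjoint_self] at this
      have h0 : #A = 0 := by rw [this]; rfl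
      omega
    have : insert A P ∈ S := by
      simp only [S, Finset.mem_filter, Finset.mem_univ, true_and]
      refine ⟨?_, ?_, ?_⟩
      · intro B hB
        rcases Finset.mem_insert.1 hB with rfl | hB
        · exact hAm
        · exact h1 B hB
      · intro B hB C hC hBC
        rcases Finset.mem_insert.1 hB with h | hB <;> rcases Finset.mem_insert.1 hC with h' | hC
        · exact absurd (h.trans h'.symm) hBC
        · rw [h]; exact hAP C hC
        · rw [h']; exact (hAP B hB).symm
        · exact h2 B hB C hC hBC
      · intro B hB u hu v hv
        rcases Finset.mem_insert.1 hB with h | hB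
        · rw [h] at hu hv
          rw [(hA' u hu).2, (hA' v hv).2]
        · exact h3 B hB u hu v hv
    have := hmax _ this
    rw [Finset.card_insert_of_notMem hne] at this
    omega
  have hL : #((P.biUnion id)ᶜ) ≤ K * m := by
    rw [Finset.card_eq_sum_card_fiberwise (f := c) (t := univ) (fun _ _ => by simp)]
    calc _ ≤ ∑ i : Fin K, m := Finset.sum_le_sum (fun i _ => hcol i)
      _ = _ := by simp
  have := Finset.card_add_card_compl (P.biUnion id)
  rw [Fintype.card_fin] at this
  omega

/-- the functional -/
noncomputable def Qf (G : SimpleGraph (Fin n)) (p : ℝ) (T : Fin n × Fin n → ℝ) : ℝ :=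
  ∑ q : Fin n × Fin n, (2 * ((if G.Adj q.1 q.2 then 1 else 0) / p) * T q - T q ^ 2)

lemma eG_eq_sum (G : SimpleGraph (Fin n)) (X Y : Finset (Fin n)) :
    (eG G X Y : ℝ) = ∑ q ∈ X ×ˢ Y, (if G.Adj q.1 q.2 then (1:ℝ) else 0) := by
  unfold eG
  rw [Finset.sum_boole]

lemma Qf_le {G : SimpleGraph (Fin n)} {p : ℝ} (hp : 0 < p) {T : Fin n × Fin n → ℝ}
    (h2 : ∀ q, T q ≤ 2) (he : (eG G univ univ : ℝ) ≤ 4 * p * n ^ 2) :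
    Qf G p T ≤ 16 * n ^ 2 := by
  calc Qf G p T ≤ ∑ q : Fin n × Fin n, 4 / p * (if G.Adj q.1 q.2 then 1 else 0) := by
        apply Finset.sum_le_sum
        intro q _
        have := h2 q
        split_ifs
        · have hp' : 0 < 1 / p := by positivity
          have : 4 / p = 4 * (1 / p) := by ring
          rw [this]
          nlinarith [sq_nonneg (T q)]
        · simp; positivity
    _ = 4 / p * eG G univ univ := by
        rw [← Finset.mul_sum, eG_eq_sum, Finset.univ_product_univ]
    _ ≤ 4 / p * (4 * p * n ^ 2) := by gcongr
    _ = 16 * n ^ 2 := by field_simp; ring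

/-- energy increment -/
lemma Qf_step {G : SimpleGraph (Fin n)} {p : ℝ} (hp : 0 < p) {T : Fin n × Fin n → ℝ} {ι : Type*}
    (J : Finset ι) (X Y : ι → Finset (Fin n)) (σ t : ι → ℝ) {a : ℝ}
    (hdis : ∀ i ∈ J, ∀ j ∈ J, i ≠ j → Disjoint (X i ×ˢ Y i) (X j ×ˢ Y j))
    (ht : ∀ i ∈ J, ∀ q ∈ X i ×ˢ Y i, T q = t i)
    (hg : ∀ i ∈ J, a ≤ 2 * σ i * (eG G (X i) (Y i) / p - t i * (#(X i) * #(Y i)))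
      - σ i ^ 2 * (#(X i) * #(Y i))) :
    Qf G p T + #J * a ≤ Qf G p (fun q => T q + ∑ i ∈ J, if q ∈ X i ×ˢ Y i then σ i else 0) := by
  set D : Fin n × Fin n → ℝ := fun q => ∑ i ∈ J, if q ∈ X i ×ˢ Y i then σ i else 0 with hD
  have hD1 : ∀ i ∈ J, ∀ q ∈ X i ×ˢ Y i, D q = σ i := by
    intro i hi q hq
    simp only [hD]
    rw [Finset.sum_eq_single i]
    · rw [if_pos hq]
    · intro j hj hji
      rw [if_neg]
      intro hq'
      exact Finset.disjoint_left.1 (hdis j hj i hi hji) hq' hq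
    · intro h; exact absurd hi h
  have hD0 : ∀ q, q ∉ J.biUnion (fun i => X i ×ˢ Y i) → D q = 0 := by
    intro q hq
    simp only [hD]
    apply Finset.sum_eq_zero
    intro i hi
    rw [if_neg]
    intro h
    exact hq (Finset.mem_biUnion.2 ⟨i, hi, h⟩)
  set g : Fin n × Fin n → ℝ := fun q => (if G.Adj q.1 q.2 then 1 else 0) / p with hgd
  have e1 : Qf G p (fun q => T q + D q) - Qf G p T = ∑ q, (2 * D q * (g q - T q) - D q ^ 2) := by
    unfold Qf
    rw [← Finset.sum_sub_distrib]
    apply Finset.sum_congr rfl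
    intro q _
    simp only [hgd]
    ring
  have e2 : ∑ q, (2 * D q * (g q - T q) - D q ^ 2)
      = ∑ q ∈ J.biUnion (fun i => X i ×ˢ Y i), (2 * D q * (g q - T q) - D q ^ 2) := by
    symm
    apply Finset.sum_subset (Finset.subset_univ _)
    intro q _ hq
    rw [hD0 q hq]
    ring
  have e3 : #J * a ≤ ∑ q ∈ J.biUnion (fun i => X i ×ˢ Y i), (2 * D q * (g q - T q) - D q ^ 2) := by
    rw [Finset.sum_biUnion (fun i hi j hj hij => hdis i hi j hj hij)]
    have : (#J : ℝ) * a = ∑ i ∈ J, a := by rw [Finset.sum_const, nsmul_eq_mul]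
    rw [this]
    apply Finset.sum_le_sum
    intro i hi
    refine (hg i hi).trans (le_of_eq ?_)
    symm
    calc ∑ q ∈ X i ×ˢ Y i, (2 * D q * (g q - T q) - D q ^ 2)
        = ∑ q ∈ X i ×ˢ Y i, (2 * σ i * g q - (2 * σ i * t i + σ i ^ 2)) := by
          apply Finset.sum_congr rfl
          intro q hq
          rw [hD1 i hi q hq, ht i hi q hq]
          ring
      _ = _ := by
          rw [Finset.sum_sub_distrib, ← Finset.mul_sum, Finset.sum_const, nsmul_eq_mul,
            Finset.card_product]
          simp only [hgd]
          rw [← Finset.sum_div, ← eG_eq_sum]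
          push_cast
          ring
  linarith

def IrrP (G : SimpleGraph (Fin n)) (p κ ε : ℝ) (m : ℕ) (A B : Finset (Fin n)) : Prop :=
  ¬ LR G A B (ε * m) (κ * p) ∧ ¬ ((eG G A B : ℝ) ≤ 3 * κ * p * m ^ 2)

lemma irr_witness {G : SimpleGraph (Fin n)} {p κ ε : ℝ} {m : ℕ} (hp : 0 < p) (hκ : 0 < κ)
    (hκ2 : κ ≤ 1 / 2) (hε1 : ε ≤ 1) (hε : 0 < ε)
    {A B : Finset (Fin n)} (hA : #A = m) (hB : #B = m) (h : IrrP G p κ ε m A B) {t : ℝ}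
    (ht0 : 0 ≤ t) (ht2 : t ≤ 2) : ∃ X Y : Finset (Fin n), ∃ σ : ℝ, X ⊆ A ∧ Y ⊆ B ∧
      0 ≤ t + σ ∧ t + σ ≤ 2 ∧ κ ^ 2 * ε ^ 2 * m ^ 2 ≤
        2 * σ * (eG G X Y / p - t * (#X * #Y)) - σ ^ 2 * (#X * #Y) := by
  by_cases htk : 2 * κ ≤ t
  · have h1 := h.1
    unfold LR at h1
    push Not at h1
    obtain ⟨X, Y, hX, hY, hXe, hYe, he⟩ := h1
    refine ⟨X, Y, -κ, hX, hY, by linarith, by linarith, ?_⟩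
    have he' : (eG G X Y : ℝ) / p ≤ κ * (#X * #Y) := by
      rw [div_le_iff₀ hp]; linarith
    have hXY : (ε * m) * (ε * m) ≤ (#X : ℝ) * #Y := by gcongr
    have hXY0 : (0 : ℝ) ≤ (#X : ℝ) * #Y := by positivity
    nlinarith [mul_nonneg hκ.le hXY0, mul_le_mul_of_nonneg_left hXY (sq_nonneg κ),
      mul_le_mul_of_nonneg_left he' hκ.le, mul_le_mul_of_nonneg_right htk (mul_nonneg hκ.le hXY0)]
  · push Not at htk
    have h2 := h.2
    push Not at h2
    refine ⟨A, B, κ, subset_rfl, subset_rfl, by linarith, by linarith, ?_⟩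
    rw [hA, hB]
    have he' : 3 * κ * (m * m) ≤ (eG G A B : ℝ) / p := by
      rw [le_div_iff₀ hp]; nlinarith
    have hXY0 : (0 : ℝ) ≤ (m : ℝ) * m := by positivity
    have hee : ε ^ 2 ≤ 1 := by nlinarith
    nlinarith [mul_le_mul_of_nonneg_left he' hκ.le,
      mul_le_mul_of_nonneg_right htk.le (mul_nonneg hκ.le hXY0),
      mul_le_mul_of_nonneg_right hee (mul_nonneg (sq_nonneg κ) hXY0)]

noncomputable def FK (τ : ℝ) : ℕ → ℕ
  | 0 => 1
  | i + 1 => FK τ i * 4 ^ (⌈2 * FK τ i / τ⌉₊ ^ 2)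

lemma FK_pos (τ : ℝ) (i : ℕ) : 1 ≤ FK τ i := by
  induction i with
  | zero => simp [FK]
  | succ i ih => unfold FK; exact Nat.mul_pos ih (by positivity)

lemma FK_mono (τ : ℝ) : Monotone (FK τ) := by
  apply monotone_nat_of_le_succ
  intro i
  conv_rhs => unfold FK
  exact Nat.le_mul_of_pos_right _ (by positivity)

def RegC (G : SimpleGraph (Fin n)) (p κ' κ ε τ K0 : ℝ) (m : ℕ) (P : Finset (Finset (Fin n))) : Prop :=
  (∀ A ∈ P, #A = m) ∧ (∀ A ∈ P, ∀ B ∈ P, A ≠ B → Disjoint A B) ∧ (n : ℝ) ≤ K0 * m ∧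
  (m : ℝ) ≤ τ * n ∧ (n : ℝ) - #P * m ≤ τ * n ∧
  (#{q ∈ P ×ˢ P | q.1 ≠ q.2 ∧ IrrP G p κ ε m q.1 q.2} : ℝ) ≤ κ' * (#P : ℝ) ^ 2

def RSt (G : SimpleGraph (Fin n)) (p : ℝ) (K : ℕ) (x : ℝ) : Prop :=
  ∃ (c : Fin n → Fin K) (T : Fin n × Fin n → ℝ), (∀ q, 0 ≤ T q ∧ T q ≤ 2) ∧
    (∀ q q', c q.1 = c q'.1 → c q.2 = c q'.2 → T q = T q') ∧ x ≤ Qf G p T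

lemma reg_step {G : SimpleGraph (Fin n)} {p κ' κ ε τ : ℝ} (hp : 0 < p) (hκ : 0 < κ)
    (hκ2 : κ ≤ 1 / 2) (hε1 : ε ≤ 1) (hε : 0 < ε) (hκ' : 0 < κ') (hτ : 0 < τ) (hτ1 : τ ≤ 1 / 2)
    {K : ℕ} {K0 : ℝ} (hK : 1 ≤ K)
    (hK0 : 2 * K / τ ≤ K0) (hn : 2 * K / τ ≤ n) {x : ℝ} (h : RSt G p K x) :
    (∃ m P, RegC G p κ' κ ε τ K0 m P) ∨
    ∃ K' ≤ K * 4 ^ (⌈2 * K / τ⌉₊ ^ 2), 1 ≤ K' ∧ RSt G p K' (x + κ ^ 2 * ε ^ 2 * κ' / 4 * n ^ 2) := by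
  obtain ⟨c, T, hT, hcT, hx⟩ := h
  have hKr : (1 : ℝ) ≤ K := by exact_mod_cast hK
  have hn0 : (0 : ℝ) < n := lt_of_lt_of_le (by positivity) hn
  set m := ⌊τ * n / K⌋₊ with hm
  have hm2 : 2 ≤ τ * n / K := by
    rw [le_div_iff₀ (by positivity)]
    rw [div_le_iff₀ hτ] at hn
    linarith
  have hmle : (m : ℝ) ≤ τ * n / K := Nat.floor_le (by positivity)
  have hmge : τ * n / K < m + 1 := Nat.lt_floor_add_one _
  have hm1 : 1 ≤ m := Nat.le_floor (by push_cast; linarith)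
  have hm1r : (1 : ℝ) ≤ m := by exact_mod_cast hm1
  have hmK : (m : ℝ) * K ≤ τ * n := by rwa [le_div_iff₀ (by positivity)] at hmle
  have hmlow : τ * n / K ≤ 2 * m := by linarith
  have hmlow' : τ * n ≤ 2 * m * K := by rwa [div_le_iff₀ (by positivity)] at hmlow
  obtain ⟨P, h1, h2, h3, h4⟩ := exists_blocks c hm1
  have h4' : (n : ℝ) ≤ #P * m + K * m := by exact_mod_cast h4
  have hPm : #P * m ≤ n := by
    have hU : #(P.biUnion id) = #P * m := by
      rw [Finset.card_biUnion]
      · exact (Finset.sum_congr rfl (fun A hA => h1 A hA)).trans (by rw [Finset.sum_const, smul_eq_mul])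
      · intro A hA B hB hAB
        exact h2 A hA B hB hAB
    rw [← hU]
    simpa using Finset.card_le_univ (P.biUnion id)
  have hPm' : (#P : ℝ) * m ≤ n := by exact_mod_cast hPm
  have hPc : #P ≤ ⌈2 * K / τ⌉₊ := by
    have : (#P : ℝ) ≤ 2 * K / τ := by
      rw [le_div_iff₀ hτ]
      by_contra hc
      push Not at hc
      have : 2 * K * m < τ * n := by
        calc 2 * K * m < #P * τ * m := by gcongr
          _ = τ * (#P * m) := by ring
          _ ≤ τ * n := by gcongr
      nlinarith
    exact_mod_cast this.trans (Nat.le_ceil _)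
  set Irr := {q ∈ P ×ˢ P | q.1 ≠ q.2 ∧ IrrP G p κ ε m q.1 q.2} with hIrr
  by_cases hI : (#Irr : ℝ) ≤ κ' * (#P : ℝ) ^ 2
  · left
    refine ⟨m, P, h1, h2, ?_, ?_, ?_, hI⟩
    · calc (n : ℝ) ≤ 2 * K / τ * m := by
            rw [div_mul_eq_mul_div, le_div_iff₀ hτ]; linarith
        _ ≤ K0 * m := by gcongr
    · nlinarith
    · linarith
  · right
    push Not at hI
    have hw : ∀ q : Finset (Fin n) × Finset (Fin n), ∃ X Y : Finset (Fin n), ∃ σ t : ℝ, q ∈ Irr →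
        (∀ u ∈ X ×ˢ Y, T u = t) ∧ X ⊆ q.1 ∧ Y ⊆ q.2 ∧
        0 ≤ t + σ ∧ t + σ ≤ 2 ∧ κ ^ 2 * ε ^ 2 * m ^ 2 ≤
        2 * σ * (eG G X Y / p - t * (#X * #Y)) - σ ^ 2 * (#X * #Y) := by
      intro q
      by_cases hq : q ∈ Irr
      · obtain ⟨hq1, hq2, hq3⟩ := Finset.mem_filter.1 hq
        obtain ⟨hqA, hqB⟩ := Finset.mem_product.1 hq1
        have hAne : q.1.Nonempty := Finset.card_pos.1 (by rw [h1 _ hqA]; omega)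
        have hBne : q.2.Nonempty := Finset.card_pos.1 (by rw [h1 _ hqB]; omega)
        obtain ⟨a, ha⟩ := hAne
        obtain ⟨b, hb⟩ := hBne
        obtain ⟨X, Y, σ, hX, hY, e1, e2, e3⟩ := irr_witness hp hκ hκ2 hε1 hε (h1 _ hqA) (h1 _ hqB) hq3
          (hT (a, b)).1 (hT (a, b)).2
        refine ⟨X, Y, σ, T (a, b), fun _ => ⟨?_, hX, hY, e1, e2, e3⟩⟩
        intro u hu
        obtain ⟨hu1, hu2⟩ := Finset.mem_product.1 hu
        exact hcT _ _ (h3 _ hqA _ (hX hu1) _ ha) (h3 _ hqB _ (hY hu2) _ hb)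
      · exact ⟨∅, ∅, 0, 0, fun h => absurd h hq⟩
    choose X Y σ t hw using hw
    set T' : Fin n × Fin n → ℝ := fun q => T q + ∑ i ∈ Irr, if q ∈ X i ×ˢ Y i then σ i else 0 with hT'
    have hdis : ∀ i ∈ Irr, ∀ j ∈ Irr, i ≠ j → Disjoint (X i ×ˢ Y i) (X j ×ˢ Y j) := by
      intro i hi j hj hij
      refine Finset.disjoint_left.2 ?_
      intro q hq hq'
      obtain ⟨hq1, hq2⟩ := Finset.mem_product.1 hq
      obtain ⟨hq1', hq2'⟩ := Finset.mem_product.1 hq'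
      have hi' := Finset.mem_product.1 (Finset.mem_filter.1 hi).1
      have hj' := Finset.mem_product.1 (Finset.mem_filter.1 hj).1
      apply hij
      apply Prod.ext
      · by_contra hne
        exact Finset.disjoint_left.1 (h2 _ hi'.1 _ hj'.1 hne) ((hw i hi).2.1 hq1) ((hw j hj).2.1 hq1')
      · by_contra hne
        exact Finset.disjoint_left.1 (h2 _ hi'.2 _ hj'.2 hne) ((hw i hi).2.2.1 hq2) ((hw j hj).2.2.1 hq2')
    have hstep := Qf_step (T := T) hp Irr X Y σ t hdis (fun i hi => (hw i hi).1)
      (fun i hi => (hw i hi).2.2.2.2.2)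
    have hgain : κ ^ 2 * ε ^ 2 * κ' / 4 * n ^ 2 ≤ #Irr * (κ ^ 2 * ε ^ 2 * m ^ 2) := by
      have hh : (n : ℝ) / 2 ≤ #P * m := by nlinarith
      have hh2 : (n : ℝ) ^ 2 / 4 ≤ (#P * m) ^ 2 := by
        calc (n : ℝ) ^ 2 / 4 = (n / 2) ^ 2 := by ring
          _ ≤ _ := by gcongr
      calc κ ^ 2 * ε ^ 2 * κ' / 4 * n ^ 2 = κ ^ 2 * ε ^ 2 * κ' * (n ^ 2 / 4) := by ring
        _ ≤ κ ^ 2 * ε ^ 2 * κ' * (#P * m) ^ 2 := by gcongr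
        _ = (κ' * #P ^ 2) * (κ ^ 2 * ε ^ 2 * m ^ 2) := by ring
        _ ≤ _ := by gcongr
    let α := Fin K × Finset (Irr : Finset _) × Finset (Irr : Finset _)
    let c' : Fin n → α := fun u => (c u, univ.filter (fun i => u ∈ X i.1), univ.filter (fun i => u ∈ Y i.1))
    have hcard : Fintype.card α = K * (2 ^ #Irr * 2 ^ #Irr) := by
      simp [α, Fintype.card_prod, Fintype.card_finset]
    have hIc : #Irr ≤ ⌈2 * K / τ⌉₊ ^ 2 := by
      calc #Irr ≤ #(P ×ˢ P) := Finset.card_filter_le _ _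
        _ = #P * #P := Finset.card_product _ _
        _ ≤ _ := by rw [pow_two]; gcongr
    refine ⟨Fintype.card α, ?_, ?_, fun u => Fintype.equivFin α (c' u), T', ?_, ?_, ?_⟩
    · rw [hcard, ← mul_pow]
      gcongr <;> norm_num
    · rw [hcard]; exact Nat.mul_pos hK (by positivity)
    · intro q
      by_cases hq : ∃ i ∈ Irr, q ∈ X i ×ˢ Y i
      · obtain ⟨i, hi, hqi⟩ := hq
        have : T' q = t i + σ i := by
          simp only [hT']
          rw [(hw i hi).1 q hqi, Finset.sum_eq_single i]
          · rw [if_pos hqi]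
          · intro j hj hji
            rw [if_neg]
            intro hq'
            exact Finset.disjoint_left.1 (hdis j hj i hi hji) hq' hqi
          · intro h; exact absurd hi h
        rw [this]
        exact ⟨(hw i hi).2.2.2.1, (hw i hi).2.2.2.2.1⟩
      · have : T' q = T q := by
          simp only [hT']
          rw [Finset.sum_eq_zero, add_zero]
          intro i hi
          rw [if_neg]
          intro h
          exact hq ⟨i, hi, h⟩
        rw [this]
        exact hT q
    · intro q q' e1 e2
      have e1' := (Fintype.equivFin α).injective e1
      have e2' := (Fintype.equivFin α).injective e2
      have e1' := (⟨congrArg Prod.fst e1', congrArg (fun z => z.2.1) e1'⟩ :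
        c q.1 = c q'.1 ∧ univ.filter (fun i : Irr => q.1 ∈ X i.1) = univ.filter (fun i : Irr => q'.1 ∈ X i.1))
      have e2' := (⟨congrArg Prod.fst e2', congrArg (fun z => z.2.2) e2'⟩ :
        c q.2 = c q'.2 ∧ univ.filter (fun i : Irr => q.2 ∈ Y i.1) = univ.filter (fun i : Irr => q'.2 ∈ Y i.1))
      simp only [hT']
      congr 1
      · exact hcT _ _ e1'.1 e2'.1
      · apply Finset.sum_congr rfl
        intro i hi
        have hx1 : q.1 ∈ X i ↔ q'.1 ∈ X i := by
          have := Finset.ext_iff.1 e1'.2 ⟨i, hi⟩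
          simpa using this
        have hy1 : q.2 ∈ Y i ↔ q'.2 ∈ Y i := by
          have := Finset.ext_iff.1 e2'.2 ⟨i, hi⟩
          simpa using this
        have : q ∈ X i ×ˢ Y i ↔ q' ∈ X i ×ˢ Y i := by
          rw [Finset.mem_product, Finset.mem_product, hx1, hy1]
        simp only [this]
    · linarith

theorem sparse_reg {κ' κ ε τ : ℝ} (hκ : 0 < κ)
    (hκ2 : κ ≤ 1 / 2) (hε1 : ε ≤ 1) (hε : 0 < ε) (hκ' : 0 < κ') (hτ : 0 < τ) (hτ1 : τ ≤ 1 / 2) :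
    ∃ K0 : ℝ, 1 ≤ K0 ∧ ∃ N : ℕ, ∀ n : ℕ, N ≤ n → ∀ (G : SimpleGraph (Fin n)) (p : ℝ), 0 < p →
      (eG G univ univ : ℝ) ≤ 4 * p * n ^ 2 → ∃ m P, RegC G p κ' κ ε τ K0 m P := by
  set α := κ ^ 2 * ε ^ 2 * κ' / 4 with hα
  have hα0 : 0 < α := by positivity
  set I := ⌊16 / α⌋₊ + 1 with hI
  have hFK : (1 : ℝ) ≤ FK τ I := by exact_mod_cast FK_pos τ I
  refine ⟨2 * FK τ I / τ, ?_, ⌈2 * FK τ I / τ⌉₊ + 1, fun n hn G p hp he => ?_⟩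
  · rw [le_div_iff₀ hτ]; linarith
  have hn' : 2 * FK τ I / τ ≤ (n : ℝ) := (Nat.le_ceil _).trans (Nat.cast_le.2 (by omega))
  have hn0 : (0 : ℝ) < n := lt_of_lt_of_le (by positivity) hn'
  have key : ∀ i ≤ I, (∃ m P, RegC G p κ' κ ε τ (2 * FK τ I / τ) m P) ∨
      ∃ K ≤ FK τ i, 1 ≤ K ∧ RSt G p K (i * (α * n ^ 2)) := by
    intro i
    induction i with
    | zero =>
      intro _
      right
      refine ⟨1, by simp [FK], le_refl _, fun _ => 0, fun _ => 0, ?_, ?_, ?_⟩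
      · intro q; norm_num
      · intros; rfl
      · simp [Qf]
    | succ i ih =>
      intro hi
      rcases ih (by omega) with h | ⟨K, hK, hK1, hSt⟩
      · left; exact h
      · have hKI : (K : ℝ) ≤ FK τ I := by exact_mod_cast hK.trans (FK_mono τ (by omega))
        have hle : 2 * (K : ℝ) / τ ≤ 2 * FK τ I / τ := by gcongr
        rcases reg_step (κ' := κ') hp hκ hκ2 hε1 hε hκ' hτ hτ1 hK1 hle (hle.trans hn') hSt with h | ⟨K', hK', hK1', hSt'⟩
        · left; exact h
        · right
          refine ⟨K', hK'.trans ?_, hK1', ?_⟩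
          · unfold FK
            gcongr <;> norm_num
          · convert hSt' using 1
            push_cast; ring
  rcases key I le_rfl with h | ⟨K, -, -, c, T, hT, -, hx⟩
  · exact h
  · exfalso
    have h1 := Qf_le hp (fun q => (hT q).2) he
    have h2 : 16 / α < I := by
      rw [hI]; push_cast; exact Nat.lt_floor_add_one _
    rw [div_lt_iff₀ hα0] at h2
    have : 16 * (n : ℝ) ^ 2 < I * (α * n ^ 2) := by
      rw [← mul_assoc]; gcongr
    linarith

end reg
end NS

namespace NS
open Classical Finset

section route
variable {ι : Type*} [Fintype ι]

def Tri (R : SimpleGraph ι) (a b c : ι) : Prop := R.Adj a b ∧ R.Adj b c ∧ R.Adj a c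

noncomputable def nb (R : SimpleGraph ι) (a : ι) : Finset ι := {b | R.Adj a b}

def BigDeg (R : SimpleGraph ι) : Prop := ∀ a, 2 * Fintype.card ι < 3 * #(nb R a)

lemma inter_card (A B : Finset ι) : #A + #B ≤ #(A ∩ B) + Fintype.card ι := by
  have := Finset.card_union_add_card_inter A B
  have h2 := Finset.card_le_univ (A ∪ B)
  omega

lemma common3 {R : SimpleGraph ι} (h : BigDeg R) (a b c : ι) :
    ∃ z, R.Adj a z ∧ R.Adj b z ∧ R.Adj c z := by
  have h1 := inter_card (nb R a) (nb R b)
  have h2 := inter_card (nb R a ∩ nb R b) (nb R c)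
  have ha := h a
  have hb := h b
  have hc := h c
  have : 0 < #(nb R a ∩ nb R b ∩ nb R c) := by omega
  obtain ⟨z, hz⟩ := Finset.card_pos.1 this
  simp only [Finset.mem_inter, nb, Finset.mem_filter, Finset.mem_univ, true_and] at hz
  exact ⟨z, hz.1.1, hz.1.2, hz.2⟩

lemma quantile [Nonempty ι] {R : SimpleGraph ι} (h : BigDeg R) (x : ι → ℝ) :
    ∃ a b c, Tri R a b c ∧ Fintype.card ι * (x a + x b + x c) ≤ 3 * ∑ i, x i := by
  obtain ⟨a, -, ha⟩ := Finset.exists_min_image univ x Finset.univ_nonempty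
  have hda := h a
  have hNa : (nb R a).Nonempty := Finset.card_pos.1 (by omega)
  obtain ⟨b, hb, hbm⟩ := Finset.exists_min_image (nb R a) x hNa
  have hdb := h b
  have h1 := inter_card (nb R a) (nb R b)
  have hNab : (nb R a ∩ nb R b).Nonempty := Finset.card_pos.1 (by omega)
  obtain ⟨c, hc, hcm⟩ := Finset.exists_min_image (nb R a ∩ nb R b) x hNab
  have hb' : R.Adj a b := by simpa [nb] using hb
  obtain ⟨hc1, hc2⟩ := Finset.mem_inter.1 hc
  have hc1' : R.Adj a c := by simpa [nb] using hc1
  have hc2' : R.Adj b c := by simpa [nb] using hc2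
  refine ⟨a, b, c, ⟨hb', hc2', hc1'⟩, ?_⟩
  have hab : x a ≤ x b := ha b (Finset.mem_univ _)
  have hbc : x b ≤ x c := hbm c hc1
  have key : ∑ i, (x a + (if i ∈ nb R a then x b - x a else 0) +
      (if i ∈ nb R a ∩ nb R b then x c - x b else 0)) ≤ ∑ i, x i := by
    apply Finset.sum_le_sum
    intro i _
    by_cases h1 : i ∈ nb R a
    · by_cases h2 : i ∈ nb R b
      · have h3 : i ∈ nb R a ∩ nb R b := Finset.mem_inter.2 ⟨h1, h2⟩
        rw [if_pos h1, if_pos h3]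
        have := hcm i h3
        linarith
      · have h3 : i ∉ nb R a ∩ nb R b := fun h => h2 (Finset.mem_inter.1 h).2
        rw [if_pos h1, if_neg h3]
        have := hbm i h1
        linarith
    · have h3 : i ∉ nb R a ∩ nb R b := fun h => h1 (Finset.mem_inter.1 h).1
      rw [if_neg h1, if_neg h3]
      have := ha i (Finset.mem_univ _)
      linarith
  rw [Finset.sum_add_distrib, Finset.sum_add_distrib, Finset.sum_const, ← Finset.sum_filter,
    ← Finset.sum_filter, Finset.sum_const, Finset.sum_const] at key
  simp only [Finset.filter_mem_eq_inter, Finset.univ_inter, nsmul_eq_mul, Finset.card_univ] at key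
  have e1 : (2 * Fintype.card ι : ℝ) ≤ 3 * #(nb R a) := by exact_mod_cast hda.le
  have e2 : (Fintype.card ι : ℝ) ≤ 3 * #(nb R a ∩ nb R b) := by
    exact_mod_cast (by omega : Fintype.card ι ≤ 3 * #(nb R a ∩ nb R b))
  nlinarith [mul_le_mul_of_nonneg_right e1 (sub_nonneg.2 hab),
    mul_le_mul_of_nonneg_right e2 (sub_nonneg.2 hbc)]

/-- number of occurrences in a triple -/
noncomputable def occ (t : ι × ι × ι) (i : ι) : ℕ :=
  (if t.1 = i then 1 else 0) + (if t.2.1 = i then 1 else 0) + (if t.2.2 = i then 1 else 0)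

lemma sum_occ (t : ι × ι × ι) : ∑ i, occ t i = 3 := by
  simp [occ, Finset.sum_add_distrib]

lemma sum_occ_mul (t : ι × ι × ι) (x : ι → ℝ) :
    ∑ i, (occ t i : ℝ) * x i = x t.1 + x t.2.1 + x t.2.2 := by
  simp [occ, Finset.sum_add_distrib, add_mul]

lemma greedy [Nonempty ι] {R : SimpleGraph ι} (h : BigDeg R) (N : ℕ) :
    ∃ cn : ι × ι × ι → ℕ, (∀ t, cn t ≠ 0 → Tri R t.1 t.2.1 t.2.2) ∧
      ∑ i, ∑ t, cn t * occ t i = 3 * N ∧ ∑ t, cn t = N ∧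
      Fintype.card ι * ∑ i, ((∑ t, cn t * occ t i : ℕ) : ℝ) ^ 2
        ≤ 9 * (N : ℝ) ^ 2 + 3 * Fintype.card ι * N := by
  have hk : (1 : ℝ) ≤ Fintype.card ι := by exact_mod_cast Fintype.card_pos
  induction N with
  | zero => exact ⟨fun _ => 0, by simp, by simp, by simp, by simp⟩
  | succ N ih =>
    obtain ⟨cn, h1, h2, h2', h3⟩ := ih
    set x : ι → ℕ := fun i => ∑ t, cn t * occ t i with hx
    obtain ⟨a, b, c, ht, hq⟩ := quantile h (fun i => (x i : ℝ))
    have hx' : ∀ i, ∑ t, (cn t + if t = (a, b, c) then 1 else 0) * occ t i = x i + occ (a, b, c) i := by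
      intro i
      simp only [add_mul, Finset.sum_add_distrib, hx]
      simp
    refine ⟨fun t => cn t + if t = (a, b, c) then 1 else 0, ?_, ?_, ?_, ?_⟩
    · intro t ht'
      by_cases h5 : t = (a, b, c)
      · rw [h5]; exact ht
      · apply h1
        simpa [h5] using ht'
    · simp only [hx']
      rw [Finset.sum_add_distrib, h2, sum_occ]
      ring
    · rw [Finset.sum_add_distrib, h2']
      simp
    · simp only [hx']
      have hocc : ∑ i, ((occ (a, b, c) i : ℝ)) ^ 2 ≤ 3 := by
        have hab := ht.1.ne
        have hbc := ht.2.1.ne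
        have hac := ht.2.2.ne
        have : ∀ i, ((occ (a, b, c) i : ℝ)) ^ 2 ≤ (occ (a, b, c) i : ℝ) := by
          intro i
          have : occ (a, b, c) i ≤ 1 := by
            unfold occ
            by_cases e1 : a = i <;> by_cases e2 : b = i <;> by_cases e3 : c = i <;>
              simp_all
          have h01 : (occ (a, b, c) i : ℝ) ≤ 1 := by exact_mod_cast this
          nlinarith [(Nat.cast_nonneg (occ (a, b, c) i) : (0:ℝ) ≤ _)]
        calc _ ≤ ∑ i, (occ (a, b, c) i : ℝ) := Finset.sum_le_sum (fun i _ => this i)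
          _ = 3 := by exact_mod_cast sum_occ (a, b, c)
      have hcross := sum_occ_mul (a, b, c) (fun i => (x i : ℝ))
      have hS : ∑ i, (x i : ℝ) = 3 * N := by exact_mod_cast h2
      simp only at hcross hq
      rw [hS] at hq
      have e : ∑ i, ((x i + occ (a, b, c) i : ℕ) : ℝ) ^ 2
          = ∑ i, (x i : ℝ) ^ 2 + 2 * ∑ i, (occ (a, b, c) i : ℝ) * x i +
            ∑ i, (occ (a, b, c) i : ℝ) ^ 2 := by
        rw [Finset.mul_sum, ← Finset.sum_add_distrib, ← Finset.sum_add_distrib]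
        apply Finset.sum_congr rfl
        intro i _
        push_cast; ring
      rw [e, hcross]
      push_cast
      nlinarith [mul_le_mul_of_nonneg_left hocc (by linarith : (0:ℝ) ≤ Fintype.card ι)]

lemma greedy_bound [Nonempty ι] (x : ι → ℕ) {N : ℕ} (hs : ∑ i, x i = 3 * N)
    (hq : Fintype.card ι * ∑ i, ((x i : ℕ) : ℝ) ^ 2 ≤ 9 * (N : ℝ) ^ 2 + 3 * Fintype.card ι * N) (i : ι) :
    (x i : ℝ) ≤ 3 * N / Fintype.card ι + Real.sqrt (3 * N) := by
  have hk : (1 : ℝ) ≤ Fintype.card ι := by exact_mod_cast Fintype.card_pos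
  set k : ℝ := ((Fintype.card ι : ℕ) : ℝ) with hkk
  have hS : ∑ i, (x i : ℝ) = 3 * N := by exact_mod_cast hs
  have h1 : ∑ i, ((x i : ℝ) - 3 * (N:ℝ) / k) ^ 2 ≤ (3 * N : ℝ) := by
    have e : ∑ i, ((x i : ℝ) - 3 * N / k) ^ 2 = ∑ i, (x i : ℝ) ^ 2 - 2 * (3 * N / k) * ∑ i, (x i : ℝ)
        + k * (3 * N / k) ^ 2 := by
      rw [Finset.mul_sum, ← Finset.sum_sub_distrib]
      have : k * (3 * N / k) ^ 2 = ∑ i : ι, (3 * N / k) ^ 2 := by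
        rw [Finset.sum_const, nsmul_eq_mul, Finset.card_univ]
      rw [this, ← Finset.sum_add_distrib]
      apply Finset.sum_congr rfl
      intro i _
      ring
    rw [e, hS]
    have : k * (∑ i, (x i : ℝ) ^ 2 - 2 * (3 * N / k) * (3 * N) + k * (3 * N / k) ^ 2) ≤ k * (3 * N) := by
      have : k * (∑ i, (x i : ℝ) ^ 2 - 2 * (3 * N / k) * (3 * N) + k * (3 * N / k) ^ 2)
        = k * ∑ i, (x i : ℝ) ^ 2 - 9 * N ^ 2 := by field_simp; ring
      rw [this]; linarith
    exact le_of_mul_le_mul_left this (by linarith)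
  have h2 : ((x i : ℝ) - 3 * N / k) ^ 2 ≤ 3 * N :=
    (Finset.single_le_sum (f := fun i => ((x i : ℝ) - 3 * N / k) ^ 2)
      (fun i _ => sq_nonneg _) (Finset.mem_univ i)).trans h1
  have := Real.le_sqrt_of_sq_le h2
  linarith

/-- square walks -/
inductive Wk (R : SimpleGraph ι) : ι × ι → ι × ι → List ι → Prop
  | nil (e : ι × ι) : Wk R e e []
  | cons {a b c : ι} {e : ι × ι} {l : List ι} : Tri R a b c → Wk R (b, c) e l → Wk R (a, b) e (c :: l)

lemma Wk.append {R : SimpleGraph ι} {e f g : ι × ι} {l l' : List ι} (h : Wk R e f l)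
    (h' : Wk R f g l') : Wk R e g (l ++ l') := by
  induction h with
  | nil => exact h'
  | cons t _ ih => exact Wk.cons t (ih h')

lemma wk3 {R : SimpleGraph ι} (h : BigDeg R) {a b c : ι} (hab : R.Adj a b) (hbc : R.Adj b c) :
    ∃ l, Wk R (a, b) (c, b) l ∧ l.length = 3 := by
  obtain ⟨z, h1, h2, h3⟩ := common3 h a b c
  refine ⟨[z, c, b], ?_, rfl⟩
  exact .cons ⟨hab, h2, h1⟩ (.cons ⟨h2, h3.symm, hbc⟩ (.cons ⟨h3.symm, hbc.symm, h2.symm⟩ (.nil _)))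

lemma wk4 {R : SimpleGraph ι} (h : BigDeg R) {a b : ι} (hab : R.Adj a b) :
    ∃ l, Wk R (a, b) (b, a) l ∧ l.length = 4 := by
  obtain ⟨z, h1, h2, -⟩ := common3 h a b b
  obtain ⟨w, g1, g2, g3⟩ := common3 h a b z
  refine ⟨[z, w, b, a], ?_, rfl⟩
  exact .cons ⟨hab, h2, h1⟩ (.cons ⟨h2, g3, g2⟩ (.cons ⟨g3, g2.symm, h2.symm⟩
    (.cons ⟨g2.symm, hab.symm, g1.symm⟩ (.nil _))))

lemma wk21 {R : SimpleGraph ι} (h : BigDeg R) {a b c d : ι} (hab : R.Adj a b) (hcd : R.Adj c d) :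
    ∃ l, Wk R (a, b) (c, d) l ∧ l.length = 21 := by
  obtain ⟨u, h1, h2, -⟩ := common3 h b c c
  obtain ⟨l1, w1, e1⟩ := wk3 h hab h1
  obtain ⟨l2, w2, e2⟩ := wk4 h h1.symm
  obtain ⟨l3, w3, e3⟩ := wk3 h h1 h2.symm
  obtain ⟨l4, w4, e4⟩ := wk4 h h2
  obtain ⟨l5, w5, e5⟩ := wk3 h h2.symm hcd
  obtain ⟨l6, w6, e6⟩ := wk4 h hcd.symm
  refine ⟨_, w1.append (w2.append (w3.append (w4.append (w5.append w6)))), ?_⟩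
  simp only [List.length_append]
  omega

lemma wk_iter {R : SimpleGraph ι} {e : ι × ι} {l : List ι} (h : Wk R e e l) (j : ℕ) :
    ∃ l', Wk R e e l' ∧ l'.length = j * l.length ∧ ∀ i, l'.count i = j * l.count i := by
  induction j with
  | zero => exact ⟨[], .nil _, by simp, by simp⟩
  | succ j ih =>
    obtain ⟨l', w, e1, e2⟩ := ih
    refine ⟨l ++ l', h.append w, ?_, ?_⟩
    · rw [List.length_append, e1]; ring
    · intro i; rw [List.count_append, e2]; ring

lemma wk_tri {R : SimpleGraph ι} {a b c : ι} (h : Tri R a b c) :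
    Wk R (a, b) (a, b) [c, a, b] :=
  .cons h (.cons ⟨h.2.1, h.2.2.symm, h.1.symm⟩ (.cons ⟨h.2.2.symm, h.1, h.2.1.symm⟩ (.nil _)))

lemma wk_loops {R : SimpleGraph ι} (h : BigDeg R) (cn : ι × ι × ι → ℕ)
    (hcn : ∀ t, cn t ≠ 0 → Tri R t.1 t.2.1 t.2.2) (ts : List (ι × ι × ι)) {a b : ι}
    (hab : R.Adj a b) : ∃ l c d, R.Adj c d ∧ Wk R (a, b) (c, d) l ∧
      3 * (ts.map cn).sum ≤ l.length ∧
      ∀ i, l.count i ≤ (ts.map (fun t => cn t * occ t i)).sum + 21 * ts.length := by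
  induction ts generalizing a b with
  | nil => exact ⟨[], a, b, hab, .nil _, by simp, by simp⟩
  | cons t ts ih =>
    by_cases ht : cn t = 0
    · obtain ⟨l, c, d, h1, h2, h3, h4⟩ := ih hab
      refine ⟨l, c, d, h1, h2, by simpa [ht] using h3, fun i => ?_⟩
      have := h4 i
      simp only [List.map_cons, List.sum_cons, List.length_cons, ht]
      omega
    · have hT := hcn t ht
      obtain ⟨l1, w1, e1⟩ := wk21 h hab hT.1
      obtain ⟨l2, w2, e2, e2'⟩ := wk_iter (wk_tri hT) (cn t)
      obtain ⟨l, c, d, h1, h2, h3, h4⟩ := ih hT.1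
      refine ⟨l1 ++ (l2 ++ l), c, d, h1, w1.append (w2.append h2), ?_, fun i => ?_⟩
      · simp only [List.length_append, List.map_cons, List.sum_cons, e2]
        simp only [List.length_cons, List.length_nil]
        omega
      · have h5 := h4 i
        have h6 : l1.count i ≤ 21 := e1 ▸ List.count_le_length
        have h7 : [t.2.2, t.1, t.2.1].count i = occ t i := by
          simp only [List.count_cons, List.count_nil, occ, beq_iff_eq]
          omega
        simp only [List.count_append, List.map_cons, List.sum_cons, List.length_cons, e2', h7]
        omega

def CR (k L : ℕ) : ℕ := 21 * k ^ 3 + 21 + (9 * L + 8 * (L - 1) * L)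

lemma CR_mono (L : ℕ) {k k' : ℕ} (h : k ≤ k') : CR k L ≤ CR k' L := by
  unfold CR
  gcongr

theorem route [Nonempty ι] {R : SimpleGraph ι} (h : BigDeg R) {L : ℕ} (hL : 1 ≤ L) (N : ℕ) :
    ∃ a b l, R.Adj a b ∧ Wk R (a, b) (a, b) l ∧ 3 * N ≤ l.length ∧ L ∣ l.length + 2 ∧
      ∀ i, (l.count i : ℝ) ≤ 3 * N / Fintype.card ι + Real.sqrt (3 * N) + CR (Fintype.card ι) L := by
  obtain ⟨cn, h1, h2, h2', h3⟩ := greedy h N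
  obtain ⟨a, b, c0, ht0, -⟩ := quantile h (fun _ => 0)
  obtain ⟨l1, c, d, hcd, w1, e1, e1'⟩ := wk_loops h cn h1 univ.toList ht0.1
  obtain ⟨l2, w2, e2⟩ := wk21 h hcd ht0.1
  obtain ⟨l0, w0, e0, -⟩ := wk_iter (wk_tri ht0) 3
  have e0 : l0.length = 9 := by simpa using e0
  obtain ⟨l41, w41, e41⟩ := wk4 h ht0.1
  obtain ⟨l42, w42, e42⟩ := wk4 h ht0.1.symm
  -- padding
  set len := (l1 ++ l2).length + 2 with hlen
  set dd := (L - len % L) % L with hdd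
  have hddL : dd < L := Nat.mod_lt _ hL
  obtain ⟨p1, v1, f1, -⟩ := wk_iter w0 dd
  obtain ⟨p2, v2, f2, -⟩ := wk_iter (w41.append w42) ((L - 1) * dd)
  have f1' : p1.length = dd * 9 := by rw [f1, e0]
  have f2' : p2.length = (L - 1) * dd * 8 := by rw [f2, List.length_append, e41, e42]
  refine ⟨a, b, (l1 ++ l2) ++ (p1 ++ p2), ht0.1, (w1.append w2).append (v1.append v2), ?_, ?_, ?_⟩
  · have : 3 * N ≤ l1.length := by
      refine le_trans (le_of_eq ?_) e1
      rw [Finset.sum_map_toList, h2']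
    simp only [List.length_append]
    omega
  · have e : ((l1 ++ l2) ++ (p1 ++ p2)).length + 2 = (len + dd) + L * (8 * dd) := by
      rw [List.length_append (as := l1 ++ l2), List.length_append (as := p1), f1', f2']
      obtain ⟨L', rfl⟩ : ∃ L', L = L' + 1 := ⟨L - 1, by omega⟩
      simp only [Nat.add_sub_cancel]
      have : len = (l1 ++ l2).length + 2 := hlen
      generalize (l1 ++ l2).length = q at *
      rw [this]
      ring
    rw [e]
    apply Dvd.dvd.add _ (Dvd.intro _ rfl)
    have h5 := Nat.mod_lt len (by omega : L > 0)
    rcases Nat.eq_zero_or_pos (len % L) with h6 | h6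
    · have : dd = 0 := by rw [hdd, h6]; simp
      rw [this, add_zero]
      exact Nat.dvd_of_mod_eq_zero h6
    · have : dd = L - len % L := by rw [hdd]; exact Nat.mod_eq_of_lt (by omega)
      rw [this]
      have h7 := Nat.div_add_mod len L
      exact ⟨len / L + 1, by rw [mul_add]; omega⟩
  · intro i
    have hb := greedy_bound (fun i => ∑ t, cn t * occ t i) h2 h3 i
    have h4 := e1' i
    rw [Finset.sum_map_toList, Finset.length_toList, Finset.card_univ] at h4
    have h5 : l2.count i ≤ 21 := e2 ▸ List.count_le_length
    have h6 : p1.count i ≤ dd * 9 := f1' ▸ List.count_le_length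
    have h7 : p2.count i ≤ (L - 1) * dd * 8 := f2' ▸ List.count_le_length
    have hc : Fintype.card (ι × ι × ι) = Fintype.card ι ^ 3 := by
      simp only [Fintype.card_prod]; ring
    rw [hc] at h4
    have h8 : (L - 1) * dd * 8 ≤ 8 * (L - 1) * L := by
      calc (L - 1) * dd * 8 ≤ (L - 1) * L * 8 := by gcongr
        _ = _ := by ring
    have : ((l1 ++ l2) ++ (p1 ++ p2)).count i ≤ ∑ t, cn t * occ t i + CR (Fintype.card ι) L := by
      simp only [List.count_append, CR]
      omega
    have : ((((l1 ++ l2) ++ (p1 ++ p2)).count i : ℕ) : ℝ) ≤ ((∑ t, cn t * occ t i : ℕ) : ℝ)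
        + CR (Fintype.card ι) L := by exact_mod_cast this
    linarith

end route
end NS

namespace NS
open Classical Finset

section reduced
variable {n : ℕ}

lemma eG_union_le (G : SimpleGraph (Fin n)) (A B C : Finset (Fin n)) :
    eG G A (B ∪ C) ≤ eG G A B + eG G A C := by
  unfold eG
  rw [Finset.product_union, Finset.filter_union]
  exact Finset.card_union_le _ _

lemma eG_biUnion_le (G : SimpleGraph (Fin n)) (A : Finset (Fin n)) (s : Finset (Finset (Fin n))) :
    eG G A (s.biUnion id) ≤ ∑ B ∈ s, eG G A B := by
  induction s using Finset.induction_on with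
  | empty => simp [eG]
  | insert B s hB ih =>
    rw [Finset.biUnion_insert, Finset.sum_insert hB]
    exact (eG_union_le G A _ _).trans (by simpa using ih)

set_option maxHeartbeats 800000 in
lemma reduced {Γ G : SimpleGraph (Fin n)} {p γ κ ε K0 : ℝ} {m U : ℕ} {P : Finset (Finset (Fin n))}
    (hn : 1 ≤ n) (hp : 0 < p) (hκ : 0 < κ) (hκγ : κ ≤ γ / 100) (hγ : γ ≤ 1 / 4)
    (hR : RegC G p (κ ^ 2) κ ε κ K0 m P) (hG : G ≤ Γ) (hD : Disc Γ p κ U) (hU : U ≤ m)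
    (hdeg : ∀ v, (2 / 3 + γ / 2) * (n * p) ≤ #{x | G.Adj v x}) :
    ∃ Q ⊆ P, (1 - κ) * #P ≤ #Q ∧ Q.Nonempty ∧
      ∀ A ∈ Q, 2 * #Q < 3 * #{B ∈ Q | A ≠ B ∧ LR G A B (ε * m) (κ * p)} := by
  obtain ⟨hPm, hPd, hK, hmn, hrest, hirr⟩ := hR
  have hn' : (1:ℝ) ≤ n := by exact_mod_cast hn
  have hm : (0:ℝ) < m := by
    rcases Nat.eq_zero_or_pos m with h | h
    · subst h; simp at hK; linarith
    · exact_mod_cast h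
  have hk : (0:ℝ) < #P := by
    by_contra h
    have h0 : (#P : ℝ) = 0 := le_antisymm (not_lt.1 h) (by positivity)
    rw [h0] at hrest
    nlinarith
  have hcov : #(P.biUnion id) = #P * m := by
    have h := Finset.card_biUnion (s := P) (t := id) (fun A hA B hB h => hPd A hA B hB h)
    rw [h]
    simp only [id]
    rw [Finset.sum_congr rfl (fun A hA => hPm A hA)]
    simp
  have hkm : (#P : ℝ) * m ≤ n := by
    have := Finset.card_le_univ (P.biUnion id)
    rw [hcov, Fintype.card_fin] at this
    exact_mod_cast this
  set irr : Finset (Fin n) → Finset (Finset (Fin n)) := fun A => {B ∈ P | A ≠ B ∧ IrrP G p κ ε m A B} with hirrd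
  have hsum : (#{q ∈ P ×ˢ P | q.1 ≠ q.2 ∧ IrrP G p κ ε m q.1 q.2} : ℝ) = ∑ A ∈ P, (#(irr A) : ℝ) := by
    rw [Finset.card_filter, Finset.sum_product]
    push_cast
    apply Finset.sum_congr rfl
    intro A _
    rw [hirrd]
    simp only [Finset.card_filter]
    push_cast
    rfl
  set Q : Finset (Finset (Fin n)) := {A ∈ P | (#(irr A) : ℝ) ≤ κ * #P} with hQ
  have hQP : Q ⊆ P := Finset.filter_subset _ _
  have hbad : (#(P \ Q) : ℝ) ≤ κ * #P := by
    have h1 : (#(P \ Q) : ℝ) * (κ * #P) ≤ ∑ A ∈ P, (#(irr A) : ℝ) := by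
      calc (#(P \ Q) : ℝ) * (κ * #P) = ∑ A ∈ P \ Q, (κ * #P) := by simp
        _ ≤ ∑ A ∈ P \ Q, (#(irr A) : ℝ) := by
          apply Finset.sum_le_sum
          intro A hA
          obtain ⟨h1, h2⟩ := Finset.mem_sdiff.1 hA
          by_contra h3
          exact h2 (Finset.mem_filter.2 ⟨h1, (not_le.1 h3).le⟩)
        _ ≤ _ := Finset.sum_le_sum_of_subset_of_nonneg Finset.sdiff_subset (fun _ _ _ => by positivity)
    rw [← hsum] at h1
    have h2 := h1.trans hirr
    have h3 : (0:ℝ) < κ * #P := by positivity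
    rw [show κ ^ 2 * (#P:ℝ) ^ 2 = (κ * #P) * (κ * #P) by ring] at h2
    exact le_of_mul_le_mul_right h2 h3
  have hPQ : (#(P \ Q) : ℝ) + #Q = #P := by
    exact_mod_cast Finset.card_sdiff_add_card_eq_card hQP
  have hQc : (1 - κ) * #P ≤ #Q := by nlinarith
  refine ⟨Q, hQP, hQc, ?_, ?_⟩
  · apply Finset.card_pos.1
    have : (0:ℝ) < #Q := by
      have : 0 < (1 - κ) * #P := mul_pos (by linarith) hk
      linarith
    exact_mod_cast this
  intro A hA
  obtain ⟨hAP, hAi⟩ := Finset.mem_filter.1 hA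
  have hAm := hPm A hAP
  set D : Finset (Finset (Fin n)) := {B ∈ P | A ≠ B ∧ LR G A B (ε * m) (κ * p)} with hDd
  set D' : Finset (Finset (Fin n)) := {B ∈ Q | A ≠ B ∧ LR G A B (ε * m) (κ * p)} with hDd'
  have hDD : (#D : ℝ) ≤ #D' + #(P \ Q) := by
    have : D ⊆ D' ∪ (P \ Q) := by
      intro B hB
      obtain ⟨h1, h2⟩ := Finset.mem_filter.1 hB
      by_cases h : B ∈ Q
      · exact Finset.mem_union_left _ (Finset.mem_filter.2 ⟨h, h2⟩)
      · exact Finset.mem_union_right _ (Finset.mem_sdiff.2 ⟨h1, h⟩)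
    exact_mod_cast (Finset.card_le_card this).trans (Finset.card_union_le _ _)
  set X := (P.biUnion id)ᶜ ∪ A with hX
  have hXU : U ≤ #X := hU.trans (hAm ▸ Finset.card_le_card Finset.subset_union_right)
  have hXc : (#X : ℝ) ≤ 2 * κ * n := by
    have h1 : #X ≤ #(P.biUnion id)ᶜ + #A := Finset.card_union_le _ _
    have h2 : #(P.biUnion id)ᶜ + #P * m = n := by
      have := Finset.card_compl_add_card (P.biUnion id)
      rw [hcov, Fintype.card_fin] at this
      exact this
    rw [hAm] at h1
    have h1' : (#X : ℝ) ≤ #(P.biUnion id)ᶜ + m := by exact_mod_cast h1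
    have h2' : (#(P.biUnion id)ᶜ : ℝ) + #P * m = n := by exact_mod_cast h2
    linarith
  have hun : (univ : Finset (Fin n)) = X ∪ (P.erase A).biUnion id := by
    symm
    rw [Finset.eq_univ_iff_forall]
    intro x
    by_cases hx : x ∈ P.biUnion id
    · obtain ⟨B, hB, hxB⟩ := Finset.mem_biUnion.1 hx
      by_cases h : B = A
      · subst h
        exact Finset.mem_union_left _ (Finset.mem_union_right _ hxB)
      · exact Finset.mem_union_right _ (Finset.mem_biUnion.2 ⟨B, Finset.mem_erase.2 ⟨h, hB⟩, hxB⟩)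
    · exact Finset.mem_union_left _ (Finset.mem_union_left _ (Finset.mem_compl.2 hx))
  have hlow : (m : ℝ) * ((2 / 3 + γ / 2) * (n * p)) ≤ eG G A univ := by
    rw [eG_eq_sum_left]
    push_cast
    calc (m : ℝ) * ((2 / 3 + γ / 2) * (n * p)) = ∑ v ∈ A, ((2 / 3 + γ / 2) * (n * p)) := by
          rw [Finset.sum_const, hAm, nsmul_eq_mul]
      _ ≤ _ := Finset.sum_le_sum (fun v _ => hdeg v)
  have hup1 : (eG G A univ : ℝ) ≤ eG G A X + ∑ B ∈ P.erase A, (eG G A B : ℝ) := by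
    rw [hun]
    have := (eG_union_le G A X ((P.erase A).biUnion id)).trans
      (Nat.add_le_add_left (eG_biUnion_le G A (P.erase A)) _)
    exact_mod_cast this
  have hXe : (eG G A X : ℝ) ≤ 4 * p * m * (2 * κ * n) := by
    have h1 := hD.2 A X (by rw [hAm]; exact hU) hXU
    rw [hAm] at h1
    have h2 : (eG G A X : ℝ) ≤ eG Γ A X := by exact_mod_cast eG_mono_graph hG A X
    have : 4 * p * m * #X ≤ 4 * p * m * (2 * κ * n) := by gcongr
    linarith
  have hterm : ∀ B ∈ P.erase A, (eG G A B : ℝ) ≤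
      (if B ∈ D then (1 + κ) * p * m ^ 2 else 0) + (if B ∈ irr A then (1 + κ) * p * m ^ 2 else 0)
        + 3 * κ * p * m ^ 2 := by
    intro B hB
    obtain ⟨hBA, hBP⟩ := Finset.mem_erase.1 hB
    have hc : (eG G A B : ℝ) ≤ (1 + κ) * p * m ^ 2 := by
      have h1 := hD.1 A B (hPd A hAP B hBP (Ne.symm hBA)) (by rw [hAm]; exact hU) (by rw [hPm B hBP]; exact hU)
      rw [hAm, hPm B hBP] at h1
      have h2 : (eG G A B : ℝ) ≤ eG Γ A B := by exact_mod_cast eG_mono_graph hG A B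
      linarith
    have p1 : 0 ≤ (1 + κ) * p * m ^ 2 := by positivity
    have p2 : 0 ≤ 3 * κ * p * m ^ 2 := by positivity
    by_cases h1 : B ∈ D
    · rw [if_pos h1]
      split_ifs <;> linarith
    · by_cases h2 : B ∈ irr A
      · rw [if_pos h2]
        split_ifs <;> linarith
      · rw [if_neg h1, if_neg h2]
        have h3 : ¬ LR G A B (ε * m) (κ * p) := fun h => h1 (Finset.mem_filter.2 ⟨hBP, Ne.symm hBA, h⟩)
        have h4 : ¬ IrrP G p κ ε m A B := fun h => h2 (Finset.mem_filter.2 ⟨hBP, Ne.symm hBA, h⟩)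
        have h5 : (eG G A B : ℝ) ≤ 3 * κ * p * m ^ 2 := by
          by_contra h; exact h4 ⟨h3, h⟩
        linarith
  have hS : ∑ B ∈ P.erase A, (eG G A B : ℝ) ≤ (1 + κ) * p * m ^ 2 * #D + (1 + κ) * p * m ^ 2 * #(irr A)
      + 3 * κ * p * m ^ 2 * #P := by
    calc ∑ B ∈ P.erase A, (eG G A B : ℝ) ≤ ∑ B ∈ P.erase A, ((if B ∈ D then (1 + κ) * p * m ^ 2 else 0) + (if B ∈ irr A then (1 + κ) * p * m ^ 2 else 0)
        + 3 * κ * p * m ^ 2) := Finset.sum_le_sum hterm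
      _ ≤ ∑ B ∈ P, ((if B ∈ D then (1 + κ) * p * m ^ 2 else 0) + (if B ∈ irr A then (1 + κ) * p * m ^ 2 else 0)
        + 3 * κ * p * m ^ 2) := by
          apply Finset.sum_le_sum_of_subset_of_nonneg (Finset.erase_subset _ _)
          intro B _ _
          have p1 : 0 ≤ (1 + κ) * p * m ^ 2 := by positivity
          have p2 : 0 ≤ 3 * κ * p * m ^ 2 := by positivity
          split_ifs <;> linarith
      _ = _ := by
          rw [Finset.sum_add_distrib, Finset.sum_add_distrib]
          rw [← Finset.sum_filter, ← Finset.sum_filter, Finset.filter_mem_eq_inter, Finset.filter_mem_eq_inter]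
          rw [Finset.inter_eq_right.2 (Finset.filter_subset _ _), Finset.inter_eq_right.2 (Finset.filter_subset _ _)]
          simp only [Finset.sum_const, nsmul_eq_mul]
          ring
  -- combine
  have hall : (m : ℝ) * p * ((2 / 3 + γ / 2) * n) ≤ (m : ℝ) * p * (8 * κ * n + (1 + κ) * m * #D
      + (1 + κ) * m * #(irr A) + 3 * κ * (#P * m)) := by
    have := (hlow.trans hup1).trans (add_le_add hXe hS)
    linarith
  have hall2 := le_of_mul_le_mul_left hall (by positivity)
  have i1 : (m:ℝ) * #(irr A) ≤ κ * n := by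
    calc (m:ℝ) * #(irr A) ≤ m * (κ * #P) := by gcongr
      _ = κ * (#P * m) := by ring
      _ ≤ κ * n := by gcongr
  have i2 : (m:ℝ) * #D ≤ m * #D' + κ * n := by
    calc (m:ℝ) * #D ≤ m * (#D' + κ * #P) := by gcongr; linarith
      _ = m * #D' + κ * (#P * m) := by ring
      _ ≤ _ := by gcongr
  have i3 : (1 + κ) * m * #(irr A) ≤ (1 + κ) * (κ * n) := by rw [mul_assoc]; gcongr
  have i4 : (1 + κ) * m * #D ≤ (1 + κ) * (m * #D' + κ * n) := by rw [mul_assoc]; gcongr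
  have i5 : (m:ℝ) * #D' ≤ n := by
    have : (#D' : ℝ) ≤ #P := by
      exact_mod_cast Finset.card_le_card ((Finset.filter_subset _ _).trans hQP)
    nlinarith
  have i6 : (m:ℝ) * #Q ≤ n := by
    have : (#Q : ℝ) ≤ #P := by exact_mod_cast Finset.card_le_card hQP
    nlinarith
  have hn0 : (0:ℝ) < n := by linarith
  have hfin : (2/3 : ℝ) * n < m * #D' := by
    have e0 : κ * (#P * m) ≤ κ * n := by gcongr
    have e1 : κ * (m * #D') ≤ κ * n := by gcongr
    have e2 : κ * (κ * n) ≤ (1/400) * (κ * n) := by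
      have : 0 ≤ κ * n := by positivity
      nlinarith
    have e3 : κ * n ≤ γ / 100 * n := by gcongr
    have e4 : 0 < γ * n := by
      have : 0 < γ := by linarith
      positivity
    linarith
  have : (m:ℝ) * (2 * #Q) < m * (3 * #D') := by linarith
  exact_mod_cast lt_of_mul_lt_mul_left this hm.le

end reduced
end NS

namespace NS
open Classical Finset

lemma sg_sq_le {η : ℝ} (h : 0 < η) (h1 : η ≤ 1) : sg η ^ 2 ≤ η := by
  have h0 := sg_pos h
  have hle : sg η ≤ η := by
    unfold sg
    rw [div_le_iff₀ (by positivity)]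
    have h2 : Real.exp (-(3 / η ^ 2)) ≤ 1 := by
      rw [Real.exp_le_one_iff]
      have : 0 < 3 / η ^ 2 := by positivity
      linarith
    have h3 : (1 : ℝ) ≤ Real.exp 2 := by
      have := Real.add_one_le_exp (2 : ℝ); linarith
    have h4 : η ^ 2 * Real.exp (-(3 / η ^ 2)) ≤ η ^ 2 * 1 := by gcongr
    nlinarith
  nlinarith

section local_lemmas
variable {n : ℕ}

/-- number of pairs in a relation -/
noncomputable def eR (F : Fin n → Fin n → Prop) (A B : Finset (Fin n)) : ℕ :=
  #{q ∈ A ×ˢ B | F q.1 q.2}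

lemma eR_right (F : Fin n → Fin n → Prop) (A B : Finset (Fin n)) :
    eR F A B = ∑ y ∈ B, #{x ∈ A | F x y} := by
  unfold eR
  rw [Finset.card_filter, Finset.sum_product_right]
  simp only [Finset.card_filter]

lemma eR_left (F : Fin n → Fin n → Prop) (A B : Finset (Fin n)) :
    eR F A B = ∑ x ∈ A, #{y ∈ B | F x y} := by
  unfold eR
  rw [Finset.card_filter, Finset.sum_product]
  simp only [Finset.card_filter]

lemma eR_le {F F' : Fin n → Fin n → Prop} {A B : Finset (Fin n)}
    (h : ∀ x ∈ A, ∀ y ∈ B, F x y → F' x y) : eR F A B ≤ eR F' A B := by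
  unfold eR
  apply Finset.card_le_card
  intro q hq
  obtain ⟨h1, h2⟩ := Finset.mem_filter.1 hq
  obtain ⟨h3, h4⟩ := Finset.mem_product.1 h1
  exact Finset.mem_filter.2 ⟨h1, h _ h3 _ h4 h2⟩

lemma markov_right (F : Fin n → Fin n → Prop) (A B : Finset (Fin n)) (t : ℝ) (ht : 0 ≤ t) :
    (#{y ∈ B | t ≤ (#{x ∈ A | F x y} : ℝ)} : ℝ) * t ≤ eR F A B := by
  rw [eR_right]
  push_cast
  calc (#{y ∈ B | t ≤ (#{x ∈ A | F x y} : ℝ)} : ℝ) * t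
      = ∑ y ∈ {y ∈ B | t ≤ (#{x ∈ A | F x y} : ℝ)}, t := by rw [Finset.sum_const, nsmul_eq_mul]
    _ ≤ ∑ y ∈ {y ∈ B | t ≤ (#{x ∈ A | F x y} : ℝ)}, (#{x ∈ A | F x y} : ℝ) :=
        Finset.sum_le_sum (fun y hy => (Finset.mem_filter.1 hy).2)
    _ ≤ _ := Finset.sum_le_sum_of_subset_of_nonneg (Finset.filter_subset _ _) (fun _ _ _ => by positivity)

lemma markov_left (F : Fin n → Fin n → Prop) (A B : Finset (Fin n)) (t : ℝ) (ht : 0 ≤ t) :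
    (#{x ∈ A | t ≤ (#{y ∈ B | F x y} : ℝ)} : ℝ) * t ≤ eR F A B := by
  rw [eR_left]
  push_cast
  calc (#{x ∈ A | t ≤ (#{y ∈ B | F x y} : ℝ)} : ℝ) * t
      = ∑ y ∈ {x ∈ A | t ≤ (#{y ∈ B | F x y} : ℝ)}, t := by rw [Finset.sum_const, nsmul_eq_mul]
    _ ≤ ∑ x ∈ {x ∈ A | t ≤ (#{y ∈ B | F x y} : ℝ)}, (#{y ∈ B | F x y} : ℝ) :=
        Finset.sum_le_sum (fun y hy => (Finset.mem_filter.1 hy).2)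
    _ ≤ _ := Finset.sum_le_sum_of_subset_of_nonneg (Finset.filter_subset _ _) (fun _ _ _ => by positivity)

lemma lowdeg {G : SimpleGraph (Fin n)} {A B A' B' : Finset (Fin n)} {r D : ℝ} (h : LR G A B r D)
    (hr : 0 < r) (hA : A' ⊆ A) (hB : B' ⊆ B) (hB' : r ≤ #B') :
    (#{x ∈ A' | (#{y ∈ B' | G.Adj x y} : ℝ) < D * #B'} : ℝ) < r := by
  by_contra hc
  rw [not_lt] at hc
  set X := {x ∈ A' | (#{y ∈ B' | G.Adj x y} : ℝ) < D * #B'} with hX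
  have h1 := h X B' ((Finset.filter_subset _ _).trans hA) hB hc hB'
  have hne : X.Nonempty := by
    apply Finset.card_pos.1
    have : (0:ℝ) < #X := lt_of_lt_of_le hr hc
    exact_mod_cast this
  have h2 : (eG G X B' : ℝ) < #X * (D * #B') := by
    rw [eG_eq_sum_left]
    push_cast
    calc ∑ x ∈ X, (#{y ∈ B' | G.Adj x y} : ℝ) < ∑ x ∈ X, D * #B' :=
          Finset.sum_lt_sum_of_nonempty hne (fun x hx => (Finset.mem_filter.1 hx).2)
      _ = _ := by rw [Finset.sum_const, nsmul_eq_mul]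
  linarith

/-- upper discrepancy, extended to small second sets -/
lemma disc_small {Γ : SimpleGraph (Fin n)} {p η : ℝ} {U : ℕ} (hD : Disc Γ p η U) (hp : 0 < p)
    {A Y : Finset (Fin n)} (hA : U ≤ #A) {a : ℝ} (hA0 : 0 < #A) (ha : a ≤ eG Γ A Y) (hU : 4 * p * #A * U < a) :
    a ≤ 4 * p * #A * #Y := by
  by_cases h : U ≤ #Y
  · exact ha.trans (hD.2 A Y hA h)
  · exfalso
    have hn : U ≤ #(univ : Finset (Fin n)) := hA.trans (Finset.card_le_univ A)
    obtain ⟨Y', h1, -, h2⟩ := Finset.exists_subsuperset_card_eq (Finset.subset_univ Y) (not_le.1 h).le hn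
    have h3 := hD.2 A Y' hA h2.ge
    rw [h2] at h3
    have h4 : (eG Γ A Y : ℝ) ≤ eG Γ A Y' := by exact_mod_cast eG_mono Γ (subset_refl A) h1
    linarith

lemma heavy {Γ : SimpleGraph (Fin n)} {p η : ℝ} {U : ℕ} (hD : Disc Γ p η U) (hp : 0 < p)
    {A B : Finset (Fin n)} {F : Fin n → Fin n → Prop} (hF : ∀ x ∈ A, ∀ y ∈ B, F x y → Γ.Adj x y)
    {a : ℝ} (hA0 : 0 < #A) (hA : U ≤ #A) (hB : U < a / 8 * #B) (he : a * p * #A * #B ≤ eR F A B) :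
    a / 8 * #B ≤ (#{y ∈ B | a / 2 * p * #A ≤ (#{x ∈ A | F x y} : ℝ)} : ℝ) := by
  set Y := {y ∈ B | a / 2 * p * #A ≤ (#{x ∈ A | F x y} : ℝ)} with hY
  have hAr : (0:ℝ) < #A := by exact_mod_cast hA0
  have h1 : (eR F A B : ℝ) ≤ eG Γ A Y + a / 2 * p * #A * #B := by
    rw [eR_right, eG_eq_sum_right]
    push_cast
    have hYB : Y ⊆ B := Finset.filter_subset _ _
    rw [← Finset.sum_sdiff hYB, add_comm]
    apply add_le_add
    · apply Finset.sum_le_sum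
      intro y hy
      have : #{x ∈ A | F x y} ≤ #{x ∈ A | Γ.Adj x y} := by
        apply Finset.card_le_card
        intro x hx
        obtain ⟨h1, h2⟩ := Finset.mem_filter.1 hx
        exact Finset.mem_filter.2 ⟨h1, hF x h1 y (hYB hy) h2⟩
      exact_mod_cast this
    · have hB0 : 0 ≤ a / 2 * p * #A := by
        have : 0 < a / 8 * #B := lt_of_le_of_lt (by positivity) hB
        have ha : 0 < a := by
          by_contra h
          have : a / 8 * #B ≤ 0 := mul_nonpos_of_nonpos_of_nonneg (by linarith) (by positivity)
          linarith
        positivity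
      calc ∑ y ∈ B \ Y, (#{x ∈ A | F x y} : ℝ) ≤ ∑ y ∈ B \ Y, a / 2 * p * #A := by
            apply Finset.sum_le_sum
            intro y hy
            obtain ⟨h1, h2⟩ := Finset.mem_sdiff.1 hy
            by_contra h
            exact h2 (Finset.mem_filter.2 ⟨h1, (not_le.1 h).le⟩)
        _ = #(B \ Y) * (a / 2 * p * #A) := by rw [Finset.sum_const, nsmul_eq_mul]
        _ ≤ #B * (a / 2 * p * #A) := by
            have : (#(B \ Y) : ℝ) ≤ #B := by exact_mod_cast Finset.card_le_card Finset.sdiff_subset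
            gcongr
        _ = _ := by ring
  have h2 : a / 2 * p * #A * #B ≤ eG Γ A Y := by linarith
  have h3 := disc_small hD hp hA hA0 h2 (by
    have : 4 * p * #A * U < 4 * p * #A * (a / 8 * #B) := by gcongr
    linarith)
  have h4 : 4 * p * #A * (a / 8 * #B) ≤ 4 * p * #A * #Y := by linarith
  exact le_of_mul_le_mul_left h4 (by positivity)

/-- one-step extension -/
lemma one_step {Γ G : SimpleGraph (Fin n)} {p κ η σ ηd δ δ' : ℝ} {s U : ℕ} (hG : G ≤ Γ)
    (hp : 0 < p) (hκ : 0 < κ) (hη : 0 < η) (hσ : 0 < σ) (hσ1 : σ ^ 2 ≤ η) (hs : 0 < s) (hκ1 : κ ≤ 1)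
    (hD : Disc Γ p ηd U) (hI : Inh Γ p κ η σ s) {W0 W1 W2 : Finset (Fin n)}
    (h0 : #W0 = s) (h1 : #W1 = s) (h2 : #W2 = s) (d01 : Disjoint W0 W1) (d02 : Disjoint W0 W2)
    (d12 : Disjoint W1 W2) (l02 : LR G W0 W2 (σ ^ 2 * s) (κ * p)) (l12 : LR G W1 W2 (σ ^ 2 * s) (κ * p))
    {Bad : Fin n → Fin n → Prop} (hbad : (eR Bad W1 W2 : ℝ) ≤ δ' * s ^ 2 * p)
    (c1 : δ' ≤ κ / 32 * δ) (c2 : η ≤ δ / 64) (c3 : η ≤ κ / 2) (hU : U ≤ s) (hU2 : U < δ / 8 * s) :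
    (eR (fun x y => G.Adj x y ∧ (#{z ∈ W2 | G.Adj x z ∧ (G.Adj y z ∧ ¬ Bad y z)} : ℝ) <
      κ * σ ^ 2 * η / 8 * s * p ^ 2) W0 W1 : ℝ) ≤ δ * s ^ 2 * p := by
  by_contra hc
  rw [not_le] at hc
  have hsr : (0:ℝ) < s := by exact_mod_cast hs
  obtain ⟨F, hF⟩ : ∃ F : Fin n → Fin n → Prop, F = fun x y => G.Adj x y ∧
      (#{z ∈ W2 | G.Adj x z ∧ (G.Adj y z ∧ ¬ Bad y z)} : ℝ) < κ * σ ^ 2 * η / 8 * s * p ^ 2 := ⟨_, rfl⟩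
  rw [← hF] at hc
  have hF' : ∀ x y, F x y → G.Adj x y ∧
      (#{z ∈ W2 | G.Adj x z ∧ (G.Adj y z ∧ ¬ Bad y z)} : ℝ) < κ * σ ^ 2 * η / 8 * s * p ^ 2 := by
    intro x y h
    rw [hF] at h
    exact h
  have hY := heavy (A := W0) (B := W1) (F := F) (a := δ) hD hp (fun x _ y _ h => hG (hF' x y h).1) (by omega) (by omega)
    (by rw [h1]; exact hU2) (by rw [h0, h1]; linarith)
  rw [h1, h0] at hY
  set Y := {y ∈ W1 | δ / 2 * p * s ≤ (#{x ∈ W0 | F x y} : ℝ)} with hYd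
  set B1 := {y ∈ W1 | (#{z ∈ W2 | G.Adj y z} : ℝ) < κ * p * #W2} with hB1
  have hb1 : (#B1 : ℝ) < σ ^ 2 * s := lowdeg l12 (by positivity) (subset_refl _) (subset_refl _)
    (by
      rw [h2]
      have : σ ^ 2 * (s:ℝ) ≤ 1 * s := by
        apply mul_le_mul_of_nonneg_right _ hsr.le
        linarith
      linarith)
  set B2 := {y ∈ W1 | κ / 2 * p * s ≤ (#{z ∈ W2 | Bad y z} : ℝ)} with hB2
  have hb2 : (#B2 : ℝ) ≤ δ / 16 * s := by
    have := markov_left Bad W1 W2 (κ / 2 * p * s) (by positivity)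
    rw [← hB2] at this
    have h3 : (#B2 : ℝ) * (κ / 2 * p * s) ≤ δ / 16 * s * (κ / 2 * p * s) := by
      have : δ' * s ^ 2 * p ≤ κ / 32 * δ * s ^ 2 * p := by gcongr
      linarith
    exact le_of_mul_le_mul_right h3 (by positivity)
  have hb3 := hI G hG W0 W2 d02 h0.le h2.le l02
  set B3 := {y ∈ (W0 ∪ W2)ᶜ | InhBad Γ G W0 W2 ⌈η * s * p⌉₊
      (κ * p * σ ^ 2 / 8 * (⌈η * s * p⌉₊ : ℝ) ^ 2) y} with hB3
  have hex : ∃ y ∈ Y, y ∉ B1 ∧ y ∉ B2 ∧ y ∉ B3 := by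
    by_contra h
    push Not at h
    have hsub : Y ⊆ B1 ∪ (B2 ∪ B3) := by
      intro y hy
      by_cases e1 : y ∈ B1
      · exact Finset.mem_union_left _ e1
      by_cases e2 : y ∈ B2
      · exact Finset.mem_union_right _ (Finset.mem_union_left _ e2)
      · exact Finset.mem_union_right _ (Finset.mem_union_right _ (h y hy e1 e2))
    have hcard : (#Y : ℝ) ≤ #B1 + (#B2 + #B3) := by
      exact_mod_cast (Finset.card_le_card hsub).trans ((Finset.card_union_le _ _).trans
        (Nat.add_le_add_left (Finset.card_union_le _ _) _))
    have e1 : σ ^ 2 * (s:ℝ) ≤ η * s := by gcongr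
    have e2 : η * (s:ℝ) ≤ δ / 64 * s := by gcongr
    linarith
  obtain ⟨y, hyY, n1, n2, n3⟩ := hex
  obtain ⟨hyW, hyF⟩ := Finset.mem_filter.1 hyY
  have m1 : κ * p * s ≤ (#{z ∈ W2 | G.Adj y z} : ℝ) := by
    by_contra h
    exact n1 (Finset.mem_filter.2 ⟨hyW, by rw [h2]; exact not_le.1 h⟩)
  have m2 : (#{z ∈ W2 | Bad y z} : ℝ) < κ / 2 * p * s := by
    by_contra h
    exact n2 (Finset.mem_filter.2 ⟨hyW, not_lt.1 h⟩)
  have m3 : (#{z ∈ W2 | G.Adj y z} : ℝ) ≤ #{z ∈ W2 | G.Adj y z ∧ ¬ Bad y z} + #{z ∈ W2 | Bad y z} := by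
    have : {z ∈ W2 | G.Adj y z} ⊆ {z ∈ W2 | G.Adj y z ∧ ¬ Bad y z} ∪ {z ∈ W2 | Bad y z} := by
      intro z hz
      obtain ⟨a1, a2⟩ := Finset.mem_filter.1 hz
      by_cases hb : Bad y z
      · exact Finset.mem_union_right _ (Finset.mem_filter.2 ⟨a1, hb⟩)
      · exact Finset.mem_union_left _ (Finset.mem_filter.2 ⟨a1, a2, hb⟩)
    exact_mod_cast (Finset.card_le_card this).trans (Finset.card_union_le _ _)
  have hq0 : 0 < η * s * p := by positivity
  set q := ⌈η * s * p⌉₊ with hq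
  have hqle : η * s * p ≤ q := Nat.le_ceil _
  have q1 : q ≤ #{x ∈ W0 | F x y} := by
    apply Nat.ceil_le.2
    have : η * s * p ≤ δ / 64 * s * p := by gcongr
    have hδ : 0 < δ := by linarith
    have : 0 < δ * s * p := by positivity
    linarith
  have q2 : q ≤ #{z ∈ W2 | G.Adj y z ∧ ¬ Bad y z} := by
    apply Nat.ceil_le.2
    have : η * s * p ≤ κ / 2 * s * p := by gcongr
    linarith
  obtain ⟨X, hX, hXc⟩ := Finset.exists_subset_card_eq q1
  obtain ⟨Z, hZ, hZc⟩ := Finset.exists_subset_card_eq q2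
  apply n3
  refine Finset.mem_filter.2 ⟨?_, X, Z, hX.trans (Finset.filter_subset _ _), hZ.trans (Finset.filter_subset _ _),
    hXc, hZc, ?_, ?_, ?_⟩
  · rw [Finset.mem_compl, Finset.mem_union]
    rintro (h | h)
    · exact Finset.disjoint_left.1 d01 h hyW
    · exact Finset.disjoint_left.1 d12 hyW h
  · intro x hx
    exact hG (hF' _ _ (Finset.mem_filter.1 (hX hx)).2).1.symm
  · intro z hz
    exact hG ((Finset.mem_filter.1 (hZ hz)).2.1)
  · rw [eG_eq_sum_left]
    push_cast
    have hq1 : (0:ℝ) < q := lt_of_lt_of_le hq0 hqle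
    have hne : X.Nonempty := by
      apply Finset.card_pos.1
      rw [hXc]
      exact_mod_cast hq1
    calc ∑ x ∈ X, (#{z ∈ Z | G.Adj x z} : ℝ) < ∑ x ∈ X, κ * σ ^ 2 * η / 8 * s * p ^ 2 := by
          apply Finset.sum_lt_sum_of_nonempty hne
          intro x hx
          refine lt_of_le_of_lt ?_ (hF' _ _ (Finset.mem_filter.1 (hX hx)).2).2
          have : #{z ∈ Z | G.Adj x z} ≤ #{z ∈ W2 | G.Adj x z ∧ (G.Adj y z ∧ ¬ Bad y z)} := by
            apply Finset.card_le_card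
            intro z hz
            obtain ⟨a1, a2⟩ := Finset.mem_filter.1 hz
            obtain ⟨a3, a4⟩ := Finset.mem_filter.1 (hZ a1)
            exact Finset.mem_filter.2 ⟨a3, a2, a4⟩
          exact_mod_cast this
      _ = q * (κ * p * σ ^ 2 / 8 * (η * s * p)) := by
          rw [Finset.sum_const, nsmul_eq_mul, hXc]; ring
      _ ≤ q * (κ * p * σ ^ 2 / 8 * q) := by gcongr
      _ = _ := by ring

end local_lemmas
end NS

namespace NS
open Classical Finset

section connect
variable {n : ℕ}

lemma eR_flip (F : Fin n → Fin n → Prop) (A B : Finset (Fin n)) :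
    eR (fun x y => F y x) A B = eR F B A := by
  rw [eR_left, eR_right]

lemma exists_edge_of_eG {G : SimpleGraph (Fin n)} {X Z : Finset (Fin n)} (h : 0 < eG G X Z) :
    ∃ x ∈ X, ∃ z ∈ Z, G.Adj x z := by
  obtain ⟨q, hq⟩ := Finset.card_pos.1 h
  obtain ⟨h1, h2⟩ := Finset.mem_filter.1 hq
  obtain ⟨h3, h4⟩ := Finset.mem_product.1 h1
  exact ⟨_, h3, _, h4, h2⟩

/-- if `y` is not an exceptional vertex then neighbourhoods contain an edge -/
lemma inh_use {Γ G : SimpleGraph (Fin n)} {p κ η σ : ℝ} {s : ℕ} {A B : Finset (Fin n)} (hp : 0 < p)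
    (hκ : 0 < κ) (hη : 0 < η) (hσ : 0 < σ) (hs : 0 < s) {y : Fin n}
    (h : y ∉ ({y ∈ (A ∪ B)ᶜ | InhBad Γ G A B ⌈η * s * p⌉₊
      (κ * p * σ ^ 2 / 8 * (⌈η * s * p⌉₊ : ℝ) ^ 2) y} : Finset (Fin n))) (hy : y ∉ A) (hy' : y ∉ B)
    {X Z : Finset (Fin n)} (hX : X ⊆ A) (hZ : Z ⊆ B) (hXa : ∀ x ∈ X, Γ.Adj y x) (hZa : ∀ z ∈ Z, Γ.Adj y z)
    (hXc : η * s * p ≤ #X) (hZc : η * s * p ≤ #Z) : ∃ x ∈ X, ∃ z ∈ Z, G.Adj x z := by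
  obtain ⟨X', hX', hXc'⟩ := Finset.exists_subset_card_eq (Nat.ceil_le.2 hXc)
  obtain ⟨Z', hZ', hZc'⟩ := Finset.exists_subset_card_eq (Nat.ceil_le.2 hZc)
  have hsr : (0:ℝ) < s := by exact_mod_cast hs
  have hq0 : 0 < η * s * p := by positivity
  have hq : (0:ℝ) < ⌈η * s * p⌉₊ := by exact_mod_cast Nat.ceil_pos.2 hq0
  have hpos : 0 < eG G X' Z' := by
    by_contra h0
    apply h
    refine Finset.mem_filter.2 ⟨?_, X', Z', hX'.trans hX, hZ'.trans hZ, hXc', hZc',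
      fun x hx => hXa x (hX' hx), fun z hz => hZa z (hZ' hz), ?_⟩
    · rw [Finset.mem_compl, Finset.mem_union]
      tauto
    · have : eG G X' Z' = 0 := by omega
      rw [this]
      push_cast
      positivity
  obtain ⟨x, hx, z, hz, hxz⟩ := exists_edge_of_eG hpos
  exact ⟨x, hX' hx, z, hZ' hz, hxz⟩

lemma connect {Γ G : SimpleGraph (Fin n)} {p κ η σ ηd ν : ℝ} {s U : ℕ} (hG : G ≤ Γ)
    (hp : 0 < p) (hκ : 0 < κ) (hκ1 : κ ≤ 1) (hη : 0 < η) (hσ : 0 < σ) (hσ1 : σ ^ 2 ≤ η) (hs : 0 < s)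
    (hν : 0 < ν) (hν1 : ν ≤ 1) (hην : η ≤ κ * ν ^ 2 / 1000)
    (hD : Disc Γ p ηd U) (hI : Inh Γ p κ η σ s) {W0 W1 W2 W3 : Finset (Fin n)}
    (h0 : #W0 = s) (h1 : #W1 = s) (h2 : #W2 = s) (h3 : #W3 = s)
    (d01 : Disjoint W0 W1) (d02 : Disjoint W0 W2)
    (d12 : Disjoint W1 W2) (d13 : Disjoint W1 W3) (d23 : Disjoint W2 W3)
    (l02 : LR G W0 W2 (σ ^ 2 * s) (κ * p)) (l12 : LR G W1 W2 (σ ^ 2 * s) (κ * p))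
    (l13 : LR G W1 W3 (σ ^ 2 * s) (κ * p)) {F H : Fin n → Fin n → Prop}
    (hF : ∀ x ∈ W0, ∀ y ∈ W1, F x y → G.Adj x y) (hH : ∀ x ∈ W2, ∀ y ∈ W3, H x y → G.Adj x y)
    (hFe : ν * s ^ 2 * p ≤ eR F W0 W1) (hHe : ν * s ^ 2 * p ≤ eR H W2 W3)
    (hU : U ≤ s) (hU2 : U < ν / 8 * s) :
    ∃ x ∈ W0, ∃ y ∈ W1, ∃ z ∈ W2, ∃ w ∈ W3, F x y ∧ H z w ∧ G.Adj x z ∧ G.Adj y z ∧ G.Adj y w := by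
  have hsr : (0:ℝ) < s := by exact_mod_cast hs
  have hY := heavy (A := W0) (B := W1) (F := F) (a := ν) hD hp (fun x hx y hy h => hG (hF x hx y hy h)) (by omega) (by omega)
    (by rw [h1]; exact hU2) (by rw [h0, h1]; linarith)
  rw [h1, h0] at hY
  have hZ := heavy (A := W3) (B := W2) (F := fun x y => H y x) (a := ν) hD hp
    (fun x hx y hy h => (hG (hH y hy x hx h)).symm) (by omega) (by omega)
    (by rw [h2]; exact hU2) (by rw [eR_flip, h2, h3]; linarith)
  rw [h2, h3] at hZ
  set Y := {y ∈ W1 | ν / 2 * p * s ≤ (#{x ∈ W0 | F x y} : ℝ)} with hYd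
  set Z := {z ∈ W2 | ν / 2 * p * s ≤ (#{w ∈ W3 | H z w} : ℝ)} with hZd
  have hb3 := hI G hG W0 W2 d02 h0.le h2.le l02
  have hb4 := hI G hG W1 W3 d13 h1.le h3.le l13
  set B3 := {y ∈ (W0 ∪ W2)ᶜ | InhBad Γ G W0 W2 ⌈η * s * p⌉₊
      (κ * p * σ ^ 2 / 8 * (⌈η * s * p⌉₊ : ℝ) ^ 2) y} with hB3
  set B4 := {y ∈ (W1 ∪ W3)ᶜ | InhBad Γ G W1 W3 ⌈η * s * p⌉₊
      (κ * p * σ ^ 2 / 8 * (⌈η * s * p⌉₊ : ℝ) ^ 2) y} with hB4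
  have hην1 : η ≤ ν / 1000 := by
    have : κ * ν ^ 2 ≤ 1 * (1 * ν) := by
      rw [sq]; gcongr
    linarith
  have hηκν : η ≤ κ * ν / 1000 := by
    have : κ * ν ^ 2 ≤ κ * (1 * ν) := by
      rw [sq]; gcongr
    linarith
  have hηs : η * s ≤ ν / 1000 * s := by gcongr
  set Z1 := Z \ B4 with hZ1
  have hZ1c : ν / 16 * s ≤ (#Z1 : ℝ) := by
    have : (#Z : ℝ) ≤ #Z1 + #B4 := by
      have := Finset.le_card_sdiff B4 Z
      have : #Z ≤ #Z1 + #B4 := by rw [hZ1]; omega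
      exact_mod_cast this
    have : 0 < ν * s := by positivity
    linarith
  have hZ1W : Z1 ⊆ W2 := Finset.sdiff_subset.trans (Finset.filter_subset _ _)
  obtain ⟨Bad, hBad⟩ : ∃ Bad : Fin n → Fin n → Prop, ∀ y z, Bad y z ↔ (G.Adj y z ∧ ∀ w ∈ W3, H z w → ¬ G.Adj y w) :=
    ⟨_, fun _ _ => Iff.rfl⟩
  have hbz : ∀ z ∈ Z1, (#{y ∈ Y | Bad y z} : ℝ) ≤ η * s * p := by
    intro z hz
    by_contra hc
    rw [not_le] at hc
    obtain ⟨hzZ, hzB⟩ := Finset.mem_sdiff.1 hz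
    obtain ⟨hzW, hzH⟩ := Finset.mem_filter.1 hzZ
    obtain ⟨y, hy, w, hw, hyw⟩ := inh_use (y := z) hp hκ hη hσ hs hzB
      (fun h => Finset.disjoint_left.1 d12 h hzW) (fun h => Finset.disjoint_left.1 d23 hzW h)
      (X := {y ∈ Y | Bad y z}) (Z := {w ∈ W3 | H z w})
      ((Finset.filter_subset _ _).trans (Finset.filter_subset _ _)) (Finset.filter_subset _ _)
      (fun y hy => (hG ((hBad _ _).1 (Finset.mem_filter.1 hy).2).1).symm)
      (fun w hw => hG (hH z hzW w (Finset.mem_filter.1 hw).1 (Finset.mem_filter.1 hw).2)) hc.le (by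
        have : η * s * p ≤ ν / 1000 * s * p := by gcongr
        have : 0 < ν * s * p := by positivity
        linarith)
    obtain ⟨hw1, hw2⟩ := Finset.mem_filter.1 hw
    exact ((hBad _ _).1 (Finset.mem_filter.1 hy).2).2 w hw1 hw2 hyw
  have hbt : (eR Bad Y Z1 : ℝ) ≤ s * (η * s * p) := by
    rw [eR_right]
    push_cast
    calc ∑ z ∈ Z1, (#{y ∈ Y | Bad y z} : ℝ) ≤ ∑ z ∈ Z1, η * s * p := Finset.sum_le_sum hbz
      _ = #Z1 * (η * s * p) := by rw [Finset.sum_const, nsmul_eq_mul]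
      _ ≤ s * (η * s * p) := by
        have : (#Z1 : ℝ) ≤ s := by
          rw [← h2]; exact_mod_cast Finset.card_le_card hZ1W
        gcongr
  set B2 := {y ∈ Y | κ * ν / 32 * p * s ≤ (#{z ∈ Z1 | Bad y z} : ℝ)} with hB2
  have hb2 : (#B2 : ℝ) ≤ ν / 20 * s := by
    have := markov_left Bad Y Z1 (κ * ν / 32 * p * s) (by positivity)
    rw [← hB2] at this
    have h3 : (#B2 : ℝ) * (κ * ν / 32 * p * s) ≤ ν / 20 * s * (κ * ν / 32 * p * s) := by
      refine (this.trans hbt).trans ?_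
      calc s * (η * s * p) ≤ s * (κ * ν ^ 2 / 1000 * s * p) := by gcongr
        _ ≤ _ := by
          have : 0 < κ * ν ^ 2 * (s * s * p) := by positivity
          linarith
    exact le_of_mul_le_mul_right h3 (by positivity)
  set B1 := {y ∈ Y | (#{z ∈ Z1 | G.Adj y z} : ℝ) < κ * p * #Z1} with hB1
  have hσs : σ ^ 2 * s ≤ η * s := by gcongr
  have hb1 : (#B1 : ℝ) < σ ^ 2 * s := lowdeg l12 (by positivity) (Finset.filter_subset _ _) hZ1W
    (by
      have : 0 < ν * s := by positivity
      linarith)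
  have hex : ∃ y ∈ Y, y ∉ B1 ∧ y ∉ B2 ∧ y ∉ B3 := by
    by_contra h
    push Not at h
    have hsub : Y ⊆ B1 ∪ (B2 ∪ B3) := by
      intro y hy
      by_cases e1 : y ∈ B1
      · exact Finset.mem_union_left _ e1
      by_cases e2 : y ∈ B2
      · exact Finset.mem_union_right _ (Finset.mem_union_left _ e2)
      · exact Finset.mem_union_right _ (Finset.mem_union_right _ (h y hy e1 e2))
    have hcard : (#Y : ℝ) ≤ #B1 + (#B2 + #B3) := by
      exact_mod_cast (Finset.card_le_card hsub).trans ((Finset.card_union_le _ _).trans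
        (Nat.add_le_add_left (Finset.card_union_le _ _) _))
    have : 0 < ν * s := by positivity
    linarith
  obtain ⟨y, hyY, n1, n2, n3⟩ := hex
  obtain ⟨hyW, hyF⟩ := Finset.mem_filter.1 hyY
  have m1 : κ * p * (ν / 16 * s) ≤ (#{z ∈ Z1 | G.Adj y z} : ℝ) := by
    have : κ * p * #Z1 ≤ (#{z ∈ Z1 | G.Adj y z} : ℝ) := by
      by_contra h
      exact n1 (Finset.mem_filter.2 ⟨hyY, not_le.1 h⟩)
    refine le_trans ?_ this
    gcongr
  have m2 : (#{z ∈ Z1 | Bad y z} : ℝ) < κ * ν / 32 * p * s := by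
    by_contra h
    exact n2 (Finset.mem_filter.2 ⟨hyY, not_lt.1 h⟩)
  have m3 : (#{z ∈ Z1 | G.Adj y z} : ℝ) ≤ #{z ∈ Z1 | G.Adj y z ∧ ¬ Bad y z} + #{z ∈ Z1 | Bad y z} := by
    have : {z ∈ Z1 | G.Adj y z} ⊆ {z ∈ Z1 | G.Adj y z ∧ ¬ Bad y z} ∪ {z ∈ Z1 | Bad y z} := by
      intro z hz
      obtain ⟨a1, a2⟩ := Finset.mem_filter.1 hz
      by_cases hb : Bad y z
      · exact Finset.mem_union_right _ (Finset.mem_filter.2 ⟨a1, hb⟩)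
      · exact Finset.mem_union_left _ (Finset.mem_filter.2 ⟨a1, a2, hb⟩)
    exact_mod_cast (Finset.card_le_card this).trans (Finset.card_union_le _ _)
  have hpos : 0 < κ * ν * p * s := by positivity
  have hηp : η * s * p ≤ κ * ν / 1000 * s * p := by gcongr
  have hηp2 : η * s * p ≤ ν / 1000 * s * p := by gcongr
  have hpos2 : 0 < ν * p * s := by positivity
  obtain ⟨x, hx, z, hz, hxz⟩ := inh_use (y := y) hp hκ hη hσ hs n3
      (fun h => Finset.disjoint_left.1 d01 h hyW) (fun h => Finset.disjoint_left.1 d12 hyW h)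
      (X := {x ∈ W0 | F x y}) (Z := {z ∈ Z1 | G.Adj y z ∧ ¬ Bad y z})
      (Finset.filter_subset _ _) ((Finset.filter_subset _ _).trans hZ1W)
      (fun x hx => (hG (hF x (Finset.mem_filter.1 hx).1 y hyW (Finset.mem_filter.1 hx).2)).symm)
      (fun z hz => hG (Finset.mem_filter.1 hz).2.1) (by linarith) (by linarith)
  obtain ⟨hx1, hx2⟩ := Finset.mem_filter.1 hx
  obtain ⟨hz1, hz2, hz3⟩ := Finset.mem_filter.1 hz
  rw [hBad] at hz3
  push Not at hz3
  obtain ⟨w, hw, hzw, hyw⟩ := hz3 hz2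
  exact ⟨x, hx1, y, hyW, z, hZ1W hz1, w, hw, hx2, hzw, hxz, hz2, hyw⟩

end connect
end NS

namespace NS
open Classical Finset

section good
variable {n : ℕ}

def Chain (G : SimpleGraph (Fin n)) (D r : ℝ) (L s : ℕ) (S : ℕ → Finset (Fin n)) : Prop :=
  (∀ j < L, #(S j) = s) ∧ (∀ i < L, ∀ j < L, i ≠ j → Disjoint (S i) (S j)) ∧
  ∀ i j, i < j → j ≤ i + 2 → j < L → LR G (S i) (S j) r D

def gd (G : SimpleGraph (Fin n)) (S : ℕ → Finset (Fin n)) (t : ℝ) : ℕ → ℕ → Fin n → Fin n → Prop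
  | 0, _, x, y => G.Adj x y
  | r + 1, j, x, y => G.Adj x y ∧ t ≤ (#{z ∈ S (j + 2) | G.Adj x z ∧ gd G S t r (j + 1) y z} : ℝ)

lemma gd_adj {G : SimpleGraph (Fin n)} {S : ℕ → Finset (Fin n)} {t : ℝ} {r j : ℕ} {x y : Fin n}
    (h : gd G S t r j x y) : G.Adj x y := by
  cases r with
  | zero => exact h
  | succ r => exact h.1

lemma eR_zero {F : Fin n → Fin n → Prop} (h : ∀ x y, ¬ F x y) (A B : Finset (Fin n)) : eR F A B = 0 := by
  unfold eR
  refine Finset.card_eq_zero.2 (Finset.eq_empty_of_forall_notMem fun q hq => ?_)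
  exact h _ _ (Finset.mem_filter.1 hq).2

lemma gd_bound {Γ G : SimpleGraph (Fin n)} {p κ η σ ηd δ : ℝ} {s U L R : ℕ} (hG : G ≤ Γ)
    (hp : 0 < p) (hκ : 0 < κ) (hη : 0 < η) (hσ : 0 < σ) (hσ1 : σ ^ 2 ≤ η) (hs : 0 < s) (hκ1 : κ ≤ 1)
    (hδ : 0 < δ)
    (hD : Disc Γ p ηd U) (hI : Inh Γ p κ η σ s) {S : ℕ → Finset (Fin n)}
    (hC : Chain G (κ * p) (σ ^ 2 * s) L s S) (c2 : η ≤ δ * (κ / 32) ^ R / 64) (c3 : η ≤ κ / 2)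
    (hU : U ≤ s) (hU2 : U < η * s) (r : ℕ) : ∀ j, r ≤ R → j + r + 1 < L →
    (eR (fun x y => G.Adj x y ∧ ¬ gd G S (κ * σ ^ 2 * η / 8 * s * p ^ 2) r j x y) (S j) (S (j + 1)) : ℝ)
      ≤ δ * (κ / 32) ^ (R - r) * s ^ 2 * p := by
  have hsr : (0:ℝ) < s := by exact_mod_cast hs
  induction r with
  | zero =>
    intro j _ _
    have : eR (fun x y => G.Adj x y ∧ ¬ gd G S (κ * σ ^ 2 * η / 8 * s * p ^ 2) 0 j x y) (S j) (S (j + 1)) = 0 := by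
      exact eR_zero (fun x y h => h.2 h.1) _ _
    rw [this]
    push_cast
    positivity
  | succ r ih =>
    intro j hr hj
    have h1 := ih (j + 1) (by omega) (by omega)
    obtain ⟨hc, hd, hl⟩ := hC
    have hpow : (κ / 32) ^ R ≤ (κ / 32) ^ (R - (r + 1)) :=
      pow_le_pow_of_le_one (by positivity) (by linarith) (by omega)
    have hηd : η ≤ δ * (κ / 32) ^ (R - (r + 1)) / 64 := by
      refine c2.trans ?_
      gcongr
    have := one_step (W0 := S j) (W1 := S (j + 1)) (W2 := S (j + 2)) (δ := δ * (κ / 32) ^ (R - (r + 1)))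
      hG hp hκ hη hσ hσ1 hs hκ1 hD hI
      (hc _ (by omega)) (hc _ (by omega)) (hc _ (by omega)) (hd _ (by omega) _ (by omega) (by omega))
      (hd _ (by omega) _ (by omega) (by omega)) (hd _ (by omega) _ (by omega) (by omega))
      (hl _ _ (by omega) (by omega) (by omega)) (hl _ _ (by omega) (by omega) (by omega))
      h1 (by
        rw [show R - r = R - (r + 1) + 1 by omega, pow_succ]
        apply le_of_eq; ring) hηd c3 hU (by
        have : η * s ≤ δ * (κ / 32) ^ (R - (r + 1)) / 64 * s := by gcongr
        have : 0 < δ * (κ / 32) ^ (R - (r + 1)) * s := by positivity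
        linarith)
    refine le_trans ?_ this
    have hle := eR_le (A := S j) (B := S (j + 1))
      (F := fun x y => G.Adj x y ∧ ¬ gd G S (κ * σ ^ 2 * η / 8 * s * p ^ 2) (r + 1) j x y)
      (F' := fun x y => G.Adj x y ∧ (#{z ∈ S (j + 2) | G.Adj x z ∧ (G.Adj y z ∧
        ¬ (G.Adj y z ∧ ¬ gd G S (κ * σ ^ 2 * η / 8 * s * p ^ 2) r (j + 1) y z))} : ℝ) <
        κ * σ ^ 2 * η / 8 * s * p ^ 2) (by
      intro x _ y _ h
      refine ⟨h.1, ?_⟩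
      by_contra hcc
      apply h.2
      refine ⟨h.1, (not_lt.1 hcc).trans ?_⟩
      have : ∀ z ∈ S (j + 2), (G.Adj x z ∧ (G.Adj y z ∧
        ¬ (G.Adj y z ∧ ¬ gd G S (κ * σ ^ 2 * η / 8 * s * p ^ 2) r (j + 1) y z))) →
        (G.Adj x z ∧ gd G S (κ * σ ^ 2 * η / 8 * s * p ^ 2) r (j + 1) y z) := by
        intro z _; tauto
      exact_mod_cast Finset.card_le_card (fun z hz => Finset.mem_filter.2 ⟨(Finset.mem_filter.1 hz).1, this z (Finset.mem_filter.1 hz).1 (Finset.mem_filter.1 hz).2⟩))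
    exact_mod_cast hle

noncomputable def PA (G : SimpleGraph (Fin n)) (S : ℕ → Finset (Fin n)) (t : ℝ) (r j : ℕ) (x y : Fin n) :
    Finset (Fin (r + 2) → Fin n) :=
  {v | v 0 = x ∧ v 1 = y ∧ (∀ i : Fin (r + 2), v i ∈ S (j + i.val)) ∧ SqP G v ∧
    gd G S t 2 (j + r) (v ⟨r, by omega⟩) (v ⟨r + 1, by omega⟩)}

lemma PA_count {G : SimpleGraph (Fin n)} {S : ℕ → Finset (Fin n)} {t : ℝ} (ht : 0 ≤ t) (r : ℕ) :
    ∀ (j : ℕ) (x y : Fin n), x ∈ S j → y ∈ S (j + 1) → gd G S t (r + 2) j x y →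
      t ^ r ≤ #(PA G S t r j x y) := by
  induction r with
  | zero =>
    intro j x y hx hy h
    have : 0 < #(PA G S t 0 j x y) := by
      apply Finset.card_pos.2
      refine ⟨![x, y], Finset.mem_filter.2 ⟨Finset.mem_univ _, rfl, rfl, ?_, ?_, h⟩⟩
      · intro i
        fin_cases i
        · exact hx
        · exact hy
      · intro i k hik
        have hi : i = 0 := by
          have := hik.1; have := k.2; apply Fin.ext; simp; omega
        have hk : k = 1 := by
          have := hik.1; have := k.2; apply Fin.ext; simp; omega
        subst hi; subst hk
        exact gd_adj h
    rw [pow_zero]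
    exact_mod_cast this
  | succ r ih =>
    intro j x y hx hy h
    obtain ⟨hxy, hZ⟩ := h
    set Z := {z ∈ S (j + 2) | G.Adj x z ∧ gd G S t (r + 2) (j + 1) y z} with hZd
    have hsub : Z.biUnion (fun z => (PA G S t r (j + 1) y z).image
        (fun v => (Fin.cons x v : Fin (r + 1 + 2) → Fin n))) ⊆ PA G S t (r + 1) j x y := by
      intro w hw
      obtain ⟨z, hz, hw⟩ := Finset.mem_biUnion.1 hw
      obtain ⟨v, hv, rfl⟩ := Finset.mem_image.1 hw
      obtain ⟨hz1, hz2, hz3⟩ := Finset.mem_filter.1 hz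
      obtain ⟨-, v0, v1, vS, vP, vg⟩ := Finset.mem_filter.1 hv
      refine Finset.mem_filter.2 ⟨Finset.mem_univ _, rfl, ?_, ?_, ?_, ?_⟩
      · rw [← v0]; rfl
      · intro i
        refine Fin.cases ?_ (fun i => ?_) i
        · exact hx
        · rw [Fin.cons_succ, Fin.val_succ, show j + (i.val + 1) = j + 1 + i.val by omega]
          exact vS i
      · intro a b hab
        obtain ⟨h1, h2⟩ := hab
        revert h1 h2
        refine Fin.cases ?_ (fun a => ?_) a
        · refine Fin.cases ?_ (fun b => ?_) b
          · intro h1; exact absurd h1 (lt_irrefl _)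
          · intro h1 h2
            rw [Fin.cons_zero, Fin.cons_succ]
            rw [Fin.val_succ] at h2
            have hb : b.val = 0 ∨ b.val = 1 := by
              simp at h2; omega
            rcases hb with hb | hb
            · have : b = 0 := Fin.ext hb
              rw [this, v0]; exact hxy
            · have : b = 1 := Fin.ext (by rw [hb]; simp)
              rw [this, v1]; exact hz2
        · refine Fin.cases ?_ (fun b => ?_) b
          · intro h1; simp at h1
          · intro h1 h2
            rw [Fin.cons_succ, Fin.cons_succ]
            rw [Fin.val_succ, Fin.val_succ] at h1 h2
            exact vP a b ⟨by omega, by omega⟩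
      · rw [show j + (r + 1) = j + 1 + r by omega]
        exact vg
    have hcard := Finset.card_le_card hsub
    rw [Finset.card_biUnion] at hcard
    · have : ∀ z ∈ Z, t ^ r ≤ (#((PA G S t r (j + 1) y z).image
        (fun v => (Fin.cons x v : Fin (r + 1 + 2) → Fin n))) : ℝ) := by
        intro z hz
        obtain ⟨hz1, hz2, hz3⟩ := Finset.mem_filter.1 hz
        rw [Finset.card_image_of_injective _ (fun a b h => Fin.cons_right_injective (α := fun _ => Fin n) x h)]
        exact ih (j + 1) y z hy hz1 hz3
      calc t ^ (r + 1) = t * t ^ r := by ring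
        _ ≤ #Z * t ^ r := by gcongr
        _ = ∑ z ∈ Z, t ^ r := by rw [Finset.sum_const, nsmul_eq_mul]
        _ ≤ _ := Finset.sum_le_sum this
        _ ≤ _ := by exact_mod_cast hcard
    · intro z _ z' _ hzz
      refine Finset.disjoint_left.2 ?_
      intro w hw hw'
      obtain ⟨v, hv, rfl⟩ := Finset.mem_image.1 hw
      obtain ⟨v', hv', he⟩ := Finset.mem_image.1 hw'
      have := Fin.cons_right_injective (α := fun _ => Fin n) x he
      subst this
      obtain ⟨-, v0, v1, -⟩ := Finset.mem_filter.1 hv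
      obtain ⟨-, v0', v1', -⟩ := Finset.mem_filter.1 hv'
      exact hzz (v1.symm.trans v1')

lemma cs_fiber {α β : Type*} [DecidableEq β] (s : Finset α) (f : α → β) :
    #s ^ 2 ≤ #(s.image f) * #{q ∈ s ×ˢ s | f q.1 = f q.2} := by
  have h1 : #s = ∑ b ∈ s.image f, #{a ∈ s | f a = b} := Finset.card_eq_sum_card_image f s
  have h2 : #{q ∈ s ×ˢ s | f q.1 = f q.2} = ∑ b ∈ s.image f, #{a ∈ s | f a = b} ^ 2 := by
    rw [Finset.card_eq_sum_card_fiberwise (f := fun q : α × α => f q.1) (t := s.image f)]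
    · apply Finset.sum_congr rfl
      intro b _
      rw [sq, ← Finset.card_product]
      congr 1
      ext q
      simp only [Finset.mem_filter, Finset.mem_product]
      constructor
      · rintro ⟨⟨⟨h1, h2⟩, h3⟩, h4⟩; exact ⟨⟨h1, h4⟩, h2, h3 ▸ h4⟩
      · rintro ⟨⟨h1, h2⟩, h3, h4⟩; exact ⟨⟨⟨h1, h3⟩, h2.trans h4.symm⟩, h2⟩
    · intro q hq
      have := (Finset.mem_product.1 (Finset.mem_filter.1 hq).1).1
      exact Finset.mem_image_of_mem f this
  rw [h2]
  conv_lhs => rw [h1]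
  exact sq_sum_le_card_mul_sum_sq

/-- number of edges with few reachable end edges -/
lemma few_ends {Γ G : SimpleGraph (Fin n)} {D ρ t T : ℝ} {S : ℕ → Finset (Fin n)} {L s r : ℕ} (hG : G ≤ Γ)
    (ht : 0 ≤ t) (hT : 0 ≤ T) (hC : Chain G D ρ L s S) (hr : 2 ≤ r) (hL : r + 2 ≤ L) :
    (#{e ∈ S 0 ×ˢ S 1 | gd G S t (r + 2) 0 e.1 e.2 ∧ (#((PA G S t r 0 e.1 e.2).image
      (fun v => (v ⟨r, by omega⟩, v ⟨r + 1, by omega⟩))) : ℝ) < T} : ℝ) * t ^ (2 * r) ≤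
      T * #(P4set Γ (r + 2)) := by
  set en : (Fin (r + 2) → Fin n) → Fin n × Fin n := fun v => (v ⟨r, by omega⟩, v ⟨r + 1, by omega⟩) with hen
  set X := {e ∈ S 0 ×ˢ S 1 | gd G S t (r + 2) 0 e.1 e.2 ∧ (#((PA G S t r 0 e.1 e.2).image en) : ℝ) < T} with hX
  set Q : Fin n × Fin n → Finset ((Fin (r + 2) → Fin n) × (Fin (r + 2) → Fin n)) := fun e =>
    {q ∈ PA G S t r 0 e.1 e.2 ×ˢ PA G S t r 0 e.1 e.2 | en q.1 = en q.2} with hQ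
  have h1 : ∀ e ∈ X, t ^ (2 * r) ≤ T * #(Q e) := by
    intro e he
    obtain ⟨he1, he2, he3⟩ := Finset.mem_filter.1 he
    obtain ⟨he4, he5⟩ := Finset.mem_product.1 he1
    have a1 := PA_count ht r 0 e.1 e.2 he4 he5 he2
    have a2 := cs_fiber (PA G S t r 0 e.1 e.2) en
    have a2' : (#(PA G S t r 0 e.1 e.2) : ℝ) ^ 2 ≤ #((PA G S t r 0 e.1 e.2).image en) * #(Q e) := by
      exact_mod_cast a2
    calc t ^ (2 * r) = (t ^ r) ^ 2 := by rw [mul_comm, pow_mul]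
      _ ≤ (#(PA G S t r 0 e.1 e.2) : ℝ) ^ 2 := by gcongr
      _ ≤ _ := a2'
      _ ≤ _ := by gcongr
  have hsub : X.biUnion Q ⊆ P4set Γ (r + 2) := by
    intro q hq
    obtain ⟨e, he, hq⟩ := Finset.mem_biUnion.1 hq
    obtain ⟨hq1, hq2⟩ := Finset.mem_filter.1 hq
    obtain ⟨hq3, hq4⟩ := Finset.mem_product.1 hq1
    obtain ⟨-, v0, v1, vS, vP, -⟩ := Finset.mem_filter.1 hq3
    obtain ⟨-, w0, w1, wS, wP, -⟩ := Finset.mem_filter.1 hq4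
    have hdis : ∀ i k : Fin (r + 2), i ≠ k → ∀ a b, a ∈ S (0 + i.val) → b ∈ S (0 + k.val) → a ≠ b := by
      intro i k hik a b ha hb hab
      subst hab
      rw [zero_add] at ha hb
      exact Finset.disjoint_left.1 (hC.2.1 i.val (by omega) k.val (by omega)
        (fun h => hik (Fin.ext h))) ha hb
    refine Finset.mem_filter.2 ⟨Finset.mem_univ _, ⟨?_, ?_, ?_, ?_⟩, ?_, ?_⟩
    · intro i k h
      by_contra hik
      exact hdis i k hik _ _ (vS i) (vS k) h
    · intro i k h
      by_contra hik
      exact hdis i k hik _ _ (wS i) (wS k) h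
    · intro i k hik
      exact hdis i k hik _ _ (vS i) (wS k)
    · intro i hi
      have hcases : i = 0 ∨ i = 1 ∨ i = ⟨r, by omega⟩ ∨ i = ⟨r + 1, by omega⟩ := by
        have hi2 := i.2
        have : i.val = 0 ∨ i.val = 1 ∨ i.val = r ∨ i.val = r + 1 := by omega
        rcases this with h | h | h | h
        · left; exact Fin.ext h
        · right; left; exact Fin.ext (by rw [h]; simp)
        · right; right; left; exact Fin.ext h
        · right; right; right; exact Fin.ext h
      rcases hcases with h | h | h | h
      · rw [h, v0, w0]
      · rw [h, v1, w1]
      · rw [h]; exact congrArg Prod.fst hq2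
      · rw [h]; exact congrArg Prod.snd hq2
    · intro i k h; exact hG (vP i k h)
    · intro i k h; exact hG (wP i k h)
  have hcard := Finset.card_le_card hsub
  rw [Finset.card_biUnion] at hcard
  · calc (#X : ℝ) * t ^ (2 * r) = ∑ e ∈ X, t ^ (2 * r) := by rw [Finset.sum_const, nsmul_eq_mul]
      _ ≤ ∑ e ∈ X, T * #(Q e) := Finset.sum_le_sum h1
      _ = T * ((∑ e ∈ X, #(Q e) : ℕ) : ℝ) := by rw [← Finset.mul_sum]; push_cast; rfl
      _ ≤ _ := by gcongr
  · intro e _ e' _ hee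
    refine Finset.disjoint_left.2 ?_
    intro q hq hq'
    have a := (Finset.mem_product.1 (Finset.mem_filter.1 hq).1).1
    have a' := (Finset.mem_product.1 (Finset.mem_filter.1 hq').1).1
    obtain ⟨-, v0, v1, -⟩ := Finset.mem_filter.1 a
    obtain ⟨-, w0, w1, -⟩ := Finset.mem_filter.1 a'
    exact hee (Prod.ext (v0.symm.trans w0) (v1.symm.trans w1))

end good
end NS

namespace NS
open Classical Finset

section good2
variable {n : ℕ}

lemma star {Γ G : SimpleGraph (Fin n)} {p ηd c : ℝ} {s U : ℕ} (hG : G ≤ Γ) (hp : 0 < p)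
    (hD : Disc Γ p ηd U) {Fw Tw : Finset (Fin n)} (h1 : U ≤ #Fw) (h0 : 0 < #Fw)
    (h : ∀ z ∈ Fw, c * s * p ^ 2 ≤ (#{u ∈ Tw | G.Adj z u} : ℝ)) (hU : U < c / 4 * s * p) :
    c / 4 * s * p ≤ #Tw := by
  have hf : (0:ℝ) < #Fw := by exact_mod_cast h0
  have a1 : #Fw * (c * s * p ^ 2) ≤ eG Γ Fw Tw := by
    have : #Fw * (c * s * p ^ 2) ≤ eG G Fw Tw := by
      rw [eG_eq_sum_left]
      push_cast
      calc #Fw * (c * s * p ^ 2) = ∑ z ∈ Fw, (c * s * p ^ 2) := by rw [Finset.sum_const, nsmul_eq_mul]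
        _ ≤ _ := Finset.sum_le_sum h
    exact this.trans (by exact_mod_cast eG_mono_graph hG _ _)
  have a2 := disc_small hD hp h1 h0 a1 (by
    calc 4 * p * #Fw * U < 4 * p * #Fw * (c / 4 * s * p) := by gcongr
      _ = _ := by ring)
  have a3 : 4 * p * #Fw * (c / 4 * s * p) ≤ 4 * p * #Fw * #Tw := by
    calc 4 * p * #Fw * (c / 4 * s * p) = #Fw * (c * s * p ^ 2) := by ring
      _ ≤ _ := a2
  exact le_of_mul_le_mul_left a3 (by positivity)

lemma expand {Γ G : SimpleGraph (Fin n)} {p ηd c c' D ρ : ℝ} {s U L r : ℕ} (hG : G ≤ Γ) (hp : 0 < p) (hp1 : p ≤ 1)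
    (hs : 0 < s) (hc : 0 < c) (hc1 : c ≤ 1) (hc' : 0 < c') (hc1' : c' ≤ 1)
    (hD : Disc Γ p ηd U) {S : ℕ → Finset (Fin n)} (hC : Chain G D ρ L s S) (hL : r + 4 ≤ L)
    {F F1 F2 : Fin n → Fin n → Prop} (hU : U < c * c' / 64 * s * p)
    (hF : ∀ z ∈ S r, ∀ w ∈ S (r + 1), F z w → gd G S (c * s * p ^ 2) 2 r z w)
    (hF1 : ∀ z ∈ S r, ∀ w ∈ S (r + 1), ∀ u ∈ S (r + 2), F z w → G.Adj z u → gd G S (c * s * p ^ 2) 1 (r + 1) w u → F1 w u)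
    (hF1' : ∀ w u, F1 w u → gd G S (c * s * p ^ 2) 1 (r + 1) w u)
    (hF2 : ∀ w ∈ S (r + 1), ∀ u ∈ S (r + 2), ∀ v ∈ S (r + 3), F1 w u → G.Adj w v → G.Adj u v → F2 u v)
    (he : c' * s ^ 2 * p ≤ eR F (S r) (S (r + 1))) :
    c ^ 2 / 128 * s ^ 2 * p ≤ eR F2 (S (r + 2)) (S (r + 3)) := by
  have hsr : (0:ℝ) < s := by exact_mod_cast hs
  obtain ⟨hcard, hdis, -⟩ := hC
  have k0 := hcard r (by omega)
  have k1 := hcard (r + 1) (by omega)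
  have k2 := hcard (r + 2) (by omega)
  have k3 := hcard (r + 3) (by omega)
  have u1 : c * c' / 64 * s * p ≤ c' / 64 * s * p := by
    have : c * c' ≤ 1 * c' := by gcongr
    have h2 : c * c' * (s * p) ≤ 1 * c' * (s * p) := by gcongr
    linarith
  have u2 : c * c' / 64 * s * p ≤ c / 64 * s * p := by
    have h2 : c * c' * (s * p) ≤ c * 1 * (s * p) := by gcongr
    linarith
  have u3 : c' / 64 * s * p ≤ c' / 64 * s := by
    have : c' / 64 * s * p ≤ c' / 64 * s * 1 := by gcongr
    linarith
  have u4 : c / 64 * s * p ≤ c / 64 * s := by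
    have : c / 64 * s * p ≤ c / 64 * s * 1 := by gcongr
    linarith
  have v1 : 0 < c' * s := by positivity
  have v2 : 0 < c * s := by positivity
  have v3 : 0 < c' * s * p := by positivity
  have v4 : 0 < c * s * p := by positivity
  have v5 : c' * s ≤ 1 * s := by gcongr
  have v6 : 0 < c * c' * s * p := by positivity
  have hUs : U ≤ s := by
    have : (U:ℝ) ≤ s := by linarith
    exact_mod_cast this
  have hW := heavy (A := S r) (B := S (r + 1)) (F := F) (a := c') hD hp
    (fun x hx y hy h => hG (gd_adj (hF x hx y hy h))) (by omega) (by omega) (by rw [k1]; linarith)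
    (by rw [k0, k1]; linarith)
  rw [k0, k1] at hW
  set W := {w ∈ S (r + 1) | c' / 2 * p * s ≤ (#{z ∈ S r | F z w} : ℝ)} with hWd
  have hW0 : (0:ℝ) < #W := by linarith
  have hst1 : ∀ w ∈ W, c / 4 * s * p ≤ (#{u ∈ S (r + 2) | F1 w u} : ℝ) := by
    intro w hw
    obtain ⟨w1, w2⟩ := Finset.mem_filter.1 hw
    apply star (Fw := {z ∈ S r | F z w}) hG hp hD
    · have : (U:ℝ) ≤ #{z ∈ S r | F z w} := by linarith
      exact_mod_cast this
    · have : (0:ℝ) < #{z ∈ S r | F z w} := by linarith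
      exact_mod_cast this
    · intro z hz
      obtain ⟨z1, z2⟩ := Finset.mem_filter.1 hz
      refine (hF z z1 w w1 z2).2.trans ?_
      have : #{u ∈ S (r + 2) | G.Adj z u ∧ gd G S (c * s * p ^ 2) 1 (r + 1) w u} ≤
          #{u ∈ {u ∈ S (r + 2) | F1 w u} | G.Adj z u} := by
        apply Finset.card_le_card
        intro u hu
        obtain ⟨a1, a2, a3⟩ := Finset.mem_filter.1 hu
        exact Finset.mem_filter.2 ⟨Finset.mem_filter.2 ⟨a1, hF1 z z1 w w1 u a1 z2 a2 a3⟩, a2⟩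
      exact_mod_cast this
    · linarith
  have hWs : W ⊆ S (r + 1) := Finset.filter_subset _ _
  have he1 : c / 4 * p * #W * #(S (r + 2)) ≤ eR F1 W (S (r + 2)) := by
    rw [eR_left, k2]
    push_cast
    calc c / 4 * p * #W * s = ∑ w ∈ W, c / 4 * s * p := by rw [Finset.sum_const, nsmul_eq_mul]; ring
      _ ≤ _ := Finset.sum_le_sum hst1
  have hY := heavy (A := W) (B := S (r + 2)) (F := F1) (a := c / 4) hD hp
    (fun x hx y hy h => hG (gd_adj (hF1' x y h))) (by exact_mod_cast hW0) (by
      have : (U:ℝ) ≤ #W := by linarith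
      exact_mod_cast this) (by rw [k2]; linarith) he1
  rw [k2] at hY
  set Y := {u ∈ S (r + 2) | c / 4 / 2 * p * #W ≤ (#{w ∈ W | F1 w u} : ℝ)} with hYd
  have hst2 : ∀ u ∈ Y, c / 4 * s * p ≤ (#{v ∈ S (r + 3) | F2 u v} : ℝ) := by
    intro u hu
    obtain ⟨w1, w2⟩ := Finset.mem_filter.1 hu
    have w3 : c / 4 / 2 * p * (c' / 8 * s) ≤ c / 4 / 2 * p * #W := by gcongr
    apply star (Fw := {w ∈ W | F1 w u}) hG hp hD
    · have : (U:ℝ) ≤ #{w ∈ W | F1 w u} := by linarith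
      exact_mod_cast this
    · have : (0:ℝ) < #{w ∈ W | F1 w u} := by linarith
      exact_mod_cast this
    · intro z hz
      obtain ⟨z1, z2⟩ := Finset.mem_filter.1 hz
      refine (hF1' z u z2).2.trans ?_
      have : #{v ∈ S (r + 1 + 2) | G.Adj z v ∧ gd G S (c * s * p ^ 2) 0 (r + 1 + 1) u v} ≤
          #{v ∈ {v ∈ S (r + 3) | F2 u v} | G.Adj z v} := by
        apply Finset.card_le_card
        intro v hv
        obtain ⟨a1, a2, a3⟩ := Finset.mem_filter.1 hv
        exact Finset.mem_filter.2 ⟨Finset.mem_filter.2 ⟨a1, hF2 z (hWs z1) u w1 v a1 z2 a2 a3⟩, a2⟩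
      exact_mod_cast this
    · linarith
  rw [eR_left]
  push_cast
  calc c ^ 2 / 128 * s ^ 2 * p = (c / 4 / 8 * s) * (c / 4 * s * p) := by ring
    _ ≤ #Y * (c / 4 * s * p) := by gcongr
    _ = ∑ u ∈ Y, c / 4 * s * p := by rw [Finset.sum_const, nsmul_eq_mul]
    _ ≤ ∑ u ∈ Y, (#{v ∈ S (r + 3) | F2 u v} : ℝ) := Finset.sum_le_sum hst2
    _ ≤ _ := Finset.sum_le_sum_of_subset_of_nonneg (Finset.filter_subset _ _) (fun _ _ _ => by positivity)

/-- squared path through the sets `S 0, …, S (L-1)` -/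
def SP (G : SimpleGraph (Fin n)) (S : ℕ → Finset (Fin n)) (L : ℕ) (v : ℕ → Fin n) : Prop :=
  (∀ i < L, v i ∈ S i) ∧ ∀ i j, i < j → j ≤ i + 2 → j < L → G.Adj (v i) (v j)

def Rch (G : SimpleGraph (Fin n)) (S : ℕ → Finset (Fin n)) (r : ℕ) (x y z w : Fin n) : Prop :=
  ∃ v, SP G S (r + 2) v ∧ v 0 = x ∧ v 1 = y ∧ v r = z ∧ v (r + 1) = w

lemma Rch_adj {G : SimpleGraph (Fin n)} {S : ℕ → Finset (Fin n)} {r : ℕ} {x y z w : Fin n}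
    (h : Rch G S r x y z w) : G.Adj z w := by
  obtain ⟨v, hv, -, -, h1, h2⟩ := h
  rw [← h1, ← h2]
  exact hv.2 r (r + 1) (by omega) (by omega) (by omega)

lemma Rch_succ {G : SimpleGraph (Fin n)} {S : ℕ → Finset (Fin n)} {r : ℕ} {x y z w u : Fin n}
    (h : Rch G S r x y z w) (hu : u ∈ S (r + 2)) (h1 : G.Adj z u) (h2 : G.Adj w u) : Rch G S (r + 1) x y w u := by
  obtain ⟨v, hv, v0, v1, vr, vr1⟩ := h
  refine ⟨Function.update v (r + 2) u, ⟨?_, ?_⟩, ?_, ?_, ?_, ?_⟩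
  · intro i hi
    by_cases h : i = r + 2
    · subst h; rw [Function.update_self]; exact hu
    · rw [Function.update_of_ne h]; exact hv.1 i (by omega)
  · intro i j hij hj hjl
    rw [Function.update_of_ne (by omega : i ≠ r + 2)]
    by_cases h : j = r + 2
    · subst h; rw [Function.update_self]
      have : i = r ∨ i = r + 1 := by omega
      rcases this with rfl | rfl
      · rw [vr]; exact h1
      · rw [vr1]; exact h2
    · rw [Function.update_of_ne h]; exact hv.2 i j hij hj (by omega)
  · rw [Function.update_of_ne (by omega)]; exact v0
  · rw [Function.update_of_ne (by omega)]; exact v1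
  · rw [Function.update_of_ne (by omega)]; exact vr1
  · rw [Function.update_self]

lemma Rch_of_PA {G : SimpleGraph (Fin n)} {S : ℕ → Finset (Fin n)} {t : ℝ} {r : ℕ} {x y : Fin n}
    {v : Fin (r + 2) → Fin n} (h : v ∈ PA G S t r 0 x y) :
    Rch G S r x y (v ⟨r, by omega⟩) (v ⟨r + 1, by omega⟩) := by
  obtain ⟨-, v0, v1, vS, vP, -⟩ := Finset.mem_filter.1 h
  refine ⟨fun i => if h : i < r + 2 then v ⟨i, h⟩ else x, ⟨?_, ?_⟩, ?_, ?_, ?_, ?_⟩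
  · intro i hi
    simp only [dif_pos hi]
    have := vS ⟨i, hi⟩
    simpa using this
  · intro i j hij hj hjl
    have hi : i < r + 2 := by omega
    simp only [dif_pos hi, dif_pos hjl]
    exact vP _ _ ⟨hij, hj⟩
  · simp only [dif_pos (show 0 < r + 2 by omega)]; exact v0
  · simp only [dif_pos (show 1 < r + 2 by omega)]; exact v1
  · simp
  · simp

lemma eR_le_add {F F' : Fin n → Fin n → Prop} {A B : Finset (Fin n)} (X : Finset (Fin n × Fin n))
    (h : ∀ e : Fin n × Fin n, e ∈ A ×ˢ B → F e.1 e.2 → F' e.1 e.2 ∨ e ∈ X) : eR F A B ≤ eR F' A B + #X := by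
  unfold eR
  refine le_trans (Finset.card_le_card ?_) (Finset.card_union_le _ _)
  intro e he
  obtain ⟨h1, h2⟩ := Finset.mem_filter.1 he
  rw [Finset.mem_union]
  rcases h e h1 h2 with h3 | h3
  · left; exact Finset.mem_filter.2 ⟨h1, h3⟩
  · right; exact h3

lemma good {Γ G : SimpleGraph (Fin n)} {p κ η σ ηd δ K M c c' : ℝ} {s U r : ℕ} (hG : G ≤ Γ)
    (hp : 0 < p) (hp1 : p ≤ 1) (hκ : 0 < κ) (hη : 0 < η) (hη1 : η ≤ 1) (hσ : 0 < σ) (hσ1 : σ ^ 2 ≤ η) (hs : 0 < s) (hκ1 : κ ≤ 1)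
    (hδ : 0 < δ) (hr : 2 ≤ r)
    (hD : Disc Γ p ηd U) (hI : Inh Γ p κ η σ s) {S : ℕ → Finset (Fin n)}
    (hC : Chain G (κ * p) (σ ^ 2 * s) (r + 4) s S) (c2 : η ≤ δ / 2 * (κ / 32) ^ (r + 2) / 64) (c3 : η ≤ κ / 2)
    (hcd : c = κ * σ ^ 2 * η / 8) (hc' : 0 < c') (hc1' : c' ≤ 1) (hM : 0 < M) (hK : 0 < K) (hnK : (n : ℝ) ≤ K * s)
    (hcM : c' * M * K ^ (2 * r) ≤ δ / 2 * c ^ (2 * r))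
    (hP : (#(P4set Γ (r + 2)) : ℝ) ≤ M * ((n : ℝ) ^ (2 * r) * p ^ (4 * r)))
    (hU : U < c * c' / 64 * s * p) :
    (eR (fun x y => G.Adj x y ∧ (eR (Rch G S (r + 2) x y) (S (r + 2)) (S (r + 3)) : ℝ) < c ^ 2 / 128 * s ^ 2 * p)
      (S 0) (S 1) : ℝ) ≤ δ * s ^ 2 * p := by
  have hsr : (0:ℝ) < s := by exact_mod_cast hs
  have hc : 0 < c := by rw [hcd]; positivity
  have hcη : c ≤ η / 8 := by
    rw [hcd]
    have : κ * σ ^ 2 * η ≤ 1 * 1 * η := by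
      have := hσ1.trans hη1
      gcongr
    linarith
  have hUη : (U:ℝ) < η * s := by
    have : c * c' / 64 * s * p ≤ η * 1 / 64 * s * 1 := by
      have : c ≤ η := by linarith
      gcongr
    have : 0 < η * s := by positivity
    linarith
  have hUs : U ≤ s := by
    have : η * (s:ℝ) ≤ 1 * s := by gcongr
    have : (U:ℝ) ≤ s := by linarith
    exact_mod_cast this
  set t := c * s * p ^ 2 with ht
  have ht0 : 0 < t := by positivity
  have hb := gd_bound hG hp hκ hη hσ hσ1 hs hκ1 (by positivity : 0 < δ / 2) hD hI hC c2 c3 hUs hUη (r + 2) 0 le_rfl (by omega)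
  rw [← hcd, ← ht, Nat.sub_self, pow_zero, mul_one, zero_add] at hb
  have hf := few_ends (T := c' * s ^ 2 * p) hG ht0.le (by positivity) hC hr (by omega)
  set X : Finset (Fin n × Fin n) := {e ∈ S 0 ×ˢ S 1 | gd G S t (r + 2) 0 e.1 e.2 ∧ (#((PA G S t r 0 e.1 e.2).image
      (fun v => (v ⟨r, by omega⟩, v ⟨r + 1, by omega⟩))) : ℝ) < c' * s ^ 2 * p} with hX
  have hXc : (#X : ℝ) ≤ δ / 2 * s ^ 2 * p := by
    have h1 : (#X : ℝ) * t ^ (2 * r) ≤ (δ / 2 * s ^ 2 * p) * t ^ (2 * r) := by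
      calc (#X : ℝ) * t ^ (2 * r) ≤ c' * s ^ 2 * p * #(P4set Γ (r + 2)) := hf
        _ ≤ c' * s ^ 2 * p * (M * ((n : ℝ) ^ (2 * r) * p ^ (4 * r))) := by gcongr
        _ ≤ c' * s ^ 2 * p * (M * ((K * s) ^ (2 * r) * p ^ (4 * r))) := by gcongr
        _ = (c' * M * K ^ (2 * r)) * (s ^ 2 * p * s ^ (2 * r) * p ^ (4 * r)) := by rw [mul_pow]; ring
        _ ≤ (δ / 2 * c ^ (2 * r)) * (s ^ 2 * p * s ^ (2 * r) * p ^ (4 * r)) := by gcongr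
        _ = _ := by
          rw [ht, mul_pow, mul_pow, ← pow_mul, show 2 * (2 * r) = 4 * r by ring]; ring
    exact le_of_mul_le_mul_right h1 (by positivity)
  have hsub : (eR (fun x y => G.Adj x y ∧ (eR (Rch G S (r + 2) x y) (S (r + 2)) (S (r + 3)) : ℝ) < c ^ 2 / 128 * s ^ 2 * p)
      (S 0) (S 1)) ≤ eR (fun x y => G.Adj x y ∧ ¬ gd G S t (r + 2) 0 x y) (S 0) (S 1) + #X := by
    apply eR_le_add
    rintro e he1 ⟨he2, he3⟩
    by_cases hg : gd G S t (r + 2) 0 e.1 e.2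
    · right
      refine Finset.mem_filter.2 ⟨he1, hg, ?_⟩
      by_contra hcon
      rw [not_lt] at hcon
      set en : (Fin (r + 2) → Fin n) → Fin n × Fin n := fun v => (v ⟨r, by omega⟩, v ⟨r + 1, by omega⟩) with hen
      obtain ⟨F, hFd⟩ : ∃ F : Fin n → Fin n → Prop, ∀ z w, F z w ↔ (z, w) ∈ (PA G S t r 0 e.1 e.2).image en :=
        ⟨_, fun _ _ => Iff.rfl⟩
      have hFR : ∀ z w, F z w → Rch G S r e.1 e.2 z w ∧ gd G S t 2 r z w ∧ z ∈ S r ∧ w ∈ S (r + 1) := by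
        intro z w h
        obtain ⟨v, hv, hvw⟩ := Finset.mem_image.1 ((hFd z w).1 h)
        have e1 : v ⟨r, by omega⟩ = z := congrArg Prod.fst hvw
        have e2 : v ⟨r + 1, by omega⟩ = w := congrArg Prod.snd hvw
        have h1 := Rch_of_PA hv
        obtain ⟨-, v0, v1, vS, vP, vg⟩ := Finset.mem_filter.1 hv
        have s1 := vS ⟨r, by omega⟩
        have s2 := vS ⟨r + 1, by omega⟩
        simp only [zero_add] at s1 s2 vg
        rw [e1] at h1 s1 vg
        rw [e2] at h1 s2 vg
        exact ⟨h1, vg, s1, s2⟩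
      have hFe : c' * s ^ 2 * p ≤ eR F (S r) (S (r + 1)) := by
        refine hcon.trans ?_
        have : #((PA G S t r 0 e.1 e.2).image en) ≤ eR F (S r) (S (r + 1)) := by
          unfold eR
          apply Finset.card_le_card
          intro q hq
          have hF : F q.1 q.2 := (hFd _ _).2 hq
          obtain ⟨-, -, a, b⟩ := hFR _ _ hF
          exact Finset.mem_filter.2 ⟨Finset.mem_product.2 ⟨a, b⟩, hF⟩
        exact_mod_cast this
      have hex := expand (r := r) (F := F) (F1 := fun w u => Rch G S (r + 1) e.1 e.2 w u ∧ gd G S t 1 (r + 1) w u)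
        (F2 := Rch G S (r + 2) e.1 e.2) hG hp hp1 hs hc (by linarith) hc' hc1' hD hC le_rfl hU
        (fun z _ w _ h => (hFR z w h).2.1)
        (fun z _ w _ u hu h hz hg => ⟨Rch_succ (hFR z w h).1 hu hz (gd_adj hg), hg⟩)
        (fun w u h => h.2)
        (fun w _ u _ v hv h h1 h2 => Rch_succ h.1 hv h1 h2) hFe
      linarith
    · left
      exact ⟨he2, hg⟩
  have hsub' : (eR (fun x y => G.Adj x y ∧ (eR (Rch G S (r + 2) x y) (S (r + 2)) (S (r + 3)) : ℝ) < c ^ 2 / 128 * s ^ 2 * p)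
      (S 0) (S 1) : ℝ) ≤ eR (fun x y => G.Adj x y ∧ ¬ gd G S t (r + 2) 0 x y) (S 0) (S 1) + #X := by exact_mod_cast hsub
  linarith

end good2
end NS

namespace NS
open Classical Finset

section emb
variable {n : ℕ}

lemma eR_or {F F1 F2 : Fin n → Fin n → Prop} {A B : Finset (Fin n)} (h : ∀ x ∈ A, ∀ y ∈ B, F x y → F1 x y ∨ F2 x y) :
    eR F A B ≤ eR F1 A B + eR F2 A B := by
  unfold eR
  refine le_trans (Finset.card_le_card ?_) (Finset.card_union_le _ _)
  intro e he
  obtain ⟨h1, h2⟩ := Finset.mem_filter.1 he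
  obtain ⟨h3, h4⟩ := Finset.mem_product.1 h1
  rw [Finset.mem_union]
  rcases h _ h3 _ h4 h2 with h5 | h5
  · left; exact Finset.mem_filter.2 ⟨h1, h5⟩
  · right; exact Finset.mem_filter.2 ⟨h1, h5⟩

lemma eR_pos {F : Fin n → Fin n → Prop} {A B : Finset (Fin n)} (h : 0 < eR F A B) : ∃ x ∈ A, ∃ y ∈ B, F x y := by
  unfold eR at h
  obtain ⟨e, he⟩ := Finset.card_pos.1 h
  obtain ⟨h1, h2⟩ := Finset.mem_filter.1 he
  obtain ⟨h3, h4⟩ := Finset.mem_product.1 h1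
  exact ⟨_, h3, _, h4, h2⟩

/-- abstract embedding context -/
structure Emb (G : SimpleGraph (Fin n)) (U : ℕ → Finset (Fin n)) (M r s : ℕ) (ρ D a b d : ℝ) : Prop where
  per : ∀ j, U (j + M) = U j
  dis : ∀ j k, U j = U k ∨ Disjoint (U j) (U k)
  room : ∀ j, #{k ∈ range M | U k = U j} + 3 * ((r + 4) * s) ≤ #(U j)
  lr : ∀ j k, j < k → k ≤ j + 2 → ∀ X ⊆ U j, ∀ Y ⊆ U k, #X = s → #Y = s → LR G X Y ρ D
  edge : ∀ X Y : Finset (Fin n), #X = s → #Y = s → LR G X Y ρ D → b ≤ eR G.Adj X Y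
  good : ∀ S : ℕ → Finset (Fin n), Chain G D ρ (r + 4) s S →
    (eR (fun x y => G.Adj x y ∧ (eR (Rch G S (r + 2) x y) (S (r + 2)) (S (r + 3)) : ℝ) < a) (S 0) (S 1) : ℝ) ≤ d
  conn : ∀ W0 W1 W2 W3 : Finset (Fin n), #W0 = s → #W1 = s → #W2 = s → #W3 = s → Disjoint W0 W1 → Disjoint W0 W2 →
    Disjoint W1 W2 → Disjoint W1 W3 → Disjoint W2 W3 → LR G W0 W2 ρ D → LR G W1 W2 ρ D → LR G W1 W3 ρ D →
    ∀ F H : Fin n → Fin n → Prop, (∀ x ∈ W0, ∀ y ∈ W1, F x y → G.Adj x y) → (∀ x ∈ W2, ∀ y ∈ W3, H x y → G.Adj x y) →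
    a ≤ eR F W0 W1 → a ≤ eR H W2 W3 →
    ∃ x ∈ W0, ∃ y ∈ W1, ∃ z ∈ W2, ∃ w ∈ W3, F x y ∧ H z w ∧ G.Adj x z ∧ G.Adj y z ∧ G.Adj y w
  apos : 0 ≤ a
  sum : a + 2 * d < b

lemma pick {s : ℕ} (U : ℕ → Finset (Fin n)) (Z : Finset (Fin n)) (L : ℕ)
    (h : ∀ j, #(U j ∩ Z) + L * s ≤ #(U j)) :
    ∃ S : ℕ → Finset (Fin n), (∀ j < L, #(S j) = s) ∧ (∀ j < L, S j ⊆ U j) ∧ (∀ j < L, Disjoint (S j) Z) ∧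
      ∀ j < L, ∀ k < L, j ≠ k → Disjoint (S j) (S k) := by
  induction L with
  | zero => exact ⟨fun _ => ∅, by simp, by simp, by simp, by simp⟩
  | succ L ih =>
    obtain ⟨S, h1, h2, h3, h4⟩ := ih (fun j => by have := h j; rw [Nat.succ_mul] at this; omega)
    set Y := (range L).biUnion S with hY
    have hYc : #Y ≤ L * s := by
      calc #Y ≤ ∑ j ∈ range L, #(S j) := Finset.card_biUnion_le
        _ = ∑ j ∈ range L, s := Finset.sum_congr rfl (fun j hj => h1 j (Finset.mem_range.1 hj))
        _ = L * s := by simp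
    have hc : s ≤ #((U L \ Z) \ Y) := by
      have e1 : #(U L ∩ Z) + #(U L \ Z) = #(U L) := Finset.card_inter_add_card_sdiff _ _
      have e2 := Finset.le_card_sdiff Y (U L \ Z)
      have e3 := h L
      rw [Nat.succ_mul] at e3
      omega
    obtain ⟨X, hX, hXs⟩ := Finset.exists_subset_card_eq hc
    have hXY : Disjoint X Y := Finset.disjoint_left.2 fun x hx => (Finset.mem_sdiff.1 (hX hx)).2
    have hXS : ∀ j < L, Disjoint X (S j) := fun j hj =>
      hXY.mono_right (Finset.subset_biUnion_of_mem S (Finset.mem_range.2 hj))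
    have key : ∀ j < L + 1, j ≠ L → j < L := fun j hj h => by omega
    refine ⟨Function.update S L X, ?_, ?_, ?_, ?_⟩
    · intro j hj
      by_cases e : j = L
      · subst e; rw [Function.update_self]; exact hXs
      · rw [Function.update_of_ne e]; exact h1 j (key j hj e)
    · intro j hj
      by_cases e : j = L
      · subst e; rw [Function.update_self]
        exact fun x hx => (Finset.mem_sdiff.1 (Finset.mem_sdiff.1 (hX hx)).1).1
      · rw [Function.update_of_ne e]; exact h2 j (key j hj e)
    · intro j hj
      by_cases e : j = L
      · subst e; rw [Function.update_self]
        exact Finset.disjoint_left.2 fun x hx => (Finset.mem_sdiff.1 (Finset.mem_sdiff.1 (hX hx)).1).2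
      · rw [Function.update_of_ne e]; exact h3 j (key j hj e)
    · intro j hj k hk hjk
      by_cases e : j = L
      · subst e
        rw [Function.update_self, Function.update_of_ne (Ne.symm hjk)]
        exact hXS k (key k hk (Ne.symm hjk))
      · rw [Function.update_of_ne e]
        by_cases e' : k = L
        · subst e'; rw [Function.update_self]; exact (hXS j (key j hj e)).symm
        · rw [Function.update_of_ne e']; exact h4 j (key j hj e) k (key k hk e') hjk

def Pth (G : SimpleGraph (Fin n)) (U : ℕ → Finset (Fin n)) (Z : Finset (Fin n)) (N : ℕ) (w : ℕ → Fin n) : Prop :=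
  (∀ a b, a < b → b < N → w a ≠ w b) ∧ (∀ a < N, w a ∈ U a ∧ w a ∉ Z) ∧
    ∀ a b, a < b → b ≤ a + 2 → b < N → G.Adj (w a) (w b)

lemma Pth.snoc {G : SimpleGraph (Fin n)} {U : ℕ → Finset (Fin n)} {Z : Finset (Fin n)} {N : ℕ} {w : ℕ → Fin n}
    (h : Pth G U Z (N + 2) w) {x : Fin n} (h1 : x ∈ U (N + 2)) (h2 : x ∉ Z) (h3 : ∀ a < N + 2, w a ≠ x)
    (h4 : G.Adj (w N) x) (h5 : G.Adj (w (N + 1)) x) : Pth G U Z (N + 3) (Function.update w (N + 2) x) := by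
  obtain ⟨p1, p2, p3⟩ := h
  refine ⟨?_, ?_, ?_⟩
  · intro a b hab hb
    rw [Function.update_of_ne (by omega : a ≠ N + 2)]
    by_cases e : b = N + 2
    · subst e; rw [Function.update_self]; exact h3 a hab
    · rw [Function.update_of_ne e]; exact p1 a b hab (by omega)
  · intro a ha
    by_cases e : a = N + 2
    · subst e; rw [Function.update_self]; exact ⟨h1, h2⟩
    · rw [Function.update_of_ne e]; exact p2 a (by omega)
  · intro a b hab hb2 hb
    rw [Function.update_of_ne (by omega : a ≠ N + 2)]
    by_cases e : b = N + 2
    · subst e; rw [Function.update_self]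
      have : a = N ∨ a = N + 1 := by omega
      rcases this with rfl | rfl
      · exact h4
      · exact h5
    · rw [Function.update_of_ne e]; exact p3 a b hab hb2 (by omega)

/-- the state after `t` blocks of length `L = r+4` -/
def St (G : SimpleGraph (Fin n)) (U : ℕ → Finset (Fin n)) (Z : Finset (Fin n)) (r s : ℕ) (ρ D a : ℝ) (N : ℕ)
    (w : ℕ → Fin n) (S : ℕ → Finset (Fin n)) : Prop :=
  Pth G U Z (N + 2) w ∧ Chain G D ρ (r + 4) s S ∧ (∀ j < r + 4, S j ⊆ U (N + j)) ∧
  (∀ j < r + 4, Disjoint (S j) Z) ∧ (∀ k < N, ∀ j < r + 4, w k ∉ S j) ∧ w N ∈ S 0 ∧ w (N + 1) ∈ S 1 ∧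
  a ≤ (eR (Rch G S (r + 2) (w N) (w (N + 1))) (S (r + 2)) (S (r + 3)) : ℝ)

lemma St.ext {G : SimpleGraph (Fin n)} {U : ℕ → Finset (Fin n)} {Z : Finset (Fin n)} {r s N : ℕ} {ρ D a : ℝ}
    {w v : ℕ → Fin n} {S : ℕ → Finset (Fin n)} (h : St G U Z r s ρ D a N w S) (hv : SP G S (r + 4) v)
    (v0 : v 0 = w N) (v1 : v 1 = w (N + 1)) :
    ∃ w', Pth G U Z (N + (r + 4)) w' ∧ (∀ k < N + 2, w' k = w k) ∧ ∀ j < r + 4, w' (N + j) = v j := by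
  obtain ⟨⟨p1, p2, p3⟩, hC, hU, hZ, hw, -, -, -⟩ := h
  have E1 : ∀ k < N, (if k < N then w k else v (k - N)) = w k := fun k hk => if_pos hk
  have E2 : ∀ k, N ≤ k → (if k < N then w k else v (k - N)) = v (k - N) := fun k hk => if_neg (by omega)
  have E3 : ∀ k < N + 2, (if k < N then w k else v (k - N)) = w k := by
    intro k hk
    by_cases h : k < N
    · exact E1 k h
    · rw [E2 k (by omega)]
      have : k = N ∨ k = N + 1 := by omega
      rcases this with rfl | rfl
      · rw [Nat.sub_self]; exact v0
      · rw [Nat.add_sub_cancel_left]; exact v1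
  refine ⟨fun k => if k < N then w k else v (k - N), ⟨?_, ?_, ?_⟩, E3, ?_⟩
  · intro a b hab hb
    show (if a < N then w a else v (a - N)) ≠ (if b < N then w b else v (b - N))
    by_cases hb' : b < N
    · rw [E1 a (by omega), E1 b hb']; exact p1 a b hab (by omega)
    · rw [E2 b (by omega)]
      have hvb := hv.1 (b - N) (by omega)
      by_cases ha : a < N
      · rw [E1 a ha]
        intro h; rw [← h] at hvb
        exact hw a ha _ (by omega) hvb
      · rw [E2 a (by omega)]
        intro h
        have hva := hv.1 (a - N) (by omega)
        rw [h] at hva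
        exact Finset.disjoint_left.1 (hC.2.1 (a - N) (by omega) (b - N) (by omega) (by omega)) hva hvb
  · intro a ha
    show (if a < N then w a else v (a - N)) ∈ U a ∧ (if a < N then w a else v (a - N)) ∉ Z
    by_cases h : a < N
    · rw [E1 a h]; exact p2 a (by omega)
    · rw [E2 a (by omega)]
      have hva := hv.1 (a - N) (by omega)
      refine ⟨?_, Finset.disjoint_left.1 (hZ (a - N) (by omega)) hva⟩
      have := hU (a - N) (by omega) hva
      rwa [Nat.add_sub_cancel' (by omega : N ≤ a)] at this
  · intro a b hab hb2 hb
    show G.Adj (if a < N then w a else v (a - N)) (if b < N then w b else v (b - N))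
    by_cases ha : a < N
    · rw [E1 a ha, E3 b (by omega)]; exact p3 a b hab hb2 (by omega)
    · rw [E2 a (by omega), E2 b (by omega)]; exact hv.2 _ _ (by omega) (by omega) (by omega)
  · intro j hj
    show (if N + j < N then w (N + j) else v (N + j - N)) = v j
    rw [E2 _ (by omega), Nat.add_sub_cancel_left]

lemma Emb.chain {G : SimpleGraph (Fin n)} {U : ℕ → Finset (Fin n)} {M r s : ℕ} {ρ D a b d : ℝ}
    (E : Emb G U M r s ρ D a b d) (N : ℕ) {S : ℕ → Finset (Fin n)} (h1 : ∀ j < r + 4, #(S j) = s)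
    (h2 : ∀ j < r + 4, S j ⊆ U (N + j)) (h4 : ∀ j < r + 4, ∀ k < r + 4, j ≠ k → Disjoint (S j) (S k)) :
    Chain G D ρ (r + 4) s S := by
  refine ⟨h1, h4, ?_⟩
  intro i j hij hj hjl
  exact E.lr (N + i) (N + j) (by omega) (by omega) _ (h2 i (by omega)) _ (h2 j hjl) (h1 i (by omega)) (h1 j hjl)

lemma Emb.used {G : SimpleGraph (Fin n)} {U : ℕ → Finset (Fin n)} {M r s : ℕ} {ρ D a b d : ℝ}
    (E : Emb G U M r s ρ D a b d) {Z Y : Finset (Fin n)} {N : ℕ} {w : ℕ → Fin n} (hw : ∀ k < N, w k ∈ U k) (hN : N ≤ M)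
    (hZ : #Z ≤ 2 * ((r + 4) * s)) (j : ℕ) :
    #(U j ∩ (Z ∪ (range N).image w)) + (r + 4) * s ≤ #(U j) := by
  have h1 : U j ∩ (Z ∪ (range N).image w) ⊆ Z ∪ ({k ∈ range M | U k = U j} : Finset ℕ).image w := by
    intro x hx
    obtain ⟨hx1, hx2⟩ := Finset.mem_inter.1 hx
    rcases Finset.mem_union.1 hx2 with hx3 | hx3
    · exact Finset.mem_union_left _ hx3
    · apply Finset.mem_union_right
      obtain ⟨k, hk, rfl⟩ := Finset.mem_image.1 hx3
      have hk := Finset.mem_range.1 hk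
      refine Finset.mem_image_of_mem _ (Finset.mem_filter.2 ⟨Finset.mem_range.2 (by omega), ?_⟩)
      rcases E.dis k j with h | h
      · exact h
      · exact absurd hx1 (Finset.disjoint_left.1 h (hw k hk))
  have h2 := (Finset.card_le_card h1).trans (Finset.card_union_le _ _)
  have h3 : #(({k ∈ range M | U k = U j} : Finset ℕ).image w) ≤ #({k ∈ range M | U k = U j} : Finset ℕ) := Finset.card_image_le
  have h4 := E.room j
  omega

lemma St.step {G : SimpleGraph (Fin n)} {U : ℕ → Finset (Fin n)} {M r s : ℕ} {ρ D a b d : ℝ}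
    (E : Emb G U M r s ρ D a b d) {Z : Finset (Fin n)} (hZc : #Z ≤ (r + 4) * s) {N : ℕ} {w : ℕ → Fin n} {S : ℕ → Finset (Fin n)}
    (h : St G U Z r s ρ D a N w S) (hN : N + 2 ≤ M) :
    ∃ w' S', St G U Z r s ρ D a (N + (r + 4)) w' S' ∧ w' 0 = w 0 ∧ w' 1 = w 1 := by
  have h' := h
  obtain ⟨hp, hC, hU, hZ, hw, w0, w1, hR⟩ := h'
  set Y := Z ∪ (range (r + 4)).biUnion S with hY
  have hYc : #Y ≤ 2 * ((r + 4) * s) := by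
    have : #((range (r + 4)).biUnion S) ≤ (r + 4) * s := by
      calc #((range (r + 4)).biUnion S) ≤ ∑ j ∈ range (r + 4), #(S j) := Finset.card_biUnion_le
        _ = ∑ j ∈ range (r + 4), s := Finset.sum_congr rfl (fun j hj => hC.1 j (Finset.mem_range.1 hj))
        _ = (r + 4) * s := by simp
    have h2 : #Y ≤ #Z + #((range (r + 4)).biUnion S) := Finset.card_union_le Z ((range (r + 4)).biUnion S)
    omega
  obtain ⟨S', c1, c2, c3, c4⟩ := pick (fun j => U (N + (r + 4) + j)) (Y ∪ (range (N + 2)).image w) (r + 4)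
    (fun j => E.used (Y := ∅) (fun k hk => (hp.2.1 k hk).1) hN hYc _)
  have hC' := E.chain _ c1 c2 c4
  have cZ : ∀ j < r + 4, Disjoint (S' j) Z := fun j hj =>
    (c3 j hj).mono_right (Finset.subset_union_left.trans Finset.subset_union_left)
  have cS : ∀ j < r + 4, ∀ k < r + 4, Disjoint (S' j) (S k) := fun j hj k hk =>
    (c3 j hj).mono_right ((Finset.subset_biUnion_of_mem S (Finset.mem_range.2 hk)).trans
      (Finset.subset_union_right.trans Finset.subset_union_left))
  have cw : ∀ j < r + 4, ∀ k < N + 2, w k ∉ S' j := fun j hj k hk hx =>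
    Finset.disjoint_left.1 (c3 j hj) hx (Finset.mem_union_right _ (Finset.mem_image_of_mem _ (Finset.mem_range.2 hk)))
  obtain ⟨H, hH⟩ : ∃ H : Fin n → Fin n → Prop, ∀ x y, H x y ↔
    (G.Adj x y ∧ a ≤ (eR (Rch G S' (r + 2) x y) (S' (r + 2)) (S' (r + 3)) : ℝ)) := ⟨_, fun _ _ => Iff.rfl⟩
  have hHe : a ≤ eR H (S' 0) (S' 1) := by
    have g1 := E.good S' hC'
    have g2 := E.edge _ _ (c1 0 (by omega)) (c1 1 (by omega)) (hC'.2.2 0 1 (by omega) (by omega) (by omega))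
    have g3 : eR G.Adj (S' 0) (S' 1) ≤ eR H (S' 0) (S' 1) +
      eR (fun x y => G.Adj x y ∧ (eR (Rch G S' (r + 2) x y) (S' (r + 2)) (S' (r + 3)) : ℝ) < a) (S' 0) (S' 1) := by
      apply eR_or
      intro x _ y _ hxy
      by_cases hh : a ≤ (eR (Rch G S' (r + 2) x y) (S' (r + 2)) (S' (r + 3)) : ℝ)
      · left; exact (hH x y).2 ⟨hxy, hh⟩
      · right; exact ⟨hxy, not_le.1 hh⟩
    have g4 : (eR G.Adj (S' 0) (S' 1) : ℝ) ≤ eR H (S' 0) (S' 1) +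
      eR (fun x y => G.Adj x y ∧ (eR (Rch G S' (r + 2) x y) (S' (r + 2)) (S' (r + 3)) : ℝ) < a) (S' 0) (S' 1) := by
      exact_mod_cast g3
    have g5 := E.sum
    have g6 : 0 ≤ d := le_trans (by positivity) g1
    linarith
  have lrx : ∀ j < r + 4, ∀ k < r + 4, j < k + (r + 4) → k + (r + 4) ≤ j + 2 → LR G (S j) (S' k) ρ D := by
    intro j hj k hk h1 h2
    exact E.lr (N + j) (N + (r + 4) + k) (by omega) (by omega) _ (hU j hj) _ (c2 k hk) (hC.1 j hj) (c1 k hk)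
  obtain ⟨x, hx, y, hy, z, hz, u, hu, ⟨v, hv, v0, v1, vx, vy⟩, hzu, xz, yz, yu⟩ :=
    E.conn (S (r + 2)) (S (r + 3)) (S' 0) (S' 1) (hC.1 _ (by omega)) (hC.1 _ (by omega)) (c1 _ (by omega)) (c1 _ (by omega))
      (hC.2.1 _ (by omega) _ (by omega) (by omega)) (cS _ (by omega) _ (by omega)).symm (cS _ (by omega) _ (by omega)).symm
      (cS _ (by omega) _ (by omega)).symm (c4 _ (by omega) _ (by omega) (by omega))
      (lrx _ (by omega) _ (by omega) (by omega) (by omega)) (lrx _ (by omega) _ (by omega) (by omega) (by omega))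
      (lrx _ (by omega) _ (by omega) (by omega) (by omega))
      (Rch G S (r + 2) (w N) (w (N + 1))) H (fun _ _ _ _ h => Rch_adj h) (fun x _ y _ h => ((hH x y).1 h).1) hR hHe
  obtain ⟨w', p', e1, e2⟩ := h.ext hv v0 v1
  have wS' : ∀ k < N + (r + 4), ∀ j < r + 4, w' k ∉ S' j := by
    intro k hk j hj hh
    by_cases hk2 : k < N
    · rw [e1 k (by omega)] at hh; exact cw j hj k (by omega) hh
    · have e := e2 (k - N) (by omega)
      rw [Nat.add_sub_cancel' (by omega : N ≤ k)] at e
      rw [e] at hh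
      exact Finset.disjoint_left.1 (cS j hj (k - N) (by omega)) hh (hv.1 _ (by omega))
  have ex : w' (N + r + 2) = x := by rw [← vx, ← e2 (r + 2) (by omega)]; rfl
  have ey : w' (N + r + 3) = y := by rw [← vy, ← e2 (r + 3) (by omega)]; rfl
  have q1 : Pth G U Z (N + r + 5) (Function.update w' (N + r + 4) z) := by
    refine Pth.snoc (N := N + r + 2) p' (by have := c2 0 (by omega) hz; exact this) ?_ ?_ ?_ ?_
    · exact Finset.disjoint_left.1 (cZ 0 (by omega)) hz
    · intro k hk hh; rw [← hh] at hz; exact wS' k hk 0 (by omega) hz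
    · rw [ex]; exact xz
    · rw [show N + r + 2 + 1 = N + r + 3 by ring, ey]; exact yz
  have q2 : Pth G U Z (N + r + 6) (Function.update (Function.update w' (N + r + 4) z) (N + r + 5) u) := by
    refine Pth.snoc (N := N + r + 3) q1 (by have := c2 1 (by omega) hu; exact this) ?_ ?_ ?_ ?_
    · exact Finset.disjoint_left.1 (cZ 1 (by omega)) hu
    · intro k hk hh
      by_cases e : k = N + r + 4
      · subst e
        rw [Function.update_self] at hh
        rw [← hh] at hu
        exact Finset.disjoint_left.1 (c4 0 (by omega) 1 (by omega) (by omega)) hz hu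
      · rw [Function.update_of_ne e] at hh
        rw [← hh] at hu; exact wS' k (by omega) 1 (by omega) hu
    · rw [Function.update_of_ne (by omega), ey]; exact yu
    · rw [Function.update_self]; exact ((hH _ _).1 hzu).1
  have f1 : Function.update (Function.update w' (N + r + 4) z) (N + r + 5) u (N + (r + 4)) = z := by
    rw [Function.update_of_ne (by omega)]
    exact Function.update_self _ _ _
  have f2 : Function.update (Function.update w' (N + r + 4) z) (N + r + 5) u (N + (r + 4) + 1) = u :=
    Function.update_self _ _ _
  have f3 : ∀ k < N + (r + 4), Function.update (Function.update w' (N + r + 4) z) (N + r + 5) u k = w' k := by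
    intro k hk
    rw [Function.update_of_ne (by omega), Function.update_of_ne (by omega)]
  refine ⟨_, S', ⟨q2, hC', c2, cZ, ?_, ?_, ?_, ?_⟩, ?_, ?_⟩
  · intro k hk j hj
    rw [f3 k hk]; exact wS' k hk j hj
  · rw [f1]; exact hz
  · rw [f2]; exact hu
  · rw [f1, f2]; exact ((hH _ _).1 hzu).2
  · rw [f3 _ (by omega)]; exact e1 _ (by omega)
  · rw [f3 _ (by omega)]; exact e1 _ (by omega)

end emb
end NS

namespace NS
open Classical Finset

section emb2
variable {n : ℕ}

lemma copy_of_cyc {G : SimpleGraph (Fin n)} {M : ℕ} (hM : 2 ≤ M) (f : ℕ → Fin n)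
    (h1 : ∀ a b, a < b → b < M → f a ≠ f b) (h2 : ∀ a b, a < b → b ≤ a + 2 → b ≤ M + 1 → G.Adj (f a) (f b))
    (h3 : f M = f 0) (h4 : f (M + 1) = f 1) : ContainsCopy (cycleSquare M) G := by
  have : NeZero M := ⟨by omega⟩
  have hr : ∀ k ≤ M + 1, f (k % M) = f k := by
    intro k hk
    rcases lt_or_ge k M with h | h
    · rw [Nat.mod_eq_of_lt h]
    · have : k = M ∨ k = M + 1 := by omega
      rcases this with rfl | rfl
      · rw [Nat.mod_self, h3]
      · rw [Nat.add_mod_left, Nat.mod_eq_of_lt (by omega), h4]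
  have key : ∀ u v : ZMod M, (u - v = 1 ∨ u - v = 2) → G.Adj (f v.val) (f u.val) := by
    intro u v huv
    have hv := ZMod.val_lt v
    rcases huv with h | h
    · have hu : u.val = (v.val + 1) % M := by
        have : u = ((v.val + 1 : ℕ) : ZMod M) := by
          push_cast; rw [ZMod.natCast_zmod_val, ← h]; ring
        rw [this, ZMod.val_natCast]
      rw [hu, hr _ (by omega)]
      exact h2 _ _ (by omega) (by omega) (by omega)
    · have hu : u.val = (v.val + 2) % M := by
        have : u = ((v.val + 2 : ℕ) : ZMod M) := by
          push_cast; rw [ZMod.natCast_zmod_val, ← h]; ring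
        rw [this, ZMod.val_natCast]
      rw [hu, hr _ (by omega)]
      exact h2 _ _ (by omega) (by omega) (by omega)
  refine ⟨fun u => f u.val, ?_, ?_⟩
  · intro u v huv
    by_contra hne
    have hne' : u.val ≠ v.val := fun h => hne (ZMod.val_injective M h)
    rcases lt_or_gt_of_ne hne' with h | h
    · exact h1 _ _ h (ZMod.val_lt v) huv
    · exact h1 _ _ h (ZMod.val_lt u) huv.symm
  · intro u v huv
    obtain ⟨-, h | h⟩ := (SimpleGraph.fromRel_adj _ _ _).1 huv
    · exact (key _ _ h).symm
    · exact key _ _ h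

lemma embed {G : SimpleGraph (Fin n)} {U : ℕ → Finset (Fin n)} {M r s T : ℕ} {ρ D a b d : ℝ}
    (E : Emb G U M r s ρ D a b d) (hM : M = (T + 1) * (r + 4) + r + 2) : ContainsCopy (cycleSquare M) G := by
  have hMge : r + 4 ≤ M := by
    have : r + 4 ≤ (T + 1) * (r + 4) := Nat.le_mul_of_pos_left _ (by omega)
    omega
  -- reserved sets
  obtain ⟨B, b1, b2, b3, b4⟩ := pick (s := s) (fun j => if j ≤ M + 1 then U (M + 1 - j) else U 0) ∅ (r + 4) (by
    intro j
    rw [Finset.inter_empty, Finset.card_empty, zero_add]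
    split_ifs
    · have := E.room (M + 1 - j); omega
    · have := E.room 0; omega)
  have b2 : ∀ j < r + 4, B j ⊆ U (M + 1 - j) := by
    intro j hj
    have := b2 j hj
    rwa [if_pos (by omega)] at this
  set Z := (range (r + 4)).biUnion B with hZd
  have hZc : #Z ≤ (r + 4) * s := by
    calc #Z ≤ ∑ j ∈ range (r + 4), #(B j) := Finset.card_biUnion_le
      _ = ∑ j ∈ range (r + 4), s := Finset.sum_congr rfl (fun j hj => b1 j (Finset.mem_range.1 hj))
      _ = (r + 4) * s := by simp
  have hBZ : ∀ j < r + 4, B j ⊆ Z := fun j hj => Finset.subset_biUnion_of_mem B (Finset.mem_range.2 hj)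
  obtain ⟨S, c1, c2, c3, c4⟩ := pick (s := s) U Z (r + 4) (by
    intro j
    have h1 := Finset.card_le_card (Finset.inter_subset_right (s₁ := U j) (s₂ := Z))
    have := E.room j
    omega)
  have hC := E.chain 0 c1 (by simpa using c2) c4
  -- the backward chain
  obtain ⟨S', e0, e1, e2⟩ : ∃ S' : ℕ → Finset (Fin n), S' 0 = S 1 ∧ S' 1 = S 0 ∧ ∀ j, 2 ≤ j → S' j = B j :=
    ⟨fun j => if j = 0 then S 1 else if j = 1 then S 0 else B j, by simp, by simp, by
      intro j hj
      show (if j = 0 then S 1 else if j = 1 then S 0 else B j) = B j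
      rw [if_neg (by omega), if_neg (by omega)]⟩
  have s1 : ∀ j < r + 4, #(S' j) = s := by
    intro j hj
    rcases (by omega : j = 0 ∨ j = 1 ∨ 2 ≤ j) with h | h | h
    · rw [h, e0]; exact c1 1 (by omega)
    · rw [h, e1]; exact c1 0 (by omega)
    · rw [e2 j h]; exact b1 j hj
  have s2 : ∀ j < r + 4, S' j ⊆ U (M + 1 - j) := by
    intro j hj
    rcases (by omega : j = 0 ∨ j = 1 ∨ 2 ≤ j) with h | h | h
    · rw [h, e0]
      have := c2 1 (by omega)
      rwa [← E.per 1, add_comm] at this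
    · rw [h, e1]
      have := c2 0 (by omega)
      rwa [← E.per 0, zero_add] at this
    · rw [e2 j h]; exact b2 j hj
  have s4' : ∀ j < r + 4, ∀ k < r + 4, j < k → Disjoint (S' j) (S' k) := by
    intro j hj k hk hjk
    rcases (by omega : j = 0 ∨ j = 1 ∨ 2 ≤ j) with h | h | h
    · rcases (by omega : k = 1 ∨ 2 ≤ k) with h' | h'
      · rw [h, h', e0, e1]; exact c4 1 (by omega) 0 (by omega) (by omega)
      · rw [h, e0, e2 k h']; exact (c3 1 (by omega)).mono_right (hBZ k hk)
    · rw [h, e1, e2 k (by omega)]; exact (c3 0 (by omega)).mono_right (hBZ k hk)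
    · rw [e2 j h, e2 k (by omega)]; exact b4 j hj k hk (by omega)
  have s4 : ∀ j < r + 4, ∀ k < r + 4, j ≠ k → Disjoint (S' j) (S' k) := by
    intro j hj k hk hjk
    rcases lt_or_gt_of_ne hjk with h | h
    · exact s4' j hj k hk h
    · exact (s4' k hk j hj h).symm
  have hC' : Chain G D ρ (r + 4) s S' := by
    refine ⟨s1, s4, ?_⟩
    intro i j hij hj hjl
    exact (E.lr (M + 1 - j) (M + 1 - i) (by omega) (by omega) _ (s2 j hjl) _ (s2 i (by omega)) (s1 j hjl) (s1 i (by omega))).symm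
  -- initial edge
  obtain ⟨x0, hx0, x1, hx1, hadj, hfw, hbw⟩ : ∃ x ∈ S 0, ∃ y ∈ S 1, G.Adj x y ∧
      a ≤ (eR (Rch G S (r + 2) x y) (S (r + 2)) (S (r + 3)) : ℝ) ∧
      a ≤ (eR (Rch G S' (r + 2) y x) (S' (r + 2)) (S' (r + 3)) : ℝ) := by
    obtain ⟨H, hH⟩ : ∃ H : Fin n → Fin n → Prop, ∀ x y, H x y ↔ (G.Adj x y ∧
      a ≤ (eR (Rch G S (r + 2) x y) (S (r + 2)) (S (r + 3)) : ℝ) ∧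
      a ≤ (eR (Rch G S' (r + 2) y x) (S' (r + 2)) (S' (r + 3)) : ℝ)) := ⟨_, fun _ _ => Iff.rfl⟩
    have g1 := E.good S hC
    have g1' := E.good S' hC'
    rw [e0, e1, ← eR_flip] at g1'
    have g2 := E.edge _ _ (c1 0 (by omega)) (c1 1 (by omega)) (hC.2.2 0 1 (by omega) (by omega) (by omega))
    obtain ⟨F1, hF1⟩ : ∃ F : Fin n → Fin n → Prop, F = fun x y => G.Adj x y ∧ (eR (Rch G S (r + 2) x y) (S (r + 2)) (S (r + 3)) : ℝ) < a := ⟨_, rfl⟩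
    obtain ⟨F2, hF2⟩ : ∃ F : Fin n → Fin n → Prop, F = fun x y => G.Adj y x ∧ (eR (Rch G S' (r + 2) y x) (S' (r + 2)) (S' (r + 3)) : ℝ) < a := ⟨_, rfl⟩
    rw [← hF1] at g1
    rw [← hF2] at g1'
    obtain ⟨F3, hF3⟩ : ∃ F : Fin n → Fin n → Prop, ∀ x y, F x y ↔ (F1 x y ∨ F2 x y) := ⟨_, fun _ _ => Iff.rfl⟩
    have g3 : eR G.Adj (S 0) (S 1) ≤ eR H (S 0) (S 1) + eR F3 (S 0) (S 1) := by
      apply eR_or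
      intro x _ y _ hxy
      by_cases hh : a ≤ (eR (Rch G S (r + 2) x y) (S (r + 2)) (S (r + 3)) : ℝ)
      · by_cases hh' : a ≤ (eR (Rch G S' (r + 2) y x) (S' (r + 2)) (S' (r + 3)) : ℝ)
        · left; exact (hH x y).2 ⟨hxy, hh, hh'⟩
        · right; refine (hF3 x y).2 (Or.inr ?_); rw [hF2]; exact ⟨hxy.symm, not_le.1 hh'⟩
      · right; refine (hF3 x y).2 (Or.inl ?_); rw [hF1]; exact ⟨hxy, not_le.1 hh⟩
    have g4 : eR F3 (S 0) (S 1) ≤ eR F1 (S 0) (S 1) + eR F2 (S 0) (S 1) := eR_or (fun x _ y _ h => (hF3 x y).1 h)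
    have g3' : (eR G.Adj (S 0) (S 1) : ℝ) ≤ eR H (S 0) (S 1) + eR F3 (S 0) (S 1) := by exact_mod_cast g3
    have g4' : (eR F3 (S 0) (S 1) : ℝ) ≤ eR F1 (S 0) (S 1) + eR F2 (S 0) (S 1) := by exact_mod_cast g4
    have g5 := E.sum
    have g6 := E.apos
    have g7 : (0:ℝ) < eR H (S 0) (S 1) := by linarith
    obtain ⟨x, hx, y, hy, hxy⟩ := eR_pos (by exact_mod_cast g7)
    exact ⟨x, hx, y, hy, (hH x y).1 hxy⟩
  -- the states
  have hst : ∀ t ≤ T, ∃ w S, St G U Z r s ρ D a (t * (r + 4)) w S ∧ w 0 = x0 ∧ w 1 = x1 := by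
    intro t
    induction t with
    | zero =>
      intro _
      have hx01 : x0 ≠ x1 := hadj.ne
      have k0 : (fun k => if k = 0 then x0 else x1 : ℕ → Fin n) 0 = x0 := by simp
      have k1 : (fun k => if k = 0 then x0 else x1 : ℕ → Fin n) 1 = x1 := by simp
      obtain ⟨w, hw0, hw1⟩ : ∃ w : ℕ → Fin n, w 0 = x0 ∧ w 1 = x1 :=
        ⟨fun k => if k = 0 then x0 else x1, k0, k1⟩
      rw [Nat.zero_mul]
      refine ⟨w, S, ⟨⟨?_, ?_, ?_⟩, hC, ?_, c3, ?_, ?_, ?_, ?_⟩, hw0, hw1⟩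
      · intro i j hij hj
        have h1 : i = 0 := by omega
        have h2 : j = 1 := by omega
        rw [h1, h2, hw0, hw1]; exact hx01
      · intro i hi
        rcases (by omega : i = 0 ∨ i = 1) with h | h
        · rw [h, hw0]; exact ⟨c2 0 (by omega) hx0, Finset.disjoint_left.1 (c3 0 (by omega)) hx0⟩
        · rw [h, hw1]; exact ⟨c2 1 (by omega) hx1, Finset.disjoint_left.1 (c3 1 (by omega)) hx1⟩
      · intro i j hij _ hj
        have h1 : i = 0 := by omega
        have h2 : j = 1 := by omega
        rw [h1, h2, hw0, hw1]; exact hadj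
      · simpa using c2
      · intro k hk; omega
      · rw [hw0]; exact hx0
      · rw [zero_add, hw1]; exact hx1
      · rw [zero_add, hw0, hw1]; exact hfw
    | succ t ih =>
      intro ht
      obtain ⟨w, S1, h, hw0, hw1⟩ := ih (by omega)
      obtain ⟨w', S2, h', e1, e2⟩ := h.step E hZc (by
        have : t * (r + 4) ≤ (T + 1) * (r + 4) := Nat.mul_le_mul_right _ (by omega)
        omega)
      refine ⟨w', S2, ?_, e1.trans hw0, e2.trans hw1⟩
      rw [Nat.succ_mul]; exact h'
  obtain ⟨w, S1, h, hw0, hw1⟩ := hst T le_rfl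
  obtain ⟨N, hN⟩ : ∃ N, N = T * (r + 4) := ⟨_, rfl⟩
  rw [← hN] at h
  have hMN : M = N + (r + 4) + r + 2 := by rw [hM, hN]; ring
  have h' := h
  obtain ⟨hp, hC1, hU, hZ, hw, -, -, hR⟩ := h'
  have lrx : ∀ j < r + 4, ∀ k < r + 4, j < (r + 3 - k) + (r + 4) → (r + 3 - k) + (r + 4) ≤ j + 2 → LR G (S1 j) (S' k) ρ D := by
    intro j hj k hk h1 h2
    exact E.lr (N + j) (M + 1 - k) (by omega) (by omega) _ (hU j hj) _ (s2 k hk) (hC1.1 j hj) (s1 k hk)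
  have cS : ∀ j < r + 4, ∀ k < r + 4, 2 ≤ k → Disjoint (S1 j) (S' k) := by
    intro j hj k hk h2
    rw [e2 k h2]
    exact (hZ j hj).mono_right (hBZ k hk)
  obtain ⟨x, hx, y, hy, z, hz, u, hu, ⟨v, hv, v0, v1, vx, vy⟩, ⟨q, hq, q0, q1, qx, qy⟩, xz, yz, yu⟩ :=
    E.conn (S1 (r + 2)) (S1 (r + 3)) (S' (r + 3)) (S' (r + 2)) (hC1.1 _ (by omega)) (hC1.1 _ (by omega)) (s1 _ (by omega)) (s1 _ (by omega))
      (hC1.2.1 _ (by omega) _ (by omega) (by omega)) (cS _ (by omega) _ (by omega) (by omega)) (cS _ (by omega) _ (by omega) (by omega))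
      (cS _ (by omega) _ (by omega) (by omega)) (s4 _ (by omega) _ (by omega) (by omega))
      (lrx _ (by omega) _ (by omega) (by omega) (by omega)) (lrx _ (by omega) _ (by omega) (by omega) (by omega))
      (lrx _ (by omega) _ (by omega) (by omega) (by omega))
      (Rch G S1 (r + 2) (w N) (w (N + 1))) (fun x y => Rch G S' (r + 2) x1 x0 y x) (fun _ _ _ _ h => Rch_adj h)
      (fun x _ y _ h => (Rch_adj h).symm) hR (by rw [eR_flip]; exact hbw)
  obtain ⟨w', p', f1, f2⟩ := h.ext hv v0 v1
  have ex : w' (N + r + 2) = x := by rw [← vx, ← f2 (r + 2) (by omega)]; rfl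
  have ey : w' (N + r + 3) = y := by rw [← vy, ← f2 (r + 3) (by omega)]; rfl
  obtain ⟨f, F1, F2⟩ : ∃ f : ℕ → Fin n, (∀ k < N + (r + 4), f k = w' k) ∧ (∀ k, N + (r + 4) ≤ k → f k = q (M + 1 - k)) :=
    ⟨fun k => if k < N + (r + 4) then w' k else q (M + 1 - k), fun k hk => if_pos hk, fun k hk => if_neg (by omega)⟩
  refine copy_of_cyc (by omega) f ?_ ?_ ?_ ?_
  · intro i j hij hj
    by_cases hj' : j < N + (r + 4)
    · rw [F1 i (by omega), F1 j hj']; exact p'.1 i j hij hj'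
    · rw [F2 j (by omega)]
      have hqj := hq.1 (M + 1 - j) (by omega)
      by_cases hi : i < N + (r + 4)
      · rw [F1 i hi]
        intro hh
        rw [← hh, e2 _ (by omega)] at hqj
        exact (p'.2.1 i hi).2 (hBZ _ (by omega) hqj)
      · rw [F2 i (by omega)]
        intro hh
        have hqi := hq.1 (M + 1 - i) (by omega)
        rw [hh] at hqi
        exact Finset.disjoint_left.1 (s4 (M + 1 - i) (by omega) (M + 1 - j) (by omega) (by omega)) hqi hqj
  · intro i j hij hj2 hj
    by_cases hj' : j < N + (r + 4)
    · rw [F1 i (by omega), F1 j hj']; exact p'.2.2 i j hij hj2 hj'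
    · by_cases hi : i < N + (r + 4)
      · rw [F1 i hi, F2 j (by omega)]
        rcases (by omega : (i = N + r + 2 ∧ M + 1 - j = r + 3) ∨ (i = N + r + 3 ∧ M + 1 - j = r + 3) ∨ (i = N + r + 3 ∧ M + 1 - j = r + 2)) with h | h | h
        · rw [h.1, h.2, ex]; show G.Adj x (q (r + 2 + 1)); rw [qy]; exact xz
        · rw [h.1, h.2, ey]; show G.Adj y (q (r + 2 + 1)); rw [qy]; exact yz
        · rw [h.1, h.2, ey, qx]; exact yu
      · rw [F2 i (by omega), F2 j (by omega)]
        exact (hq.2 _ _ (by omega) (by omega) (by omega)).symm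
  · rw [F2 _ (by omega), F1 _ (by omega), f1 _ (by omega), hw0, show M + 1 - M = 1 by omega, q1]
  · rw [F2 _ (by omega), F1 _ (by omega), f1 _ (by omega), hw1, Nat.sub_self, q0]

end emb2
end NS

namespace NS
open Classical Finset

section seq
variable {ι : Type}

lemma cnt_le {ι : Type} (a x : ι) (l : List ι) : #{k ∈ range l.length | l.getD k a = x} ≤ l.count x := by
  induction l with
  | nil => simp
  | cons c l ih =>
    rw [Finset.card_filter] at ih ⊢
    rw [List.length_cons, Finset.sum_range_succ']
    simp only [List.getD_cons_succ, List.getD_cons_zero]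
    rw [List.count_cons]
    by_cases h : c = x
    · simp only [h, if_true, beq_self_eq_true]; omega
    · have : (c == x) = false := by simpa using h
      simp only [h, if_false, this]
      simpa using ih

lemma mem_nb' [Fintype ι] {R : SimpleGraph ι} {a b : ι} : b ∈ nb R a ↔ R.Adj a b := by
  unfold nb
  rw [Finset.mem_filter]
  exact ⟨fun h => h.2, fun h => ⟨Finset.mem_univ _, h⟩⟩

lemma Wk.getD {R : SimpleGraph ι} {e f : ι × ι} {l : List ι} (h : Wk R e f l) (x : ι) :
    (∀ j < l.length, Tri R ((e.1 :: e.2 :: l).getD j x) ((e.1 :: e.2 :: l).getD (j + 1) x) ((e.1 :: e.2 :: l).getD (j + 2) x)) ∧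
    (e.1 :: e.2 :: l).getD l.length x = f.1 ∧ (e.1 :: e.2 :: l).getD (l.length + 1) x = f.2 := by
  induction h with
  | nil e => simp
  | cons ht _ ih =>
    obtain ⟨i1, i2, i3⟩ := ih
    refine ⟨?_, ?_, ?_⟩
    · intro j hj
      cases j with
      | zero => simpa using ht
      | succ j =>
        have := i1 j (by simpa using hj)
        simpa only [List.getD_cons_succ] using this
    · simpa using i2
    · simpa using i3

lemma cyc {R : SimpleGraph ι} {a b : ι} {l : List ι} (h : Wk R (a, b) (a, b) l) (hl : 2 ≤ l.length) :
    ∃ i : ℕ → ι, (∀ j, i (j + l.length) = i j) ∧ (∀ j, R.Adj (i j) (i (j + 1)) ∧ R.Adj (i j) (i (j + 2))) ∧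
      ∀ x, #{k ∈ range l.length | i k = x} ≤ l.count x := by
  obtain ⟨h1, h2, h3⟩ := h.getD a
  obtain ⟨g, hg⟩ : ∃ g : ℕ → ι, ∀ j, g j = (a :: b :: l).getD j a := ⟨_, fun _ => rfl⟩
  simp only [← hg] at h1 h2 h3
  obtain ⟨M, hM⟩ : ∃ M, M = l.length := ⟨_, rfl⟩
  rw [← hM] at h1 h2 h3 hl ⊢
  have g0 : g 0 = a := by rw [hg]; simp
  have g1 : g 1 = b := by rw [hg]; simp
  have hr : ∀ k ≤ M + 1, g (k % M) = g k := by
    intro k hk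
    rcases lt_or_ge k M with h | h
    · rw [Nat.mod_eq_of_lt h]
    · have : k = M ∨ k = M + 1 := by omega
      rcases this with rfl | rfl
      · rw [Nat.mod_self, h2, g0]
      · rw [Nat.add_mod_left, Nat.mod_eq_of_lt (by omega), h3, g1]
  have hadj : ∀ j, R.Adj (g (j % M)) (g ((j + 1) % M)) ∧ R.Adj (g (j % M)) (g ((j + 2) % M)) := by
    intro j
    have hlt : j % M < M := Nat.mod_lt _ (by omega)
    have e1 : (j + 1) % M = (j % M + 1) % M := by simp
    have e2 : (j + 2) % M = (j % M + 2) % M := by simp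
    rw [e1, e2, hr (j % M + 1) (by omega), hr (j % M + 2) (by omega)]
    have := h1 _ hlt
    exact ⟨this.1, this.2.2⟩
  refine ⟨fun j => g ((j + 2) % M), ?_, ?_, ?_⟩
  · intro j
    show g ((j + M + 2) % M) = g ((j + 2) % M)
    rw [show j + M + 2 = j + 2 + M by ring, Nat.add_mod_right]
  · intro j
    exact hadj (j + 2)
  · intro x
    refine le_trans (le_of_eq ?_) (cnt_le a x l)
    rw [← hM]
    congr 1
    apply Finset.filter_congr
    intro k hk
    have hk := Finset.mem_range.1 hk
    show g ((k + 2) % M) = x ↔ _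
    rw [hr _ (by omega), hg]
    simp

end seq

lemma cfl {α : Type} {s : Finset α} {P Q : α → Prop} [DecidablePred P] {_ : DecidablePred Q} (h : ∀ a ∈ s, P a → Q a) :
    #{a ∈ s | P a} ≤ #{a ∈ s | Q a} := by
  apply Finset.card_le_card
  intro a ha
  obtain ⟨h1, h2⟩ := Finset.mem_filter.1 ha
  exact Finset.mem_filter.2 ⟨h1, h a h1 h2⟩

lemma seqU {n m s L N : ℕ} {G : SimpleGraph (Fin n)} {ρ D : ℝ} {Q : Finset (Finset (Fin n))} (hQ : Q.Nonempty) (hL : 1 ≤ L)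
    (hm : ∀ A ∈ Q, #A = m) (hd : ∀ A ∈ Q, ∀ B ∈ Q, A ≠ B → Disjoint A B)
    (hdeg : ∀ A ∈ Q, 2 * #Q < 3 * #{B ∈ Q | A ≠ B ∧ LR G A B ρ D}) (hN : 1 ≤ N)
    (hroom : 3 * (N:ℝ) / #Q + Real.sqrt (3 * N) + CR #Q L + 3 * (L * s) ≤ m) :
    ∃ (M : ℕ) (U : ℕ → Finset (Fin n)), 3 * N ≤ M ∧ L ∣ M + 2 ∧ (∀ j, U (j + M) = U j) ∧
      (∀ j k, U j = U k ∨ Disjoint (U j) (U k)) ∧ (∀ j, #{k ∈ range M | U k = U j} + 3 * (L * s) ≤ #(U j)) ∧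
      (∀ j k, j < k → k ≤ j + 2 → LR G (U j) (U k) ρ D) := by
  let R : SimpleGraph {A // A ∈ Q} :=
    { Adj := fun A B => A ≠ B ∧ LR G A.1 B.1 ρ D
      symm := ⟨fun A B h => ⟨h.1.symm, h.2.symm⟩⟩
      loopless := ⟨fun A h => h.1 rfl⟩ }
  have hcard : Fintype.card {A // A ∈ Q} = #Q := Fintype.card_coe Q
  have : Nonempty {A // A ∈ Q} := ⟨⟨hQ.choose, hQ.choose_spec⟩⟩
  have hB : BigDeg R := by
    intro A
    rw [hcard]
    have h1 := hdeg A.1 A.2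
    have h2 : #{B ∈ Q | A.1 ≠ B ∧ LR G A.1 B ρ D} ≤ #(nb R A) := by
      calc #{B ∈ Q | A.1 ≠ B ∧ LR G A.1 B ρ D} ≤ #((nb R A).map ⟨Subtype.val, Subtype.val_injective⟩) := by
            apply Finset.card_le_card
            intro B hB
            obtain ⟨b1, b2, b3⟩ := Finset.mem_filter.1 hB
            refine Finset.mem_map.2 ⟨⟨B, b1⟩, ?_, rfl⟩
            refine mem_nb'.2 ⟨?_, b3⟩
            exact fun h => b2 (congrArg Subtype.val h)
        _ = _ := Finset.card_map _
    omega
  obtain ⟨a, b, l, hab, hw, hlen, hdvd, hcnt⟩ := route hB hL N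
  obtain ⟨i, i1, i2, i3⟩ := cyc hw (by omega)
  refine ⟨l.length, fun j => (i j).1, hlen, hdvd, ?_, ?_, ?_, ?_⟩
  · intro j; show (i (j + l.length)).1 = (i j).1; rw [i1]
  · intro j k
    by_cases h : (i j).1 = (i k).1
    · left; exact h
    · right; exact hd _ (i j).2 _ (i k).2 h
  · intro j
    show #{k ∈ range l.length | (i k).1 = (i j).1} + 3 * (L * s) ≤ #(i j).1
    rw [hm _ (i j).2]
    have h1 := (i3 (i j)).trans' (cfl (P := fun k => (i k).1 = (i j).1) (fun k _ h => Subtype.ext h))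
    have h2 := hcnt (i j)
    rw [hcard] at h2
    have h3 : ((#{k ∈ range l.length | (i k).1 = (i j).1} + 3 * (L * s) : ℕ) : ℝ) ≤ m := by
      push_cast
      have h4 := le_trans (Nat.cast_le (α := ℝ).2 h1) h2
      linarith
    exact_mod_cast h3
  · intro j k hjk hk
    rcases (by omega : k = j + 1 ∨ k = j + 2) with rfl | rfl
    · exact (i2 j).1.2
    · exact (i2 j).2.2
end NS

namespace NS
open Classical Finset

/-- the constants -/
structure Cst (κ δ η₁ η₂ c c' ν ε K Mp : ℝ) (r : ℕ) : Prop where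
  hκ : 0 < κ
  hκ1 : κ ≤ 1
  hδ : 0 < δ
  hδκ : δ ≤ κ / 8
  a1 : 0 < η₁
  a1' : η₁ ≤ 1
  a2 : 0 < η₂
  a2' : η₂ ≤ 1
  hr : 2 ≤ r
  c2 : η₁ ≤ δ / 2 * (κ / 32) ^ (r + 2) / 64
  c3 : η₁ ≤ κ / 2
  hc : c = κ * sg η₁ ^ 2 * η₁ / 8
  hc' : 0 < c'
  hc1' : c' ≤ c / 16
  hν : ν = c ^ 2 / 128
  hην : η₂ ≤ κ * ν ^ 2 / 1000
  hε : 0 < ε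
  hε1 : ε ≤ sg η₁ ^ 2
  hε2 : ε ≤ sg η₂ ^ 2
  hK : 0 < K
  hM : 0 < Mp
  hcM : c' * Mp * K ^ (2 * r) ≤ δ / 2 * c ^ (2 * r)

lemma Cst.cpos {κ δ η₁ η₂ c c' ν ε K Mp : ℝ} {r : ℕ} (C : Cst κ δ η₁ η₂ c c' ν ε K Mp r) : 0 < c := by
  have := C.hκ
  have := C.a1
  have := sg_pos C.a1
  rw [C.hc]; positivity

lemma Cst.cle {κ δ η₁ η₂ c c' ν ε K Mp : ℝ} {r : ℕ} (C : Cst κ δ η₁ η₂ c c' ν ε K Mp r) : c ≤ κ / 8 := by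
  have h1 := C.hκ
  have h2 := C.a1
  have h2' := C.a1'
  have h3 := sg_pos C.a1
  have h4 := sg_sq_le C.a1 C.a1'
  rw [C.hc]
  have : κ * sg η₁ ^ 2 * η₁ ≤ κ * 1 * 1 := by
    have := h4.trans h2'
    gcongr
  linarith

lemma emb_of {n : ℕ} {Γ G : SimpleGraph (Fin n)} {V : ℕ → Finset (Fin n)} {M r s U : ℕ} {p ηd κ δ η₁ η₂ c c' ν ε K Mp : ℝ}
    (C : Cst κ δ η₁ η₂ c c' ν ε K Mp r) (hG : G ≤ Γ) (hp : 0 < p) (hp1 : p ≤ 1) (hD : Disc Γ p ηd U)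
    (I1 : Inh Γ p κ η₁ (sg η₁) s) (I2 : Inh Γ p κ η₂ (sg η₂) s)
    (hP : (#(P4set Γ (r + 2)) : ℝ) ≤ Mp * ((n : ℝ) ^ (2 * r) * p ^ (4 * r)))
    (hs : 0 < s) (hnK : (n : ℝ) ≤ K * s) (hU : U < c * c' / 64 * s * p)
    (per : ∀ j, V (j + M) = V j) (dis : ∀ j k, V j = V k ∨ Disjoint (V j) (V k))
    (room : ∀ j, #{k ∈ range M | V k = V j} + 3 * ((r + 4) * s) ≤ #(V j))
    (lr : ∀ j k, j < k → k ≤ j + 2 → LR G (V j) (V k) (ε * s) (κ * p)) :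
    Emb G V M r s (ε * s) (κ * p) (ν * s ^ 2 * p) (κ * s ^ 2 * p) (δ * s ^ 2 * p) := by
  have hsr : (0:ℝ) < s := by exact_mod_cast hs
  have hκ := C.hκ
  have hκ1 := C.hκ1
  have hc := C.cpos
  have hcκ := C.cle
  have hc' := C.hc'
  have hν := C.hν
  have hνp : 0 < ν := by rw [hν]; positivity
  have hνκ : ν ≤ κ / 128 := by
    rw [hν]
    have : c ^ 2 ≤ κ := by
      calc c ^ 2 = c * c := by ring
        _ ≤ κ * 1 := by
          have : c ≤ κ := by linarith
          have : c ≤ 1 := by linarith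
          gcongr
        _ = κ := by ring
    linarith
  have hU2 : (U:ℝ) < ν / 8 * s := by
    refine lt_of_lt_of_le hU ?_
    rw [hν]
    calc c * c' / 64 * s * p ≤ c * (c / 16) / 64 * s * 1 := by
          have := C.hc1'
          gcongr
      _ = _ := by ring
  have hUs : U ≤ s := by
    have : ν / 8 * (s:ℝ) ≤ 1 * s := by
      have : ν / 8 ≤ 1 := by linarith
      gcongr
    have : (U:ℝ) ≤ s := by linarith
    exact_mod_cast this
  have e1 : ε * s ≤ sg η₁ ^ 2 * s := by have := C.hε1; gcongr
  have e2 : ε * s ≤ sg η₂ ^ 2 * s := by have := C.hε2; gcongr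
  have hε1 : ε * s ≤ s := by
    have h1 := C.hε1
    have h2 := sg_sq_le C.a1 C.a1'
    have h3 := C.a1'
    have : ε * s ≤ 1 * s := by
      have : ε ≤ 1 := by linarith
      gcongr
    linarith
  refine ⟨per, dis, room, ?_, ?_, ?_, ?_, by positivity, ?_⟩
  · intro j k h1 h2 X hX Y hY _ _
    exact (lr j k h1 h2).mono hX hY le_rfl
  · intro X Y hX hY h
    have := h X Y (Finset.Subset.refl _) (Finset.Subset.refl _) (by rw [hX]; exact hε1) (by rw [hY]; exact hε1)
    rw [hX, hY] at this
    calc κ * s ^ 2 * p = κ * p * s * s := by ring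
      _ ≤ _ := this
      _ = _ := by rfl
  · intro S hS
    have hS' : Chain G (κ * p) (sg η₁ ^ 2 * s) (r + 4) s S :=
      ⟨hS.1, hS.2.1, fun i j h1 h2 h3 => (hS.2.2 i j h1 h2 h3).mono (Finset.Subset.refl _) (Finset.Subset.refl _) e1⟩
    rw [hν]
    exact good hG hp hp1 hκ C.a1 C.a1' (sg_pos C.a1) (sg_sq_le C.a1 C.a1') hs hκ1 C.hδ C.hr hD I1 hS' C.c2 C.c3 C.hc hc'
      (by have := C.hc1'; linarith) C.hM C.hK hnK C.hcM hP hU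
  · intro W0 W1 W2 W3 h0 h1 h2 h3 d01 d02 d12 d13 d23 l02 l12 l13 F H hF hH hFe hHe
    exact connect hG hp hκ hκ1 C.a2 (sg_pos C.a2) (sg_sq_le C.a2 C.a2') hs hνp (by linarith) C.hην hD I2 h0 h1 h2 h3
      d01 d02 d12 d13 d23 (l02.mono (Finset.Subset.refl _) (Finset.Subset.refl _) e2) (l12.mono (Finset.Subset.refl _) (Finset.Subset.refl _) e2)
      (l13.mono (Finset.Subset.refl _) (Finset.Subset.refl _) e2) hF hH hFe hHe hUs hU2
  · have h1 := C.hδκ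
    have : ν + 2 * δ < κ := by linarith
    have h2 : (ν + 2 * δ) * (s ^ 2 * p) < κ * (s ^ 2 * p) := by gcongr
    linarith

lemma final_det {n : ℕ} {Γ G : SimpleGraph (Fin n)} {r m : ℕ} {P : Finset (Finset (Fin n))}
    {p γ κ δ η₁ η₂ c c' ν ε K Mp K0 ρ η0 : ℝ}
    (C : Cst κ δ η₁ η₂ c c' ν ε K Mp r) (hγ0 : 0 < γ) (hγ : γ ≤ 1 / 4) (hκγ : κ = γ / 100) (hρ : ρ = γ / (24 * (r + 4)))
    (hK0 : 1 ≤ K0) (hK : K = 2 * K0 / ρ) (hη0 : η0 = c * c' / (256 * K))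
    (hG : G ≤ Γ) (hp : 0 < p) (hp1 : p ≤ 1) (hD : Disc Γ p κ ⌈η0 * n * p⌉₊) (hnp : 1 ≤ η0 * n * p)
    (I1 : ∀ s : ℕ, s ≤ n → (n : ℝ) ≤ K * s → Inh Γ p κ η₁ (sg η₁) s)
    (I2 : ∀ s : ℕ, s ≤ n → (n : ℝ) ≤ K * s → Inh Γ p κ η₂ (sg η₂) s)
    (hP : (#(P4set Γ (r + 2)) : ℝ) ≤ Mp * ((n : ℝ) ^ (2 * r) * p ^ (4 * r)))
    (hR : RegC G p (κ ^ 2) κ (ε * ρ / 2) κ K0 m P)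
    (hdeg : ∀ v, (2 / 3 + γ / 2) * (n * p) ≤ #{x | G.Adj v x})
    (n1 : 2 * K0 / ρ ≤ n) (n2 : (16 * K0 / γ) ^ 2 ≤ n) (n3 : 16 * K0 * CR ⌊K0⌋₊ (r + 4) / γ ≤ n) (n4 : 6 / γ ≤ n)
    (n5 : 6 * ((r:ℝ) + 4) ≤ n) :
    ∃ M : ℕ, (1 - γ) * n ≤ M ∧ ContainsCopy (cycleSquare M) G := by
  have hρ0 : 0 < ρ := by rw [hρ]; positivity
  have hρ1 : ρ ≤ 1 := by
    rw [hρ, div_le_one (by positivity)]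
    have : (0:ℝ) ≤ r := by positivity
    linarith
  have hκ := C.hκ
  have hc := C.cpos
  have hc' := C.hc'
  have hKp := C.hK
  obtain ⟨rPm, rPd, rK, rm, rrest, -⟩ := id hR
  have hn0 : (0:ℝ) < n := by
    have : (0:ℝ) ≤ r := by positivity
    linarith
  have hm0 : (0:ℝ) < m := by
    by_contra h
    have : K0 * (m:ℝ) ≤ 0 := mul_nonpos_of_nonneg_of_nonpos (by linarith) (not_lt.1 h)
    linarith
  -- s
  have hρm : 2 ≤ ρ * m := by
    rw [div_le_iff₀ hρ0] at n1
    have h1 : K0 * 2 ≤ K0 * (ρ * m) := by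
      calc K0 * 2 = 2 * K0 := by ring
        _ ≤ n * ρ := n1
        _ ≤ K0 * m * ρ := by gcongr
        _ = _ := by ring
    exact le_of_mul_le_mul_left h1 (by linarith)
  obtain ⟨s, hs⟩ : ∃ s, s = ⌊ρ * m⌋₊ := ⟨_, rfl⟩
  have s1 : (s:ℝ) ≤ ρ * m := by rw [hs]; exact Nat.floor_le (by positivity)
  have s2 : ρ * m / 2 ≤ s := by
    have := Nat.lt_floor_add_one (ρ * m)
    rw [← hs] at this
    linarith
  have hs0 : 0 < s := by
    have : (0:ℝ) < s := by linarith
    exact_mod_cast this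
  have hsr : (0:ℝ) < s := by exact_mod_cast hs0
  have hsm : (s:ℝ) ≤ m := by
    have : ρ * (m:ℝ) ≤ 1 * m := by gcongr
    linarith
  have hnK : (n:ℝ) ≤ K * s := by
    calc (n:ℝ) ≤ K0 * m := rK
      _ = K * (ρ * m / 2) := by rw [hK]; field_simp
      _ ≤ K * s := by gcongr
  have hη0p : 0 < η0 := by rw [hη0]; positivity
  obtain ⟨U, hUd⟩ : ∃ U, U = ⌈η0 * n * p⌉₊ := ⟨_, rfl⟩
  rw [← hUd] at hD
  have hU : (U:ℝ) < c * c' / 64 * s * p := by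
    have h1 := Nat.ceil_lt_add_one (show 0 ≤ η0 * n * p by positivity)
    rw [← hUd] at h1
    have h2 : η0 * n * p ≤ c * c' / 256 * s * p := by
      calc η0 * n * p ≤ η0 * (K * s) * p := by gcongr
        _ = _ := by rw [hη0]; field_simp
    have : 0 < c * c' * s * p := by positivity
    linarith
  have hUm : U ≤ m := by
    have h1 := C.hc1'
    have h2 := C.cle
    have h3 := C.hκ1
    have : c * c' / 64 * s * p ≤ 1 * 1 / 64 * s * 1 := by
      have : c ≤ 1 := by linarith
      have : c' ≤ 1 := by linarith
      gcongr
    have : (U:ℝ) ≤ m := by linarith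
    exact_mod_cast this
  have hn1 : 1 ≤ n := by
    have : 0 < n := by exact_mod_cast hn0
    omega
  obtain ⟨Q, hQP, hQc, hQn, hQd⟩ := reduced hn1 hp hκ (by linarith) hγ hR hG hD hUm hdeg
  obtain ⟨k, hk⟩ : ∃ k, k = #Q := ⟨_, rfl⟩
  have hk0 : (0:ℝ) < k := by rw [hk]; exact_mod_cast Finset.card_pos.2 hQn
  have hkm : (k:ℝ) * m ≤ n := by
    have h1 : #(Q.biUnion id) = ∑ A ∈ Q, #A := by
      rw [Finset.card_biUnion]
      · rfl
      · intro A hA B hB hAB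
        exact rPd A (hQP hA) B (hQP hB) hAB
    have h2 : ∑ A ∈ Q, #A = k * m := by
      rw [Finset.sum_congr rfl (fun A hA => rPm A (hQP hA)), Finset.sum_const, hk, smul_eq_mul]
    have h3 : #(Q.biUnion id) ≤ n := by
      have := Finset.card_le_univ (Q.biUnion id)
      simpa using this
    rw [h1, h2] at h3
    exact_mod_cast h3
  have hkK : (k:ℝ) ≤ K0 := by
    have : (k:ℝ) * m ≤ K0 * m := hkm.trans rK
    exact le_of_mul_le_mul_right this hm0
  have hkm2 : (1 - γ / 50) * n ≤ k * m := by
    rw [← hk] at hQc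
    have h1 : (1 - κ) * n ≤ #P * m := by linarith
    have h2 : (1 - κ) * ((1 - κ) * n) ≤ k * m := by
      calc (1 - κ) * ((1 - κ) * n) ≤ (1 - κ) * (#P * m) := by
            have : 0 ≤ 1 - κ := by linarith
            gcongr
        _ = (1 - κ) * #P * m := by ring
        _ ≤ k * m := by gcongr
    have h3 : 0 ≤ κ ^ 2 * n := by positivity
    have h4 : κ * n = γ / 100 * n := by rw [hκγ]
    linarith
  -- N
  obtain ⟨N, hN⟩ : ∃ N, N = ⌊(1 - γ / 4) * (k * m) / 3⌋₊ := ⟨_, rfl⟩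
  have hg4 : 0 ≤ 1 - γ / 4 := by linarith
  have N1 : 3 * (N:ℝ) ≤ (1 - γ / 4) * (k * m) := by
    have := Nat.floor_le (show 0 ≤ (1 - γ / 4) * (k * m) / 3 by positivity)
    rw [← hN] at this
    linarith
  have N2 : (1 - γ / 4) * (k * m) - 3 ≤ 3 * N := by
    have := Nat.lt_floor_add_one ((1 - γ / 4) * (k * m) / 3)
    rw [← hN] at this
    linarith
  have N3 : (1 - γ) * n ≤ 3 * N := by
    rw [div_le_iff₀ hγ0] at n4
    have h1 : (1 - γ / 4) * ((1 - γ / 50) * n) ≤ (1 - γ / 4) * (k * m) := by gcongr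
    have h2 : 0 ≤ γ ^ 2 * n := by positivity
    linarith
  have N4 : r + 4 ≤ N := by
    have h1 : 3 / 4 * (n:ℝ) ≤ (1 - γ) * n := by
      have : 3 / 4 ≤ 1 - γ := by linarith
      gcongr
    have : ((r + 4 : ℕ):ℝ) ≤ N := by push_cast; linarith
    exact_mod_cast this
  have hroom : 3 * (N:ℝ) / #Q + Real.sqrt (3 * N) + CR #Q (r + 4) + 3 * ((r + 4 : ℕ) * s) ≤ m := by
    rw [← hk]
    have h1 : 3 * (N:ℝ) / k ≤ (1 - γ / 4) * m := by
      rw [div_le_iff₀ hk0]; linarith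
    have hγm : γ / (16 * K0) * n ≤ γ / 16 * m := by
      calc γ / (16 * K0) * n ≤ γ / (16 * K0) * (K0 * m) := by gcongr
        _ = _ := by field_simp
    have h2 : Real.sqrt (3 * N) ≤ γ / 16 * m := by
      refine le_trans ?_ hγm
      rw [Real.sqrt_le_left (by positivity)]
      have h3 : 3 * (N:ℝ) ≤ n := by
        have : (1 - γ / 4) * ((k:ℝ) * m) ≤ 1 * (k * m) := by
          have : 1 - γ / 4 ≤ 1 := by linarith
          gcongr
        linarith
      calc 3 * (N:ℝ) ≤ n := h3
        _ = (γ / (16 * K0)) ^ 2 * ((16 * K0 / γ) ^ 2 * n) := by field_simp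
        _ ≤ (γ / (16 * K0)) ^ 2 * (n * n) := by gcongr
        _ = _ := by ring
    have h3 : (CR k (r + 4) : ℝ) ≤ γ / 16 * m := by
      refine le_trans ?_ hγm
      have h4 : CR k (r + 4) ≤ CR ⌊K0⌋₊ (r + 4) := CR_mono _ (Nat.le_floor hkK)
      have h5 : (CR k (r + 4) : ℝ) ≤ CR ⌊K0⌋₊ (r + 4) := by exact_mod_cast h4
      calc (CR k (r + 4) : ℝ) ≤ CR ⌊K0⌋₊ (r + 4) := h5
        _ = γ / (16 * K0) * (16 * K0 * CR ⌊K0⌋₊ (r + 4) / γ) := by field_simp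
        _ ≤ _ := by gcongr
    have h4 : 3 * (((r + 4 : ℕ):ℝ) * s) ≤ γ / 8 * m := by
      calc 3 * (((r + 4 : ℕ):ℝ) * s) ≤ 3 * (((r + 4 : ℕ):ℝ) * (ρ * m)) := by gcongr
        _ = _ := by rw [hρ]; push_cast; field_simp; norm_num
    linarith
  obtain ⟨M, V, M1, M2, per, dis, room, lr⟩ := seqU hQn (by omega : 1 ≤ r + 4) (fun A hA => rPm A (hQP hA))
    (fun A hA B hB h => rPd A (hQP hA) B (hQP hB) h) hQd (by omega : 1 ≤ N) hroom
  have hsn : s ≤ n := by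
    have : (s:ℝ) ≤ n := by
      have : κ * (n:ℝ) ≤ 1 * n := by have := C.hκ1; gcongr
      linarith
    exact_mod_cast this
  have E := emb_of C hG hp hp1 hD (I1 s hsn hnK) (I2 s hsn hnK) hP hs0 hnK hU per dis room (fun j k h1 h2 =>
    (lr j k h1 h2).mono (Finset.Subset.refl _) (Finset.Subset.refl _) (by
      have := C.hε
      calc ε * ρ / 2 * m = ε * (ρ * m / 2) := by ring
        _ ≤ ε * s := by gcongr))
  obtain ⟨q, hq⟩ := M2
  refine ⟨M, ?_, ?_⟩
  · have : ((3 * N : ℕ):ℝ) ≤ M := by exact_mod_cast M1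
    push_cast at this
    linarith
  · have hq2 : 2 ≤ q := by
      by_contra h
      have : (r + 4) * q ≤ (r + 4) * 1 := Nat.mul_le_mul_left _ (by omega)
      omega
    obtain ⟨T, rfl⟩ := Nat.exists_eq_add_of_le hq2
    refine embed (T := T) E ?_
    have : (r + 4) * (2 + T) = (T + 1) * (r + 4) + (r + 4) := by ring
    omega
end NS

namespace NS
open Classical Finset

/-- the resilience property -/
def Good (γ : ℝ) {n : ℕ} (ω : Sym2 (Fin n) → Bool) : Prop :=
  ∀ G : SimpleGraph (Fin n), G ≤ graphOf ω →
        (∀ v : Fin n, (((graphOf ω).neighborSet v \ G.neighborSet v).ncard : ℝ) ≤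
          (1 / 3 - γ) * ((graphOf ω).neighborSet v).ncard) →
        ∃ m : ℕ, (1 - γ) * (n : ℝ) ≤ (m : ℝ) ∧ ContainsCopy (cycleSquare m) G

lemma deg_sub {n : ℕ} {Γ G : SimpleGraph (Fin n)} (hG : G ≤ Γ) {γ p : ℝ} (hγ0 : 0 < γ) (hγ : γ ≤ 1 / 4)
    (hp : 0 ≤ p) (v : Fin n) (h1 : (1 - γ / 4) * n * p ≤ (Γ.neighborSet v).ncard)
    (h2 : ((Γ.neighborSet v \ G.neighborSet v).ncard : ℝ) ≤ (1 / 3 - γ) * (Γ.neighborSet v).ncard) :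
    (2 / 3 + γ / 2) * (n * p) ≤ #{x | G.Adj v x} := by
  have e1 : (G.neighborSet v).ncard = #{x | G.Adj v x} := by
    rw [← Set.ncard_coe_finset]
    congr 1
    ext x
    simp
  have e2 : (Γ.neighborSet v \ G.neighborSet v).ncard + (G.neighborSet v).ncard
      = (Γ.neighborSet v).ncard :=
    Set.ncard_sdiff_add_ncard_of_subset (fun x hx => hG hx) (Set.toFinite _)
  rw [← e1]
  have e3 : ((Γ.neighborSet v \ G.neighborSet v).ncard : ℝ) + (G.neighborSet v).ncard
      = (Γ.neighborSet v).ncard := by exact_mod_cast e2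
  have hnp : (0:ℝ) ≤ n * p := by positivity
  have e4 : (2 / 3 + γ) * ((1 - γ / 4) * n * p) ≤ (2 / 3 + γ) * (Γ.neighborSet v).ncard := by gcongr
  have e5 : (2 / 3 + γ / 2) * (n * p) ≤ (2 / 3 + γ) * ((1 - γ / 4) * n * p) := by
    have : (2 / 3 + γ / 2) ≤ (2 / 3 + γ) * (1 - γ / 4) := by nlinarith
    calc _ ≤ (2 / 3 + γ) * (1 - γ / 4) * (n * p) := by gcongr
      _ = _ := by ring
  linarith

lemma consts {γ ζ : ℝ} (hγ0 : 0 < γ) (hγ : γ ≤ 1 / 4) (hζ : 0 < ζ) :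
    ∃ k : ℕ, 3 / 4 ≤ γ * (((k + 1 : ℕ) : ℝ) - 4) ∧ ∃ η₁ η₂ c ν ε : ℝ, ∃ K0 : ℝ, 1 ≤ K0 ∧ 0 < c ∧ c ≤ 1 ∧
      (∃ N : ℕ, ∀ n : ℕ, N ≤ n → ∀ (G : SimpleGraph (Fin n)) (p : ℝ), 0 < p →
      (eG G univ univ : ℝ) ≤ 4 * p * n ^ 2 → ∃ m P, RegC G p ((γ/100)^2) (γ/100)
        (ε * (γ / (24 * ((2 * k : ℕ) + 4))) / 2) (γ/100) K0 m P) ∧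
      ∃ c', c' ≤ 1 ∧ Cst (γ/100) (γ/100/8) η₁ η₂ c c' ν ε (2 * K0 / (γ / (24 * ((2 * k : ℕ) + 4))))
        (2 ^ (2 * (k + 1)) / ζ) (2 * k) := by
  obtain ⟨k0, hk0⟩ := exists_nat_ge (3 / 4 / γ)
  refine ⟨k0 + 3, ?_, ?_⟩
  · rw [div_le_iff₀ hγ0] at hk0
    push_cast
    linarith
  set k := k0 + 3 with hk
  set κ := γ / 100 with hκ
  have κ0 : 0 < κ := by positivity
  have κ1 : κ ≤ 1 / 2 := by rw [hκ]; linarith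
  set δ := κ / 8 with hδ
  have δ0 : 0 < δ := by positivity
  obtain ⟨η₁, e10, e11, e12⟩ : ∃ η₁ : ℝ, 0 < η₁ ∧ η₁ ≤ δ / 2 * (κ / 32) ^ (2 * k + 2) / 64 ∧ η₁ ≤ κ / 2 :=
    ⟨min (δ / 2 * (κ / 32) ^ (2 * k + 2) / 64) (κ / 2), lt_min (by positivity) (by positivity),
      min_le_left _ _, min_le_right _ _⟩
  have e13 : η₁ ≤ 1 := by linarith
  have s1 := sg_pos e10
  have s1' := sg_le e10 e13
  obtain ⟨c, hc⟩ : ∃ c, c = κ * sg η₁ ^ 2 * η₁ / 8 := ⟨_, rfl⟩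
  have c0 : 0 < c := by rw [hc]; positivity
  have c1 : c ≤ 1 := by
    have : κ * sg η₁ ^ 2 * η₁ ≤ 1 * 1 ^ 2 * 1 := by gcongr; linarith
    rw [hc]; linarith
  obtain ⟨ν, hν⟩ : ∃ ν, ν = c ^ 2 / 128 := ⟨_, rfl⟩
  have ν0 : 0 < ν := by rw [hν]; positivity
  have ν1 : ν ≤ 1 := by
    have : c ^ 2 ≤ 1 := by nlinarith
    rw [hν]; linarith
  obtain ⟨η₂, hη₂⟩ : ∃ η₂, η₂ = κ * ν ^ 2 / 1000 := ⟨_, rfl⟩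
  have e20 : 0 < η₂ := by rw [hη₂]; positivity
  have e21 : η₂ ≤ 1 := by
    have : κ * ν ^ 2 ≤ 1 * 1 ^ 2 := by gcongr; linarith
    rw [hη₂]; linarith
  have s2 := sg_pos e20
  obtain ⟨ε, hε, hε1, hε2⟩ : ∃ ε : ℝ, 0 < ε ∧ ε ≤ sg η₁ ^ 2 ∧ ε ≤ sg η₂ ^ 2 :=
    ⟨min (sg η₁ ^ 2) (sg η₂ ^ 2), lt_min (by positivity) (by positivity), min_le_left _ _, min_le_right _ _⟩
  have hε3 : ε ≤ 1 := hε1.trans (by nlinarith)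
  set ρ := γ / (24 * (((2 * k : ℕ) : ℝ) + 4)) with hρ
  have ρ0 : 0 < ρ := by positivity
  have ρ1 : ρ ≤ 1 := by
    rw [hρ, div_le_one (by positivity)]
    have : (0:ℝ) ≤ ((2 * k : ℕ) : ℝ) := by positivity
    linarith
  have hεr : ε * ρ / 2 ≤ 1 := by nlinarith
  obtain ⟨K0, hK0, N, hN⟩ := sparse_reg (κ' := κ ^ 2) κ0 κ1 hεr (by positivity) (by positivity) κ0 κ1
  have hK : 0 < 2 * K0 / ρ := by positivity
  have hM : (0:ℝ) < 2 ^ (2 * (k + 1)) / ζ := by positivity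
  refine ⟨η₁, η₂, c, ν, ε, K0, hK0, c0, c1, ⟨N, hN⟩,
    min (c / 16) (δ / 2 * c ^ (2 * (2 * k)) / (2 ^ (2 * (k + 1)) / ζ * (2 * K0 / ρ) ^ (2 * (2 * k)))), ?_, ?_⟩
  · exact (min_le_left _ _).trans (by linarith)
  refine ⟨κ0, by linarith, δ0, le_refl _, e10, e13, e20, e21, by omega, e11, e12, hc,
    lt_min (by positivity) (by positivity), min_le_left _ _, hν, hη₂.le, hε, hε1, hε2, ?_, ?_, ?_⟩
  · exact hK
  · exact hM
  · have h := min_le_right (c / 16) (δ / 2 * c ^ (2 * (2 * k)) / (2 ^ (2 * (k + 1)) / ζ * (2 * K0 / ρ) ^ (2 * (2 * k))))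
    rw [le_div_iff₀ (by positivity), ← mul_assoc] at h
    exact h

lemma main_bad {γ ζ : ℝ} (hγ0 : 0 < γ) (hγ : γ ≤ 1 / 4) (hζ : 0 < ζ) :
    ∃ N : ℕ, ∀ n : ℕ, N ≤ n → ∀ p : ℝ, (n : ℝ) ^ (γ - 1 / 2) ≤ p → p ≤ 1 →
      Pr p (fun ω : Sym2 (Fin n) → Bool => ¬ Good γ ω) ≤ 5 * ζ := by
  obtain ⟨k, hk, η₁, η₂, c, ν, ε, K0, hK0, c0, c1, ⟨N0, hN0⟩, c', c1', C⟩ := consts hγ0 hγ hζ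
  obtain ⟨ρ, hρ⟩ : ∃ ρ, ρ = γ / (24 * (((2 * k : ℕ) : ℝ) + 4)) := ⟨_, rfl⟩
  have ρ0 : 0 < ρ := by rw [hρ]; positivity
  have ρ1 : ρ ≤ 1 := by
    rw [hρ, div_le_one (by positivity)]
    have : (0:ℝ) ≤ ((2 * k : ℕ) : ℝ) := by positivity
    linarith
  rw [← hρ] at hN0 C
  obtain ⟨K, hK⟩ : ∃ K, K = 2 * K0 / ρ := ⟨_, rfl⟩
  rw [← hK] at C
  have K1 : 1 ≤ K := by
    rw [hK, le_div_iff₀ ρ0]; linarith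
  have c0' := C.hc'
  have κ0 := C.hκ
  obtain ⟨η0, hη0⟩ : ∃ η0, η0 = c * c' / (256 * K) := ⟨_, rfl⟩
  have h00 : 0 < η0 := by rw [hη0]; positivity
  have h01 : η0 ≤ 1 := by
    rw [hη0, div_le_one (by positivity)]
    have : c * c' ≤ 1 * 1 := by gcongr
    linarith
  obtain ⟨N1, H1⟩ := deg_event hγ0 (η := γ / 4) (by positivity) (by linarith) hζ
  obtain ⟨N2, H2⟩ := disc_event hγ0 κ0 C.hκ1 h00 hζ
  obtain ⟨N3, H3⟩ := inh_event hγ0 κ0 C.a1 C.a1' hζ (lt_of_lt_of_le one_pos K1)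
  obtain ⟨N4, H4⟩ := inh_event hγ0 κ0 C.a2 C.a2' hζ (lt_of_lt_of_le one_pos K1)
  obtain ⟨N5, H5⟩ := p4_event hγ0 hk hζ
  obtain ⟨N6, H6⟩ := np2_const hγ0 (1 / η0)
  obtain ⟨N7, H7⟩ := exists_nat_ge (2 * K0 / ρ + (16 * K0 / γ) ^ 2 + 16 * K0 * CR ⌊K0⌋₊ (2 * k + 4) / γ
    + 6 / γ + 6 * (((2 * k : ℕ) : ℝ) + 4))
  refine ⟨N0 + N1 + N2 + N3 + N4 + N5 + N6 + N7 + 1, fun n hn p hp hp1 => ?_⟩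
  have hp0 := p_pos (by omega) hp
  have H7' : (N7 : ℝ) ≤ n := by exact_mod_cast (by omega : N7 ≤ n)
  have q1 : 0 ≤ 2 * K0 / ρ := by positivity
  have q2 : 0 ≤ (16 * K0 / γ) ^ 2 := by positivity
  have q3 : 0 ≤ 16 * K0 * CR ⌊K0⌋₊ (2 * k + 4) / γ := by positivity
  have q4 : 0 ≤ 6 / γ := by positivity
  have q5 : 0 ≤ 6 * (((2 * k : ℕ) : ℝ) + 4) := by positivity
  have hnp : 1 ≤ η0 * n * p := by
    have h := H6 n (by omega) p hp
    rw [div_le_iff₀ h00] at h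
    calc (1:ℝ) ≤ n * p ^ 2 * η0 := h
      _ = (η0 * n * p) * p := by ring
      _ ≤ (η0 * n * p) * 1 := by gcongr
      _ = _ := by ring
  have key : ∀ ω : Sym2 (Fin n) → Bool, ¬ Good γ ω →
      ((((¬ ∀ v : Fin n, (1 - γ / 4) * n * p ≤ ((graphOf ω).neighborSet v).ncard) ∨
      ¬ Disc (graphOf ω) p (γ / 100) ⌈η0 * n * p⌉₊) ∨
      ¬ ∀ s : ℕ, s ≤ n → (n : ℝ) ≤ K * s → Inh (graphOf ω) p (γ / 100) η₁ (sg η₁) s) ∨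
      ¬ ∀ s : ℕ, s ≤ n → (n : ℝ) ≤ K * s → Inh (graphOf ω) p (γ / 100) η₂ (sg η₂) s) ∨
      ¬ (#(P4set (graphOf ω) (2 * (k + 1))) : ℝ) ≤
        2 ^ (2 * (k + 1)) / ζ * ((n : ℝ) ^ (4 * (k + 1) - 4) * p ^ (8 * (k + 1) - 8)) := by
    intro ω hω
    by_contra hb
    simp only [not_or, not_not] at hb
    obtain ⟨⟨⟨⟨b1, b2⟩, b3⟩, b4⟩, b5⟩ := hb
    apply hω
    intro G hG hd
    have hU : ⌈η0 * n * p⌉₊ ≤ #(univ : Finset (Fin n)) := by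
      rw [Finset.card_univ, Fintype.card_fin, Nat.ceil_le]
      calc η0 * n * p ≤ 1 * n * 1 := by gcongr
        _ = n := by ring
    have hE : (eG G univ univ : ℝ) ≤ 4 * p * n ^ 2 := by
      have h1 := b2.2 univ univ hU hU
      rw [Finset.card_univ, Fintype.card_fin] at h1
      have h2 : (eG G univ univ : ℝ) ≤ eG (graphOf ω) univ univ := by
        exact_mod_cast eG_mono_graph hG univ univ
      calc _ ≤ _ := h2
        _ ≤ _ := h1
        _ = _ := by ring
    obtain ⟨m, P, hR⟩ := hN0 n (by omega) G p hp0 hE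
    have i1 : 4 * (k + 1) - 4 = 2 * (2 * k) := by omega
    have i2 : 8 * (k + 1) - 8 = 4 * (2 * k) := by omega
    rw [i1, i2] at b5
    exact final_det C hγ0 hγ rfl hρ hK0 hK hη0 hG hp0 hp1 b2 hnp b3 b4 b5 hR
      (fun v => deg_sub hG hγ0 hγ hp0.le v (b1 v) (hd v))
      (by linarith) (by linarith) (by linarith) (by linarith) (by linarith)
  refine (Pr_mono hp0.le hp1 key).trans ?_
  refine (Pr_or hp0.le hp1 _ _).trans ?_
  have t4 := H5 n (by omega) p hp hp1
  have t3 := (Pr_or hp0.le hp1 (E := Sym2 (Fin n)) (fun ω => (((¬ ∀ v : Fin n, (1 - γ / 4) * n * p ≤ ((graphOf ω).neighborSet v).ncard) ∨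
      ¬ Disc (graphOf ω) p (γ / 100) ⌈η0 * n * p⌉₊) ∨
      ¬ ∀ s : ℕ, s ≤ n → (n : ℝ) ≤ K * s → Inh (graphOf ω) p (γ / 100) η₁ (sg η₁) s)) (fun ω => 
      ¬ ∀ s : ℕ, s ≤ n → (n : ℝ) ≤ K * s → Inh (graphOf ω) p (γ / 100) η₂ (sg η₂) s))
  have t2 := (Pr_or hp0.le hp1 (E := Sym2 (Fin n)) (fun ω => ((¬ ∀ v : Fin n, (1 - γ / 4) * n * p ≤ ((graphOf ω).neighborSet v).ncard) ∨
      ¬ Disc (graphOf ω) p (γ / 100) ⌈η0 * n * p⌉₊)) (fun ω => 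
      ¬ ∀ s : ℕ, s ≤ n → (n : ℝ) ≤ K * s → Inh (graphOf ω) p (γ / 100) η₁ (sg η₁) s))
  have t1 := (Pr_or hp0.le hp1 (E := Sym2 (Fin n)) (fun ω => (¬ ∀ v : Fin n, (1 - γ / 4) * n * p ≤ ((graphOf ω).neighborSet v).ncard))
      (fun ω => ¬ Disc (graphOf ω) p (γ / 100) ⌈η0 * n * p⌉₊))
  have u1 := H1 n (by omega) p hp hp1
  have u2 := H2 n (by omega) p hp hp1
  have u3 := H3 n (by omega) p hp hp1
  have u4 := H4 n (by omega) p hp hp1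
  linarith

lemma Good_mono {γ γ' : ℝ} (h : γ' ≤ γ) {n : ℕ} (ω : Sym2 (Fin n) → Bool) (hω : Good γ' ω) : Good γ ω := by
  intro G hG hd
  obtain ⟨m, h1, h2⟩ := hω G hG (fun v => (hd v).trans (by gcongr))
  exact ⟨m, le_trans (by gcongr) h1, h2⟩

lemma main_all {γ ζ : ℝ} (hγ0 : 0 < γ) (hζ : 0 < ζ) :
    ∃ N : ℕ, ∀ n : ℕ, N ≤ n → ∀ p : ℝ, (n : ℝ) ^ (γ - 1 / 2) ≤ p → p ≤ 1 → 0 ≤ p →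
      Pr p (fun ω : Sym2 (Fin n) → Bool => ¬ Good γ ω) ≤ ζ := by
  obtain ⟨N, hN⟩ := main_bad (γ := min γ (1 / 4)) (ζ := ζ / 5) (lt_min hγ0 (by norm_num)) (min_le_right _ _)
    (by positivity)
  refine ⟨N + 1, fun n hn p hp hp1 hp0 => ?_⟩
  have h1 : (n : ℝ) ^ (min γ (1 / 4) - 1 / 2) ≤ p := by
    refine le_trans (Real.rpow_le_rpow_of_exponent_le ?_ ?_) hp
    · exact_mod_cast (by omega : 1 ≤ n)
    · have := min_le_left γ (1 / 4)
      linarith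
  have h2 := hN n (by omega) p h1 hp1
  refine (Pr_mono hp0 hp1 (fun ω hω h => hω (Good_mono (min_le_left _ _) ω h))).trans (h2.trans ?_)
  linarith

lemma main_tendsto (γ : ℝ) (hγ : 0 < γ) (p : ℕ → ℝ) (hp : ∀ n, 0 ≤ p n ∧ p n ≤ 1)
    (hpge : ∀ᶠ n : ℕ in atTop, (n : ℝ) ^ (γ - 1 / 2) ≤ p n) :
    Tendsto (fun n : ℕ => gnp n (p n) {ω | Good γ ω}) atTop (𝓝 1) := by
  have e : (fun n : ℕ => gnp n (p n) {ω | Good γ ω})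
      = fun n : ℕ => ENNReal.ofReal (1 - Pr (p n) (fun ω : Sym2 (Fin n) → Bool => ¬ Good γ ω)) := by
    funext n
    rw [gnp_eq n (hp n).1 (hp n).2, Pr_not]
    rfl
  have h : Tendsto (fun n : ℕ => Pr (p n) (fun ω : Sym2 (Fin n) → Bool => ¬ Good γ ω)) atTop (𝓝 0) := by
    rw [Metric.tendsto_atTop']
    intro ζ hζ
    obtain ⟨N, hN⟩ := main_all hγ (half_pos hζ)
    obtain ⟨N', hN'⟩ := eventually_atTop.1 hpge
    refine ⟨N + N', fun n hn => ?_⟩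
    have h1 := hN n (by omega) (p n) (hN' n (by omega)) (hp n).2 (hp n).1
    rw [Real.dist_eq, sub_zero, abs_of_nonneg (Pr_nonneg (hp n).1 (hp n).2 _)]
    linarith
  rw [e]
  have h2 := ENNReal.tendsto_ofReal (h.const_sub 1)
  simpa using h2

end NS

/-- **Noever–Steger theorem.** For every `γ > 0`, if `p ≥ n^{γ - 1/2}` then a.a.s. every
spanning subgraph of `G(n,p)` obtained by deleting at most `(1/3 - γ)·deg(v)` edges at each
vertex `v` contains the square of a cycle on at least `(1-γ)n` vertices. -/
theorem stmt_19 (γ : ℝ) (hγ : 0 < γ) (p : ℕ → ℝ) (hp : ∀ n, 0 ≤ p n ∧ p n ≤ 1)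
    (hpge : ∀ᶠ n : ℕ in atTop, (n : ℝ) ^ (γ - 1 / 2) ≤ p n) :
    Tendsto (fun n : ℕ => gnp n (p n)
      {ω | ∀ G : SimpleGraph (Fin n), G ≤ graphOf ω →
        (∀ v : Fin n, (((graphOf ω).neighborSet v \ G.neighborSet v).ncard : ℝ) ≤
          (1 / 3 - γ) * ((graphOf ω).neighborSet v).ncard) →
        ∃ m : ℕ, (1 - γ) * (n : ℝ) ≤ (m : ℝ) ∧ ContainsCopy (cycleSquare m) G})
      atTop (𝓝 1) := by
  exact NS.main_tendsto γ hγ p hp hpge
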